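/- arXiv:1504.02970 — 3 statements merged into one kernel-verified Lean document; each statement's English description precedes it below -/
import Mathlib

section
/- The Schofield semi-invariants s^±_{i;j,k}, for all labels ±(i;j,k) with i = j + k and 1 ≤ i ≤ l, are algebraically independent elements of the semi-invariant ring SI_{β_l}(K^2_{l,l}) over the base field k. -/
noncomputable section

/-! ## Representations of the flagged Kronecker quiver `K^2_{l,l}` and
Schofield semi-invariants (matrices in source×target convention, acting on row vectors). -/

/-- A representation of `K^2_{l,l}` of the standard dimension vector `β_l(v) = |v|`, with
entries in a commutative ring `R`.  `neg t` is the matrix of the arrow `−(t+1) → −(t+2)`,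
`pos t` that of `t+2 → t+1`, and `kr 0, kr 1` those of the two arrows `a_1, a_2 : −l → l`. -/
structure RepK2 (l : ℕ) (R : Type) [CommRing R] where
  neg : ∀ t : Fin (l - 1), Matrix (Fin (t.1 + 1)) (Fin (t.1 + 2)) R
  pos : ∀ t : Fin (l - 1), Matrix (Fin (t.1 + 2)) (Fin (t.1 + 1)) R
  kr : Fin 2 → Matrix (Fin l) (Fin l) R

variable {R : Type} [CommRing R] {l : ℕ}

/-- Padding a rectangular matrix into the top-left corner of an `l×l` matrix. -/
def padM {a b : ℕ} (l : ℕ) (A : Matrix (Fin a) (Fin b) R) : Matrix (Fin l) (Fin l) R :=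
  fun r c => if h : r.1 < a ∧ c.1 < b then A ⟨r.1, h.1⟩ ⟨c.1, h.2⟩ else 0

/-- The product of the (padded) matrices along the negative arm from `−i` to `−l`;
its top-left `i×l` block is the matrix of that path. -/
def chainNeg (M : RepK2 l R) (i : ℕ) : Matrix (Fin l) (Fin l) R :=
  ((List.range (l - i)).map fun d =>
    if h : i - 1 + d < l - 1 then padM l (M.neg ⟨i - 1 + d, h⟩) else 1).prod

/-- The product of the (padded) matrices along the positive arm from `l` down to `j`;
its top-left `l×j` block is the matrix of that path. -/
def chainPos (M : RepK2 l R) (j : ℕ) : Matrix (Fin l) (Fin l) R :=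
  ((List.range (l - j)).map fun d =>
    if h : l - 2 - d < l - 1 then padM l (M.pos ⟨l - 2 - d, h⟩) else 1).prod

/-- The matrix of the unique path from `−i` to `j` through the arrow `a_{ε+1}`. -/
def pathMat (M : RepK2 l R) (ε : Fin 2) (i j : ℕ) (hi : i ≤ l) (hj : j ≤ l) :
    Matrix (Fin i) (Fin j) R :=
  (chainNeg M i * M.kr ε * chainPos M j).submatrix (Fin.castLE hi) (Fin.castLE hj)

/-- The Schofield semi-invariant `s_{i;j,k}` (`i = j + k`), the determinant of
`Hom(f_{i;j,k}, −)` for the presentation `f_{i;j,k} : P_j ⊕ P_k → P_{−i}` given by the paths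
`p¹_{−i,j}` and `p²_{−i,k}` (with the convention `P_0 = 0`). -/
def sPos (M : RepK2 l R) (j k : ℕ) (h : j + k ≤ l) : R :=
  Matrix.det (Matrix.of fun (r c : Fin (j + k)) =>
    Sum.elim
      (fun cj : Fin j => pathMat M 0 (j + k) j h (by omega) r cj)
      (fun ck : Fin k => pathMat M 1 (j + k) k h (by omega) r ck)
      (finSumFinEquiv.symm c))

/-- The Schofield semi-invariant `s_{j,k;i}` (`i = j + k`), the determinant of
`Hom(f_{j,k;i}, −)` for the presentation `f_{j,k;i} : P_i → P_{−j} ⊕ P_{−k}` given by the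
paths `p¹_{−j,i}` and `p²_{−k,i}`. -/
def sNeg (M : RepK2 l R) (j k : ℕ) (h : j + k ≤ l) : R :=
  Matrix.det (Matrix.of fun (r c : Fin (j + k)) =>
    Sum.elim
      (fun rj : Fin j => pathMat M 0 j (j + k) (by omega) h rj c)
      (fun rk : Fin k => pathMat M 1 k (j + k) (by omega) h rk c)
      (finSumFinEquiv.symm r))

/-- Ambient vertex labels of the diamond quiver: `(true, j, k)` is `(i;j,k)` and
`(false, j, k)` is `(j,k;i)`, with `i = j + k`; horizontal labels are identified with
canonical sign `true`. -/
abbrev VT : Type := Bool × ℕ × ℕ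

/-- Canonical representative of a label. -/
def canon (v : VT) : VT := if v.2.1 = 0 ∨ v.2.2 = 0 then (true, v.2.1, v.2.2) else v

/-- The labels `±(i;j,k)` with `1 ≤ i = j + k ≤ l`, the vertex set of `Diamond_l`. -/
def IsVert (l : ℕ) (v : VT) : Prop := canon v = v ∧ 1 ≤ v.2.1 + v.2.2 ∧ v.2.1 + v.2.2 ≤ l

/-- The Schofield semi-invariant `s^±_{i;j,k}` attached to a label. -/
def sLab (M : RepK2 l R) (v : VT) : R :=
  if h : v.2.1 + v.2.2 ≤ l then
    (if v.1 = true then sPos M v.2.1 v.2.2 h else sNeg M v.2.1 v.2.2 h)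
  else 0

/-- The `n × n` minor of the infinite array `F` with top-left corner `(a, b)`. -/
def arrayMinor {K : Type*} [CommRing K] (F : ℕ → ℕ → K) (a b n : ℕ) : K :=
  Matrix.det (Matrix.of fun p q : Fin n => F (a + p) (b + q))

theorem arrayMinor_zero {K : Type*} [CommRing K] (F : ℕ → ℕ → K) (a b : ℕ) :
    arrayMinor F a b 0 = 1 := by
  simp [arrayMinor]

/-- Adding `x` to the bottom-right entry of a square matrix changes the determinant by `x` times
the complementary minor. -/
theorem Matrix.det_add_last_entry {K : Type*} [CommRing K] {n : ℕ}
    (A B : Matrix (Fin (n + 1)) (Fin (n + 1)) K) (x : K)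
    (hB : ∀ p q, B p q = A p q + if p = Fin.last n ∧ q = Fin.last n then x else 0) :
    B.det = A.det + x * (A.submatrix Fin.castSucc Fin.castSucc).det := by
  rw [Matrix.det_succ_row B (Fin.last n), Matrix.det_succ_row A (Fin.last n),
    Fin.sum_univ_castSucc, Fin.sum_univ_castSucc]
  have hsub : ∀ q : Fin (n + 1), B.submatrix (Fin.last n).succAbove q.succAbove =
      A.submatrix (Fin.last n).succAbove q.succAbove := by
    intro q
    ext p r
    simp [hB, Fin.castSucc_ne_last]
  simp only [hsub]
  simp only [hB, Fin.castSucc_ne_last, and_false, if_false, add_zero, and_self, if_true,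
    Fin.succAbove_last]
  have hs : ((-1 : K)) ^ ((Fin.last n : ℕ) + (Fin.last n : ℕ)) = 1 := by
    simp
  rw [hs]
  ring

theorem arrayMinor_congr {K : Type*} [CommRing K] {F G : ℕ → ℕ → K} {a b n : ℕ}
    (h : ∀ p < n, ∀ q < n, F (a + p) (b + q) = G (a + p) (b + q)) :
    arrayMinor F a b n = arrayMinor G a b n := by
  unfold arrayMinor
  congr 1
  ext p q
  exact h p p.2 q q.2

theorem arrayMinor_succ_of_eq_add {K : Type*} [CommRing K] {F G : ℕ → ℕ → K} {a b n : ℕ} (x : K)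
    (h : ∀ p ≤ n, ∀ q ≤ n, G (a + p) (b + q) = F (a + p) (b + q) + if p = n ∧ q = n then x else 0) :
    arrayMinor G a b (n + 1) = arrayMinor F a b (n + 1) + x * arrayMinor F a b n := by
  unfold arrayMinor
  rw [Matrix.det_add_last_entry (A := Matrix.of fun p q : Fin (n + 1) => F (a + p) (b + q)) (x := x)]
  · rfl
  · intro p q
    simp only [Matrix.of_apply, Fin.ext_iff, Fin.val_last]
    exact h p (by omega) q (by omega)

/-- The initial minors of an array (those touching the first row or the first column) can be
prescribed arbitrarily among nonzero values, as long as the bottom-right corners lie in a bounded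
region. -/
theorem exists_array_of_initial_minors {K : Type*} [Field K] (T : ℕ → ℕ → K)
    (hT : ∀ r c, T r c ≠ 0) (n : ℕ) :
    ∃ F : ℕ → ℕ → K, ∀ a b j, a = 0 ∨ b = 0 → a + b + 2 * j < n →
      arrayMinor F a b (j + 1) = T (a + j) (b + j) := by
  induction n with
  | zero => exact ⟨0, fun a b j _ h => by omega⟩
  | succ n ih =>
    obtain ⟨F, hF⟩ := ih
    have key : ∀ r c, r + c = n → arrayMinor F (r - min r c) (c - min r c) (min r c) ≠ 0 := by
      intro r c hrc
      rcases Nat.eq_zero_or_pos (min r c) with h | h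
      · rw [h, arrayMinor_zero]
        exact one_ne_zero
      · obtain ⟨m, hm⟩ : ∃ m, min r c = m + 1 := ⟨min r c - 1, by omega⟩
        rw [hm, hF _ _ _ (by omega) (by omega)]
        exact hT _ _
    let δ : ℕ → ℕ → K := fun r c =>
      (T r c - arrayMinor F (r - min r c) (c - min r c) (min r c + 1)) /
        arrayMinor F (r - min r c) (c - min r c) (min r c)
    refine ⟨fun r c => F r c + if r + c = n then δ r c else 0, fun a b j hab hlt => ?_⟩
    rcases Nat.lt_succ_iff_lt_or_eq.mp hlt with h | h
    · rw [← hF a b j hab h]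
      refine arrayMinor_congr fun p hp q hq => ?_
      rw [if_neg (by omega), add_zero]
    · rw [arrayMinor_succ_of_eq_add (F := F) (δ (a + j) (b + j))]
      · have hmin : min (a + j) (b + j) = j := by omega
        have hk := key (a + j) (b + j) (by omega)
        simp only [δ]
        rw [hmin] at hk ⊢
        simp only [Nat.add_sub_cancel] at hk ⊢
        rw [div_mul_cancel₀ _ hk]
        ring
      · intro p hp q hq
        by_cases hpq : p = j ∧ q = j
        · obtain ⟨rfl, rfl⟩ := hpq
          rw [if_pos (by omega), if_pos ⟨rfl, rfl⟩]
        · rw [if_neg (by omega), if_neg hpq]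

/-- The identification of `Fin j ⊕ Fin k` with `Fin (j + k)` placing the second block first. -/
def swapSumFinEquiv (j k : ℕ) : Fin j ⊕ Fin k ≃ Fin (j + k) :=
  (Equiv.sumComm _ _).trans (finSumFinEquiv.trans (finCongr (Nat.add_comm k j)))

/-- The sign of the permutation interchanging blocks of sizes `j` and `k`. -/
def blockSign (j k : ℕ) : ℤˣ :=
  Equiv.Perm.sign (finSumFinEquiv.symm.trans (swapSumFinEquiv j k))

/-- Determinant of a matrix `[X | D]` with `D` diagonal. -/
theorem det_columns_diagonal {K : Type*} [CommRing K] (X : ℕ → ℕ → K) (d : ℕ → K) (j k : ℕ) :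
    Matrix.det (Matrix.of fun (r c : Fin (j + k)) =>
      Sum.elim (fun cj : Fin j => X r cj)
        (fun ck : Fin k => if (r : ℕ) = ck then d r else 0) (finSumFinEquiv.symm c)) =
      ((blockSign j k : ℤˣ) : ℤ) * (arrayMinor X k 0 j * ∏ q ∈ Finset.range k, d q) := by
  set N : Matrix (Fin (j + k)) (Fin (j + k)) K := Matrix.of fun (r c : Fin (j + k)) =>
      Sum.elim (fun cj : Fin j => X r cj)
        (fun ck : Fin k => if (r : ℕ) = ck then d r else 0) (finSumFinEquiv.symm c) with hN
  set σ : Equiv.Perm (Fin (j + k)) := finSumFinEquiv.symm.trans (swapSumFinEquiv j k) with hσ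
  have h1 := Matrix.det_permute σ N
  have h2 : ((N.submatrix σ id).submatrix finSumFinEquiv finSumFinEquiv :
      Matrix (Fin j ⊕ Fin k) (Fin j ⊕ Fin k) K) =
      Matrix.fromBlocks (Matrix.of fun p q : Fin j => X (k + p) (0 + q)) 0
        (Matrix.of fun (p : Fin k) (q : Fin j) => X p q)
        (Matrix.diagonal fun q : Fin k => d q) := by
    ext p q
    rcases p with p | p <;> rcases q with q | q
    · simp [hN, hσ, swapSumFinEquiv, Nat.add_comm]
    · have : (p : ℕ) + k ≠ q := by omega
      simp [hN, hσ, swapSumFinEquiv, this]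
    · simp [hN, hσ, swapSumFinEquiv]
    · simp [hN, hσ, swapSumFinEquiv, Matrix.diagonal_apply, Fin.ext_iff]
  have h3 := Matrix.det_submatrix_equiv_self finSumFinEquiv (N.submatrix σ id)
  rw [h2, Matrix.det_fromBlocks_zero₁₂, Matrix.det_diagonal, h1] at h3
  have h4 : (((Equiv.Perm.sign σ : ℤˣ) : ℤ) : K) * ((Equiv.Perm.sign σ : ℤˣ) : ℤ) = 1 := by
    rw [← Int.cast_mul, ← Units.val_mul, Int.units_mul_self]
    simp
  have h5 : N.det = (((Equiv.Perm.sign σ : ℤˣ) : ℤ) : K) *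
      ((((Equiv.Perm.sign σ : ℤˣ) : ℤ) : K) * N.det) := by
    rw [← mul_assoc, h4, one_mul]
  rw [h5, ← h3, Finset.prod_range]
  rfl

/-- Matrices whose first `i` rows and columns are those of the identity form a submonoid. -/
def leadingIdentity (l i : ℕ) (R : Type) [CommRing R] : Submonoid (Matrix (Fin l) (Fin l) R) where
  carrier := {A | ∀ r c : Fin l, r.1 < i ∨ c.1 < i → A r c = if r = c then 1 else 0}
  one_mem' := fun r c _ => Matrix.one_apply
  mul_mem' := by
    intro A B hA hB r c h
    rw [Matrix.mul_apply]
    rcases h with h | h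
    · rw [Finset.sum_congr rfl fun x _ => by rw [hA r x (Or.inl h)]]
      simp [hB r c (Or.inl h)]
    · rw [Finset.sum_congr rfl fun x _ => by rw [hB x c (Or.inr h)]]
      simp [hA r c (Or.inr h)]

theorem padM_mem_leadingIdentity {a b i : ℕ} (A : Matrix (Fin a) (Fin b) R) (ha : i ≤ a)
    (hb : i ≤ b) (hA : ∀ r c, A r c = if r.1 = c.1 then 1 else 0) :
    padM l A ∈ leadingIdentity l i R := by
  intro r c h
  unfold padM
  by_cases hrc : r = c
  · subst hrc
    rw [dif_pos (by omega), hA]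
    simp
  · have : r.1 ≠ c.1 := fun h => hrc (Fin.ext h)
    split_ifs
    · simp [hA, this]
    · rfl

/-- The representation whose arms are the standard inclusions and projections and whose Kronecker
arrows are an array `X` and the diagonal matrix with entries `d`. -/
def standardRep (l : ℕ) (X : ℕ → ℕ → R) (d : ℕ → R) : RepK2 l R where
  neg := fun _ r c => if r.1 = c.1 then 1 else 0
  pos := fun _ r c => if r.1 = c.1 then 1 else 0
  kr := ![fun r c => X r c, fun r c => if r.1 = c.1 then d r else 0]

theorem chainNeg_standardRep_mem (X : ℕ → ℕ → R) (d : ℕ → R) (i : ℕ) :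
    chainNeg (standardRep l X d) i ∈ leadingIdentity l i R := by
  refine Submonoid.list_prod_mem _ fun A hA => ?_
  obtain ⟨e, -, rfl⟩ := List.mem_map.mp hA
  split_ifs
  · exact padM_mem_leadingIdentity _ (by simp only; omega) (by simp only; omega) (fun _ _ => rfl)
  · exact Submonoid.one_mem _

theorem chainPos_standardRep_mem (X : ℕ → ℕ → R) (d : ℕ → R) (j : ℕ) :
    chainPos (standardRep l X d) j ∈ leadingIdentity l j R := by
  refine Submonoid.list_prod_mem _ fun A hA => ?_
  obtain ⟨e, he, rfl⟩ := List.mem_map.mp hA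
  rw [List.mem_range] at he
  split_ifs
  · exact padM_mem_leadingIdentity _ (by simp only; omega) (by simp only; omega) (fun _ _ => rfl)
  · exact Submonoid.one_mem _

theorem pathMat_standardRep (X : ℕ → ℕ → R) (d : ℕ → R) (ε : Fin 2) {i j : ℕ} (hi : i ≤ l)
    (hj : j ≤ l) (r : Fin i) (c : Fin j) :
    pathMat (standardRep l X d) ε i j hi hj r c =
      (standardRep l X d).kr ε (Fin.castLE hi r) (Fin.castLE hj c) := by
  have hA := chainNeg_standardRep_mem (l := l) X d i
  have hB := chainPos_standardRep_mem (l := l) X d j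
  unfold pathMat
  rw [Matrix.submatrix_apply, Matrix.mul_apply,
    Finset.sum_congr rfl fun x _ => by rw [hB x (Fin.castLE hj c) (Or.inr c.2)]]
  simp only [mul_ite, mul_one, mul_zero, Finset.sum_ite_eq', Finset.mem_univ, if_true]
  rw [Matrix.mul_apply,
    Finset.sum_congr rfl fun x _ => by rw [hA (Fin.castLE hi r) x (Or.inl r.2)]]
  simp

theorem sPos_standardRep (X : ℕ → ℕ → R) (d : ℕ → R) {j k : ℕ} (h : j + k ≤ l) :
    sPos (standardRep l X d) j k h =
      ((blockSign j k : ℤˣ) : ℤ) * (arrayMinor X k 0 j * ∏ q ∈ Finset.range k, d q) := by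
  rw [← det_columns_diagonal]
  unfold sPos
  simp only [pathMat_standardRep]
  rfl

theorem sNeg_standardRep (X : ℕ → ℕ → R) (d : ℕ → R) {j k : ℕ} (h : j + k ≤ l) :
    sNeg (standardRep l X d) j k h =
      ((blockSign j k : ℤˣ) : ℤ) * (arrayMinor X 0 k j * ∏ q ∈ Finset.range k, d q) := by
  have htr : arrayMinor X 0 k j = arrayMinor (fun r c => X c r) k 0 j := by
    unfold arrayMinor
    rw [← Matrix.det_transpose]
    rfl
  rw [htr, ← det_columns_diagonal, ← Matrix.det_transpose]
  unfold sNeg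
  simp only [pathMat_standardRep]
  congr 1
  ext r c
  simp only [Matrix.transpose_apply, Matrix.of_apply]
  congr 1
  ext q
  change (if (q : ℕ) = c then d q else 0) = if (c : ℕ) = q then d c else 0
  by_cases hq : (q : ℕ) = c
  · rw [if_pos hq, if_pos hq.symm, hq]
  · rw [if_neg hq, if_neg (Ne.symm hq)]

/-- Every family of nonzero scalars is the family of values of the Schofield semi-invariants at
some representation. -/
theorem exists_rep_sLab_eq {K : Type} [Field K] (l : ℕ) (t : VT → K) (ht : ∀ v, t v ≠ 0) :
    ∃ M : RepK2 l K, ∀ v, IsVert l v → sLab M v = t v := by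
  have hs : ∀ j k, (((blockSign j k : ℤˣ) : ℤ) : K) ≠ 0 := by
    intro j k
    rcases Int.units_eq_one_or (blockSign j k) with h | h <;> simp [h]
  let m : ℕ → K := fun k => if k = 0 then 1 else t (true, 0, k) / ((blockSign 0 k : ℤˣ) : ℤ)
  have hm : ∀ k, m k ≠ 0 := by
    intro k
    simp only [m]
    split_ifs
    · exact one_ne_zero
    · exact div_ne_zero (ht _) (hs _ _)
  let d : ℕ → K := fun q => m (q + 1) / m q
  have hd : ∀ k, ∏ q ∈ Finset.range k, d q = m k := by
    intro k
    induction k with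
    | zero => simp [m]
    | succ k ih => rw [Finset.prod_range_succ, ih, mul_div_cancel₀ _ (hm k)]
  let u : VT → K := fun v => t v / (((blockSign v.2.1 v.2.2 : ℤˣ) : ℤ) * m v.2.2)
  have hu : ∀ v, u v ≠ 0 := fun v => div_ne_zero (ht v) (mul_ne_zero (hs _ _) (hm _))
  have hut : ∀ v : VT, (((blockSign v.2.1 v.2.2 : ℤˣ) : ℤ) : K) * (u v * m v.2.2) = t v := by
    intro v
    rw [mul_left_comm]
    exact div_mul_cancel₀ _ (mul_ne_zero (hs _ _) (hm _))
  obtain ⟨F, hF⟩ := exists_array_of_initial_minors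
    (fun r c => if c ≤ r then u (true, c + 1, r - c) else u (false, r + 1, c - r))
    (fun r c => by split_ifs <;> exact hu _) (2 * l)
  refine ⟨standardRep l F d, ?_⟩
  rintro ⟨s, j, k⟩ ⟨hc, h1, h2⟩
  simp only at h1 h2
  unfold sLab
  rw [dif_pos h2]
  rcases s with _ | _
  · have hjk : j ≠ 0 ∧ k ≠ 0 := by
      by_contra hcon
      have : canon (false, j, k) = (true, j, k) := if_pos (by simp only; tauto)
      simp [this] at hc
    obtain ⟨i, rfl⟩ := Nat.exists_eq_succ_of_ne_zero hjk.1
    rw [if_neg (by simp), sNeg_standardRep, hd, hF _ _ _ (Or.inl rfl) (by dsimp only; omega),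
      if_neg (show ¬ k + i ≤ 0 + i by omega), ← hut]
    simp
  · rw [if_pos rfl, sPos_standardRep, hd]
    rcases j with _ | i
    · have hk : k ≠ 0 := by omega
      simp only [arrayMinor_zero, m, if_neg hk, one_mul]
      exact mul_div_cancel₀ _ (hs _ _)
    · rw [hF _ _ _ (Or.inr rfl) (by dsimp only; omega), if_pos (show 0 + i ≤ k + i by omega), ← hut]
      simp

/-- A finitely indexed family of functions is algebraically independent as soon as it attains all
tuples of nonzero values. -/
theorem algebraicIndependent_of_forall_ne_zero_exists {K ι S : Type*} [Field K] [Infinite K]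
    [Finite ι] (f : ι → S → K) (h : ∀ t : ι → K, (∀ i, t i ≠ 0) → ∃ s, ∀ i, f i s = t i) :
    AlgebraicIndependent K f := by
  cases nonempty_fintype ι
  rw [algebraicIndependent_iff]
  intro p hp
  have hprod : (∏ i, MvPolynomial.X i : MvPolynomial ι K) ≠ 0 :=
    Finset.prod_ne_zero_iff.mpr fun i _ => MvPolynomial.X_ne_zero i
  refine (mul_eq_zero.mp (?_ : p * ∏ i, MvPolynomial.X i = 0)).resolve_right hprod
  refine MvPolynomial.funext fun t => ?_
  rw [map_mul, map_prod, map_zero]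
  by_cases ht : ∀ i, t i ≠ 0
  · obtain ⟨s, hs⟩ := h t ht
    have hev : MvPolynomial.aeval (fun i => f i s) p = 0 := by
      have hp' := congrArg (Pi.evalAlgHom K (fun _ : S => K) s) hp
      rwa [MvPolynomial.comp_aeval_apply, map_zero] at hp'
    rw [funext hs, MvPolynomial.aeval_eq_eval] at hev
    rw [show MvPolynomial.eval t p = 0 from hev, zero_mul]
  · push Not at ht
    obtain ⟨i, hi⟩ := ht
    rw [Finset.prod_eq_zero (Finset.mem_univ i) (by simpa using hi), mul_zero]

theorem finite_isVert (l : ℕ) : Finite {v : VT // IsVert l v} := by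
  refine Set.Finite.to_subtype (Set.Finite.subset
    (Set.finite_univ.prod ((Set.finite_Iic l).prod (Set.finite_Iic l))) ?_)
  rintro ⟨s, j, k⟩ ⟨-, -, h⟩
  simp only at h
  simp only [Set.mem_prod, Set.mem_univ, Set.mem_Iic, true_and]
  omega

/-- **Statement 13**: the Schofield semi-invariants `s^±_{i;j,k}`, for all labels
`±(i;j,k)` with `i = j + k` and `1 ≤ i ≤ l` (with the identifications
`s_{i;i,0} = s_{i,0;i}`, `s_{i;0,i} = s_{0,i;i}`), are algebraically independent elements of
the semi-invariant ring `SI_{β_l}(K^2_{l,l}) ⊆ k[Rep_{β_l}(K^2_{l,l})]`. -/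
theorem statement13 (l : ℕ) (hl : 1 ≤ l) :
    AlgebraicIndependent ℂ
      (fun v : {v : VT // IsVert l v} => (fun M : RepK2 l ℂ => sLab M v.1)) := by
  have := finite_isVert l
  classical
  refine algebraicIndependent_of_forall_ne_zero_exists _ fun t ht => ?_
  obtain ⟨M, hM⟩ := exists_rep_sLab_eq l (fun v => if h : IsVert l v then t ⟨v, h⟩ else 1)
    (fun v => by split_ifs <;> simp [ht])
  exact ⟨M, fun v => by rw [hM v.1 v.2, dif_pos v.2]⟩
end
end

section
/- In SI_{β_l}(K^2_{l,l}) the following exchange identities hold for all admissible indices (with s-symbols of out-of-range index interpreted via the conventions e_0 = 0, P_0 = 0): s^±_{i;j,k} · (s^±_{i;j,k})' = s^±_{i−1;j−1,k} s^±_{i;j+1,k−1} s^±_{i+1;j,k+1} + s^±_{i−1;j,k−1} s^±_{i;j−1,k+1} s^±_{i+1;j+1,k} for non-horizontal mutable labels, and s_{i;i,0} · (s_{i;i,0})' = s_{i−1;i−1,0} s_{i,1;i+1} s_{i+1;i,1} + s_{i−1,1;i} s_{i;i−1,1} s_{i+1;i+1,0} for horizontal mutable labels. -/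
noncomputable section

variable {R : Type} [CommRing R] {l : ℕ}

/-! ## The adjacent cluster variables `(s^±_{i;j,k})'` -/

/-- `(s_{i;j,k})' = (−1)^{jk} s(f'_u)` for a non-horizontal mutable label `u = (i;j,k)`
(`j, k ≥ 1`, `i = j + k < l`): the signed determinant of `Hom(f'_u, −)` for the presentation
`f'_u : P_{j+1} ⊕ P_{j−1} ⊕ P_{k+1} ⊕ P_{k−1} → P_{−(i+1)} ⊕ P_{−(i−1)}` of the paper. -/
def sPosP (M : RepK2 l R) (j k : ℕ) (h1 : 1 ≤ j) (h2 : 1 ≤ k) (h : j + k + 1 ≤ l) : R :=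
  (-1 : R) ^ (j * k) *
  Matrix.det (Matrix.of fun (r c : Fin (2 * (j + k))) =>
    if hr : r.1 < j + k + 1 then
      if hc1 : c.1 < j + 1 then
        pathMat M 0 (j + k + 1) (j + 1) (by omega) (by omega) ⟨r.1, hr⟩ ⟨c.1, hc1⟩
      else if hc2 : c.1 < 2 * j then 0
      else if hc3 : c.1 < 2 * j + (k + 1) then
        pathMat M 1 (j + k + 1) (k + 1) (by omega) (by omega) ⟨r.1, hr⟩ ⟨c.1 - 2 * j, by omega⟩
      else 0
    else
      if hc1 : c.1 < j + 1 then 0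
      else if hc2 : c.1 < 2 * j then
        pathMat M 0 (j + k - 1) (j - 1) (by omega) (by omega)
          ⟨r.1 - (j + k + 1), by omega⟩ ⟨c.1 - (j + 1), by omega⟩
      else if hc3 : c.1 < 2 * j + (k + 1) then
        pathMat M 1 (j + k - 1) (k + 1) (by omega) (by omega)
          ⟨r.1 - (j + k + 1), by omega⟩ ⟨c.1 - 2 * j, by omega⟩
      else
        pathMat M 1 (j + k - 1) (k - 1) (by omega) (by omega)
          ⟨r.1 - (j + k + 1), by omega⟩ ⟨c.1 - (2 * j + (k + 1)), by omega⟩)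

/-- `(s_{j,k;i})' = (−1)^{jk} s(f'_u)` for a non-horizontal mutable negative label
`u = (j,k;i)`, where `f'_u = −f'_{(i;j,k)}` under the involution `p^ε_{−s,t} ↦ p^ε_{−t,s}`. -/
def sNegP (M : RepK2 l R) (j k : ℕ) (h1 : 1 ≤ j) (h2 : 1 ≤ k) (h : j + k + 1 ≤ l) : R :=
  (-1 : R) ^ (j * k) *
  Matrix.det (Matrix.of fun (r c : Fin (2 * (j + k))) =>
    if hc : c.1 < j + k + 1 then
      if hr1 : r.1 < j + 1 then
        pathMat M 0 (j + 1) (j + k + 1) (by omega) (by omega) ⟨r.1, hr1⟩ ⟨c.1, hc⟩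
      else if hr2 : r.1 < 2 * j then 0
      else if hr3 : r.1 < 2 * j + (k + 1) then
        pathMat M 1 (k + 1) (j + k + 1) (by omega) (by omega) ⟨r.1 - 2 * j, by omega⟩ ⟨c.1, hc⟩
      else 0
    else
      if hr1 : r.1 < j + 1 then 0
      else if hr2 : r.1 < 2 * j then
        pathMat M 0 (j - 1) (j + k - 1) (by omega) (by omega)
          ⟨r.1 - (j + 1), by omega⟩ ⟨c.1 - (j + k + 1), by omega⟩
      else if hr3 : r.1 < 2 * j + (k + 1) then
        pathMat M 1 (k + 1) (j + k - 1) (by omega) (by omega)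
          ⟨r.1 - 2 * j, by omega⟩ ⟨c.1 - (j + k + 1), by omega⟩
      else
        pathMat M 1 (k - 1) (j + k - 1) (by omega) (by omega)
          ⟨r.1 - (2 * j + (k + 1)), by omega⟩ ⟨c.1 - (j + k + 1), by omega⟩)

/-- `(s_{i;i,0})' = (−1)^i s(f'_u)` for a horizontal mutable label `u = (i;i,0)` (`i < l`),
for the presentation `f'_u : P_{i+1} ⊕ P_{i−1} ⊕ P_1 → P_{−(i+1)} ⊕ P_{−(i−1)} ⊕ P_{−1}`
of the paper. -/
def sHorP (M : RepK2 l R) (i : ℕ) (h1 : 1 ≤ i) (h : i + 1 ≤ l) : R :=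
  (-1 : R) ^ i *
  Matrix.det (Matrix.of fun (r c : Fin (2 * i + 1)) =>
    if hr : r.1 < i + 1 then
      if hc1 : c.1 < i + 1 then
        pathMat M 0 (i + 1) (i + 1) (by omega) (by omega) ⟨r.1, hr⟩ ⟨c.1, hc1⟩
      else if hc2 : c.1 < 2 * i then
        pathMat M 0 (i + 1) (i - 1) (by omega) (by omega) ⟨r.1, hr⟩ ⟨c.1 - (i + 1), by omega⟩
      else
        pathMat M 1 (i + 1) 1 (by omega) (by omega) ⟨r.1, hr⟩ ⟨c.1 - 2 * i, by omega⟩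
    else if hr2 : r.1 < 2 * i then
      if hc1 : c.1 < i + 1 then
        pathMat M 0 (i - 1) (i + 1) (by omega) (by omega) ⟨r.1 - (i + 1), by omega⟩ ⟨c.1, hc1⟩
      else 0
    else
      if hc1 : c.1 < i + 1 then
        pathMat M 1 1 (i + 1) (by omega) (by omega) ⟨r.1 - 2 * i, by omega⟩ ⟨c.1, hc1⟩
      else 0)

/-- The determinant of the `n × n` matrix whose columns are the first `n` terms of `f`, each
truncated to its first `n` entries. -/
def colDet (n : ℕ) (f : ℕ → ℕ → R) : R := Matrix.det (Matrix.of fun r c : Fin n => f c r)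

lemma colDet_congr {n : ℕ} {f g : ℕ → ℕ → R} (h : ∀ c < n, ∀ r < n, f c r = g c r) :
    colDet n f = colDet n g := by
  unfold colDet
  congr 1
  ext r c
  exact h c c.2 r r.2

lemma colDet_transpose (n : ℕ) (f : ℕ → ℕ → R) : colDet n (fun c r => f r c) = colDet n f := by
  unfold colDet
  rw [← Matrix.det_transpose]
  rfl

lemma colDet_update {n t : ℕ} (ht : t < n) (f : ℕ → ℕ → R) (y : ℕ → R) :
    colDet n (Function.update f t y) =
      ((Matrix.of fun r c : Fin n => f c r).updateCol ⟨t, ht⟩ fun r => y r).det := by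
  unfold colDet
  congr 1
  ext r c
  by_cases h : c = ⟨t, ht⟩
  · subst h; simp
  · have : (c : ℕ) ≠ t := fun h' => h (Fin.ext h')
    simp [h, this]

lemma colDet_eq_zero {n s t : ℕ} (hs : s < n) (ht : t < n) (hst : s ≠ t) {f : ℕ → ℕ → R}
    (h : ∀ r < n, f s r = f t r) : colDet n f = 0 :=
  Matrix.det_zero_of_column_eq (i := ⟨s, hs⟩) (j := ⟨t, ht⟩) (by simpa using hst)
    fun r => h r r.2

lemma colDet_update_add {n t : ℕ} (ht : t < n) (f : ℕ → ℕ → R) (y z : ℕ → R) :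
    colDet n (Function.update f t (y + z)) =
      colDet n (Function.update f t y) + colDet n (Function.update f t z) := by
  rw [colDet_update ht, colDet_update ht, colDet_update ht, ← Matrix.det_updateCol_add]
  rfl

/-- Replacing one column by its sum with another does not change the determinant. -/
lemma colDet_update_add_col {n s t : ℕ} (hs : s < n) (ht : t < n) (hst : s ≠ t)
    (f : ℕ → ℕ → R) : colDet n (Function.update f t (f t + f s)) = colDet n f := by
  rw [colDet_update_add ht, Function.update_eq_self,
    colDet_eq_zero (f := Function.update f t (f s)) hs ht hst (by simp [hst]), add_zero]

/-- Subtracting a block of columns from an earlier one does not change the determinant. -/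
lemma colDet_add_block {n a s t : ℕ} (hts : t ≤ s) (hn : a + t + s ≤ n) (f g : ℕ → ℕ → R)
    (hfg : ∀ c < n, ∀ r < n, f c r = g c r + if a ≤ c ∧ c < a + t then g (c + s) r else 0) :
    colDet n f = colDet n g := by
  rw [colDet_congr hfg]
  clear hfg
  induction t with
  | zero =>
    apply colDet_congr
    intro c _ r _
    rw [if_neg (by omega), add_zero]
  | succ t ih =>
    rw [← ih (by omega) (by omega), ← colDet_update_add_col (n := n) (s := a + t + s)
      (t := a + t) (by omega) (by omega) (by omega)
      (fun c r => g c r + if a ≤ c ∧ c < a + t then g (c + s) r else 0)]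
    apply colDet_congr
    intro c _ r _
    rcases eq_or_ne c (a + t) with rfl | h
    · have h1 : ¬ (a + t + s < a + t) := by omega
      simp [h1]
    · rw [Function.update_of_ne h]
      have : (a ≤ c ∧ c < a + (t + 1)) ↔ (a ≤ c ∧ c < a + t) := by omega
      simp only [this]

lemma colDet_swap {n s : ℕ} (hs : s + 1 < n) (f : ℕ → ℕ → R) :
    colDet n (fun c => f (Equiv.swap s (s + 1) c)) = -colDet n f := by
  unfold colDet
  have := Matrix.det_permute' (Equiv.swap (⟨s, by omega⟩ : Fin n) ⟨s + 1, hs⟩)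
    (Matrix.of fun r c : Fin n => f c r)
  rw [Equiv.Perm.sign_swap (by simp)] at this
  simp only [Units.val_neg, Units.val_one, Int.cast_neg, Int.cast_one, neg_mul, one_mul] at this
  rw [← this]
  congr 1
  ext r c
  simp only [Matrix.of_apply, Matrix.submatrix_apply, id]
  congr 1
  simp only [Equiv.swap_apply_def, Fin.ext_iff]
  split_ifs <;> rfl

/-- Moving one column to the right past `q` columns. -/
lemma colDet_move {n a q : ℕ} (hn : a + q < n) (f g : ℕ → ℕ → R)
    (hfg : ∀ c < n, ∀ r < n, g c r =
      if c < a then f c r else if c < a + q then f (c + 1) r else if c = a + q then f a r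
        else f c r) :
    colDet n g = (-1) ^ q * colDet n f := by
  rw [colDet_congr hfg]
  clear hfg
  induction q with
  | zero =>
    rw [pow_zero, one_mul]
    apply colDet_congr
    intro c _ r _
    split_ifs with h1 h2 h3
    · rfl
    · omega
    · rw [h3]; rfl
    · rfl
  | succ q ih =>
    rw [pow_succ', mul_assoc, ← ih (by omega), neg_one_mul, ← colDet_swap (s := a + q) hn]
    apply colDet_congr
    intro c _ r _
    simp only [Equiv.swap_apply_def]
    grind

/-- Interchanging two adjacent blocks of `p` and `q` columns. -/
lemma colDet_block_swap {n a p q : ℕ} (hn : a + p + q ≤ n) (f g : ℕ → ℕ → R)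
    (hfg : ∀ c < n, ∀ r < n, g c r =
      if c < a then f c r else if c < a + q then f (c + p) r
        else if c < a + q + p then f (c - q) r else f c r) :
    colDet n g = (-1) ^ (p * q) * colDet n f := by
  rw [colDet_congr hfg]
  clear hfg
  induction p generalizing f with
  | zero =>
    rw [zero_mul, pow_zero, one_mul]
    apply colDet_congr
    intro c _ r _
    grind
  | succ p ih =>
    set f' : ℕ → ℕ → R := fun c r =>
      if c < a + p then f c r else if c < a + p + q then f (c + 1) r
        else if c = a + p + q then f (a + p) r else f c r with hf'
    have h1 := colDet_move (n := n) (a := a + p) (q := q) (by omega) f f' (fun _ _ _ _ => rfl)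
    rw [add_mul, one_mul, pow_add, mul_assoc, ← h1, ← ih (by omega) f']
    apply colDet_congr
    intro c _ r _
    grind

lemma colDet_blocks_lower {m n : ℕ} (f : ℕ → ℕ → R) (h : ∀ c < m, ∀ r, m ≤ r → f c r = 0) :
    colDet (m + n) f = colDet m f * colDet n (fun c r => f (m + c) (m + r)) := by
  unfold colDet
  rw [← Matrix.det_submatrix_equiv_self finSumFinEquiv]
  set N := (Matrix.of fun r c : Fin (m + n) => f c r).submatrix finSumFinEquiv finSumFinEquiv
    with hN
  rw [← Matrix.fromBlocks_toBlocks N]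
  have : N.toBlocks₂₁ = 0 := by
    ext r c
    simpa [hN, Matrix.toBlocks₂₁] using h c c.2 (m + r) (by omega)
  rw [this, Matrix.det_fromBlocks_zero₂₁]
  congr 1

lemma colDet_blocks_upper {m n : ℕ} (f : ℕ → ℕ → R) (h : ∀ c, m ≤ c → ∀ r < m, f c r = 0) :
    colDet (m + n) f = colDet m f * colDet n (fun c r => f (m + c) (m + r)) := by
  rw [← colDet_transpose, colDet_blocks_lower _ (fun c hc r hr => h r hr c hc),
    colDet_transpose m f, ← colDet_transpose n]

/-- The standard basis vector `e_i`. -/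
def basisCol (i : ℕ) : ℕ → R := fun r => if r = i then 1 else 0

/-- Appending a standard basis vector as the last column. -/
lemma colDet_succ_basisCol {n : ℕ} (f : ℕ → ℕ → R) (h : ∀ r < n + 1, f n r = basisCol n r) :
    colDet (n + 1) f = colDet n f := by
  rw [colDet_congr (g := fun c r => if c < n then f c r else basisCol n r), colDet_blocks_upper]
  · have : colDet 1 (fun c r => if n + c < n then f (n + c) (n + r) else basisCol n (n + r)) =
        (1 : R) := by
      simp [colDet, basisCol]
    rw [this, mul_one]
    exact colDet_congr fun c hc r _ => by simp [hc]
  · intro c hc r hr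
    simp [hc.not_gt, basisCol, hr.ne]
  · intro c hc r hr
    rcases eq_or_ne c n with rfl | h'
    · simpa using h r hr
    · rw [if_pos (by omega)]

/-- The exchange (Plücker) relation between two determinants. -/
lemma colDet_exchange {n t : ℕ} (ht : t < n) (f g : ℕ → ℕ → R) (y : ℕ → R) :
    colDet n f * colDet n (Function.update g t y) =
      ∑ i ∈ Finset.range n, colDet n (Function.update f i y) *
        colDet n (Function.update g t (f i)) := by
  rw [← Fin.sum_univ_eq_sum_range (fun i => colDet n (Function.update f i y) *
        colDet n (Function.update g t (f i)))]
  set S := Matrix.of fun r c : Fin n => f c r with hS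
  set T := Matrix.of fun r c : Fin n => g c r with hT
  have hT' (z : ℕ → R) : colDet n (Function.update g t z) = T.cramer (fun r => z r) ⟨t, ht⟩ := by
    rw [colDet_update ht, Matrix.cramer_apply]
  have hS' : colDet n f • (fun r : Fin n => y r) =
      ∑ i : Fin n, colDet n (Function.update f i y) • fun r : Fin n => f i r := by
    change S.det • _ = _
    rw [← Matrix.mulVec_cramer S]
    ext r
    simp [Matrix.mulVec, dotProduct, Matrix.cramer_apply, colDet_update, hS, mul_comm]
  simp only [hT']
  calc _ = T.cramer (colDet n f • (fun r : Fin n => y r)) ⟨t, ht⟩ := by simp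
    _ = _ := by rw [hS']; simp

/-- Expansion of a determinant made of two overlapping diagonal blocks which share the two
columns `m` and `m + 1`. -/
lemma colDet_two_blocks {m n : ℕ} (f : ℕ → ℕ → R) (h₁ : ∀ c < m, ∀ r, m + 1 ≤ r → f c r = 0)
    (h₂ : ∀ c, m + 2 ≤ c → ∀ r < m + 1, f c r = 0) :
    colDet (m + 1 + (n + 1)) f =
      colDet (m + 1) f * colDet (n + 1) (fun c r => f (m + 1 + c) (m + 1 + r)) -
      colDet (m + 1) (fun c => if c < m then f c else f (m + 1)) *
        colDet (n + 1) (fun c r => if c = 0 then f m (m + 1 + r) else f (m + 1 + c) (m + 1 + r)) := by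
  set p : ℕ → R := fun r => if r < m + 1 then f m r else 0 with hp
  set q : ℕ → R := fun r => if r < m + 1 then 0 else f m r with hq
  have hpq : f = Function.update f m (p + q) := by
    funext c r
    rcases eq_or_ne c m with rfl | h
    · simp only [Function.update_self, Pi.add_apply, hp, hq]
      split_ifs <;> simp
    · simp [h]
  conv_lhs => rw [hpq, colDet_update_add (by omega)]
  rw [sub_eq_add_neg]
  congr 1
  · rw [colDet_blocks_lower]
    · congr 1
      · refine colDet_congr fun c _ r hr => ?_
        rcases eq_or_ne c m with rfl | h
        · rw [Function.update_self, hp]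
          exact if_pos hr
        · rw [Function.update_of_ne h]
      · refine colDet_congr fun c _ r hr => ?_
        rw [Function.update_of_ne (by omega)]
    · intro c hc r hr
      rcases eq_or_ne c m with rfl | h
      · rw [Function.update_self, hp]
        exact if_neg hr.not_gt
      · rw [Function.update_of_ne h, h₁ c (by omega) r hr]
  · rw [← neg_inj, neg_neg, ← colDet_swap (s := m) (by omega), colDet_blocks_upper]
    · congr 1
      · refine colDet_congr fun c hc r _ => ?_
        rcases eq_or_ne c m with rfl | h
        · simp
        · rw [Equiv.swap_apply_of_ne_of_ne h (by omega), Function.update_of_ne h, if_pos (by omega)]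
      · refine colDet_congr fun c _ r _ => ?_
        rcases eq_or_ne c 0 with rfl | h
        · simp [hq, add_assoc]
        · rw [Equiv.swap_apply_of_ne_of_ne (by omega) (by omega), Function.update_of_ne (by omega),
            if_neg h]
    · intro c hc r hr
      rcases eq_or_ne c (m + 1) with rfl | h
      · rw [Equiv.swap_apply_right, Function.update_self, hq]
        exact if_pos hr
      · rw [Equiv.swap_apply_of_ne_of_ne (by omega) h, Function.update_of_ne (by omega),
          h₂ c (by omega) r hr]

/-- The determinant with first columns `w` followed by two further columns. -/
def bracketTwo (n : ℕ) (w : ℕ → ℕ → R) (p q : ℕ → R) : R :=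
  colDet (n + 2) fun c => if c < n then w c else if c = n then p else q

/-- The determinant with first columns `w` followed by three further columns. -/
def bracketThree (n : ℕ) (w : ℕ → ℕ → R) (p q s : ℕ → R) : R :=
  colDet (n + 3) fun c => if c < n then w c else if c = n then p else if c = n + 1 then q else s

lemma bracketTwo_exchange (n : ℕ) (w : ℕ → ℕ → R) (a b y p : ℕ → R) :
    bracketTwo n w a b * bracketTwo n w y p =
      bracketTwo n w y b * bracketTwo n w a p + bracketTwo n w a y * bracketTwo n w b p := by
  have h := colDet_exchange (n := n + 2) (t := n) (by omega)
    (fun c => if c < n then w c else if c = n then a else b)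
    (fun c => if c < n then w c else if c = n then y else p) y
  rw [Finset.sum_range_succ, Finset.sum_range_succ, Finset.sum_eq_zero, zero_add] at h
  · unfold bracketTwo
    convert h using 2
    · exact colDet_congr fun c _ r _ => by simp only [Function.update_apply]; grind
    · congr 1 <;> exact colDet_congr fun c _ r _ => by simp only [Function.update_apply]; grind
    · congr 1 <;> exact colDet_congr fun c _ r _ => by simp only [Function.update_apply]; grind
  · intro i hi
    rw [Finset.mem_range] at hi
    refine mul_eq_zero_of_right _
      (colDet_eq_zero (s := i) (t := n) (by omega) (by omega) (by omega) fun r _ => ?_)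
    simp [hi, hi.ne]

lemma bracketTwo_swap (n : ℕ) (w : ℕ → ℕ → R) (p q : ℕ → R) :
    bracketTwo n w q p = -bracketTwo n w p q := by
  unfold bracketTwo
  rw [← colDet_swap (s := n) (by omega)]
  refine colDet_congr fun c _ r _ => ?_
  simp only [Equiv.swap_apply_def]
  grind

lemma bracketThree_exchange (n : ℕ) (w : ℕ → ℕ → R) (a b v y p q : ℕ → R) :
    bracketThree n w a b v * bracketThree n w y p q =
      bracketThree n w y b v * bracketThree n w a p q +
      bracketThree n w a y v * bracketThree n w b p q +
      bracketThree n w a b y * bracketThree n w v p q := by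
  have h := colDet_exchange (n := n + 3) (t := n) (by omega)
    (fun c => if c < n then w c else if c = n then a else if c = n + 1 then b else v)
    (fun c => if c < n then w c else if c = n then y else if c = n + 1 then p else q) y
  rw [Finset.sum_range_succ, Finset.sum_range_succ, Finset.sum_range_succ, Finset.sum_eq_zero,
    zero_add] at h
  · unfold bracketThree
    convert h using 2
    · exact colDet_congr fun c _ r _ => by simp only [Function.update_apply]; grind
    · congr 1 <;> congr 1 <;> exact colDet_congr fun c _ r _ => by simp only [Function.update_apply]; grind
    · congr 1 <;> exact colDet_congr fun c _ r _ => by simp only [Function.update_apply]; grind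
  · intro i hi
    rw [Finset.mem_range] at hi
    refine mul_eq_zero_of_right _
      (colDet_eq_zero (s := i) (t := n) (by omega) (by omega) (by omega) fun r _ => ?_)
    simp [hi, hi.ne]

lemma bracketThree_swap_left (n : ℕ) (w : ℕ → ℕ → R) (p q s : ℕ → R) :
    bracketThree n w q p s = -bracketThree n w p q s := by
  unfold bracketThree
  rw [← colDet_swap (s := n) (by omega)]
  refine colDet_congr fun c _ r _ => ?_
  simp only [Equiv.swap_apply_def]
  grind

lemma bracketThree_swap_right (n : ℕ) (w : ℕ → ℕ → R) (p q s : ℕ → R) :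
    bracketThree n w p s q = -bracketThree n w p q s := by
  unfold bracketThree
  rw [← colDet_swap (s := n + 1) (by omega)]
  refine colDet_congr fun c _ r _ => ?_
  simp only [Equiv.swap_apply_def]
  grind

lemma bracketThree_self_left (n : ℕ) (w : ℕ → ℕ → R) (p s : ℕ → R) :
    bracketThree n w p p s = 0 :=
  colDet_eq_zero (s := n) (t := n + 1) (by omega) (by omega) (by omega) fun r _ => by simp

lemma bracketThree_self_outer (n : ℕ) (w : ℕ → ℕ → R) (p s : ℕ → R) :
    bracketThree n w p s p = 0 :=
  colDet_eq_zero (s := n) (t := n + 2) (by omega) (by omega) (by omega) fun r _ => by simp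

/-- The six-vector relation behind the non-horizontal exchange identities. -/
lemma bracketThree_hexagon (n : ℕ) (w : ℕ → ℕ → R) (a b x y u v : ℕ → R) :
    bracketThree n w a b v * (bracketThree n w a x y * bracketThree n w b u v -
        bracketThree n w a x b * bracketThree n w y u v) =
      bracketThree n w b u v * bracketThree n w a x v * bracketThree n w a b y +
      bracketThree n w a u v * bracketThree n w b y v * bracketThree n w a x b := by
  have h1 := bracketThree_exchange n w a b v y u v
  have h2 := bracketThree_exchange n w a b v y a x
  rw [bracketThree_self_outer] at h1
  rw [bracketThree_self_left, bracketThree_swap_left n w a b x, bracketThree_swap_right n w a x b,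
    bracketThree_swap_left n w a v x, bracketThree_swap_right n w a x v,
    bracketThree_swap_left n w a y x, bracketThree_swap_right n w a x y] at h2
  rw [bracketThree_swap_left n w b y v] at h1 h2
  linear_combination bracketThree n w b u v * h2 - bracketThree n w a x b * h1

/-- Interchanging two adjacent blocks of columns, one of which has even size. -/
lemma colDet_block_swap_even {n a p q : ℕ} (hn : a + p + q ≤ n) (he : Even (p * q))
    (f g : ℕ → ℕ → R) (hfg : ∀ c < n, ∀ r < n, g c r =
      if c < a then f c r else if c < a + q then f (c + p) r
        else if c < a + q + p then f (c - q) r else f c r) :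
    colDet n g = colDet n f := by
  rw [colDet_block_swap hn f g hfg, he.neg_one_pow, one_mul]

/-- The determinant formed by the first `j` columns of `X` and the first `k` columns of `Y`. -/
def flagPos (X Y : ℕ → ℕ → R) (j k : ℕ) : R :=
  colDet (j + k) fun c => if c < j then X c else Y (c - j)

/-- The determinant of the block matrix with block rows of sizes `J + K + 3`, `J + K + 1` and
block columns `X, X, Y, Y` of sizes `J + 2`, `J`, `K + 2`, `K`. -/
def flagPosP (X Y : ℕ → ℕ → R) (J K : ℕ) : R :=
  colDet (2 * (J + 1 + (K + 1))) fun c r =>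
    if r < J + K + 3 then
      if c < J + 2 then X c r
      else if c < 2 * J + 2 then 0
      else if c < 2 * J + K + 4 then Y (c - (2 * J + 2)) r
      else 0
    else
      if c < J + 2 then 0
      else if c < 2 * J + 2 then X (c - (J + 2)) (r - (J + K + 3))
      else if c < 2 * J + K + 4 then Y (c - (2 * J + 2)) (r - (J + K + 3))
      else Y (c - (2 * J + K + 4)) (r - (J + K + 3))

/-- The common columns of `X` and `Y`. -/
def flagCols (X Y : ℕ → ℕ → R) (J : ℕ) : ℕ → ℕ → R := fun c => if c < J then X c else Y (c - J)


lemma bracketThree_basisCol (n : ℕ) (w : ℕ → ℕ → R) (p q : ℕ → R) :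
    bracketThree n w p q (basisCol (n + 2)) = bracketTwo n w p q := by
  unfold bracketThree bracketTwo
  rw [colDet_succ_basisCol]
  · exact colDet_congr fun c _ r _ => by grind
  · intro r _
    simp

lemma bracketTwo_basisCol (n : ℕ) (w : ℕ → ℕ → R) (p : ℕ → R) :
    bracketTwo n w p (basisCol (n + 1)) = colDet (n + 1) (fun c => if c < n then w c else p) := by
  unfold bracketTwo
  rw [colDet_succ_basisCol]
  · exact colDet_congr fun c _ r _ => by grind
  · intro r _
    simp

section
variable (X Y : ℕ → ℕ → R) (J K : ℕ)

lemma flagPos_add_zero_one : flagPos X Y J (K + 1) =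
    colDet (J + K + 1) (fun c => if c < J + K then flagCols X Y J c else Y K) := by
  unfold flagPos flagCols
  exact colDet_congr fun c _ r _ => by grind

lemma flagPos_add_one_zero : flagPos X Y (J + 1) K =
    (-1) ^ K * colDet (J + K + 1) (fun c => if c < J + K then flagCols X Y J c else X J) := by
  unfold flagPos flagCols
  rw [show J + 1 + K = J + K + 1 by omega]
  nth_rw 2 [← mul_one K]
  refine colDet_block_swap (a := J) (p := K) (q := 1) (by omega) _ _ fun c _ r _ => ?_
  grind

lemma flagPos_add_one_one : flagPos X Y (J + 1) (K + 1) =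
    (-1) ^ K * bracketTwo (J + K) (flagCols X Y J) (X J) (Y K) := by
  unfold flagPos flagCols bracketTwo
  rw [show J + 1 + (K + 1) = J + K + 2 by omega]
  nth_rw 2 [← mul_one K]
  refine colDet_block_swap (a := J) (p := K) (q := 1) (by omega) _ _ fun c _ r _ => ?_
  grind

lemma flagPos_add_two_zero : flagPos X Y (J + 2) K =
    bracketTwo (J + K) (flagCols X Y J) (X J) (X (J + 1)) := by
  unfold flagPos flagCols bracketTwo
  rw [show J + 2 + K = J + K + 2 by omega]
  refine colDet_block_swap_even (a := J) (p := K) (q := 2) (by omega) (even_two.mul_left K) _ _ fun c _ r _ => ?_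
  grind

lemma flagPos_add_zero_two : flagPos X Y J (K + 2) =
    bracketTwo (J + K) (flagCols X Y J) (Y K) (Y (K + 1)) := by
  unfold flagPos flagCols bracketTwo
  exact colDet_congr fun c _ r _ => by grind

lemma flagPos_add_one_two : flagPos X Y (J + 1) (K + 2) =
    (-1) ^ K * bracketThree (J + K) (flagCols X Y J) (X J) (Y K) (Y (K + 1)) := by
  unfold flagPos flagCols bracketThree
  rw [show J + 1 + (K + 2) = J + K + 3 by omega]
  nth_rw 2 [← mul_one K]
  refine colDet_block_swap (a := J) (p := K) (q := 1) (by omega) _ _ fun c _ r _ => ?_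
  grind

lemma flagPos_add_two_one : flagPos X Y (J + 2) (K + 1) =
    bracketThree (J + K) (flagCols X Y J) (X J) (X (J + 1)) (Y K) := by
  unfold flagPos flagCols bracketThree
  rw [show J + 2 + (K + 1) = J + K + 3 by omega]
  refine colDet_block_swap_even (a := J) (p := K) (q := 2) (by omega) (even_two.mul_left K) _ _ fun c _ r _ => ?_
  grind

set_option maxHeartbeats 2000000 in
lemma flagPosP_eq : flagPosP X Y J K = (-1) ^ (J * K + J + K) *
    (bracketThree (J + K) (flagCols X Y J) (X J) (X (J + 1)) (Y K) *
        colDet (J + K + 1) (fun c => if c < J + K then flagCols X Y J c else Y (K + 1)) -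
      bracketThree (J + K) (flagCols X Y J) (X J) (X (J + 1)) (Y (K + 1)) *
        colDet (J + K + 1) (fun c => if c < J + K then flagCols X Y J c else Y K)) := by
  set f₁ : ℕ → ℕ → R := fun c r =>
    if r < J + K + 3 then
      if c < J + 2 then X c r
      else if c < 2 * J + 2 then 0
      else if c < 2 * J + K + 4 then Y (c - (2 * J + 2)) r
      else 0
    else
      if c < J + 2 then 0
      else if c < 2 * J + 2 then X (c - (J + 2)) (r - (J + K + 3))
      else if c < 2 * J + K + 2 then 0
      else if c < 2 * J + K + 4 then Y (c - (2 * J + 2)) (r - (J + K + 3))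
      else Y (c - (2 * J + K + 4)) (r - (J + K + 3)) with hf₁
  set f₂ : ℕ → ℕ → R := fun c r =>
    if r < J + K + 3 then
      if c < J + 2 then X c r
      else if c < J + K + 4 then Y (c - (J + 2)) r
      else 0
    else
      if c < J + K + 2 then 0
      else if c < J + K + 4 then Y (c - (J + 2)) (r - (J + K + 3))
      else if c < 2 * J + K + 4 then X (c - (J + K + 4)) (r - (J + K + 3))
      else Y (c - (2 * J + K + 4)) (r - (J + K + 3)) with hf₂
  have h1 : flagPosP X Y J K = colDet (2 * (J + 1 + (K + 1))) f₁ := by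
    refine colDet_add_block (a := 2 * J + 2) (s := K + 2) (t := K) (by omega) (by omega) _ _
      fun c _ r _ => ?_
    simp only [hf₁]
    split_ifs <;> first | omega | simp
    all_goals (congr 1; omega)
  have h2 : colDet (2 * (J + 1 + (K + 1))) f₁ = (-1) ^ (J * K) * colDet (2 * (J + 1 + (K + 1))) f₂ := by
    have h := colDet_block_swap (n := 2 * (J + 1 + (K + 1))) (a := J + 2) (p := K + 2) (q := J) (by omega) f₂ f₁
      fun c _ r _ => by
        simp only [hf₁, hf₂]
        split_ifs <;> first | omega | rfl | (congr 1; omega)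
    rw [h]
    congr 1
    rw [add_mul, pow_add, (even_two_mul J).neg_one_pow, mul_one, mul_comm]
  have h3 := colDet_two_blocks (m := J + K + 2) (n := J + K) f₂ (fun c hc r hr => by
      simp only [hf₂]
      rw [if_neg (by omega), if_pos hc]) (fun c hc r hr => by
      simp only [hf₂]
      rw [if_pos hr, if_neg (by omega), if_neg (by omega)])
  rw [show J + K + 2 + 1 + (J + K + 1) = 2 * (J + 1 + (K + 1)) by omega] at h3
  have top (P : ℕ → ℕ → R) (z : ℕ → R) (hP : ∀ c < J + K + 3, ∀ r < J + K + 3, P c r = if c < J + K + 2 then f₂ c r else z r) :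
      colDet (J + K + 2 + 1) P = bracketThree (J + K) (flagCols X Y J) (X J) (X (J + 1)) z := by
    unfold bracketThree
    refine colDet_block_swap_even (a := J) (p := K) (q := 2) (by omega) (even_two.mul_left K) _ _
      fun c hc r hr => ?_
    rw [hP c hc r hr]
    simp only [hf₂, flagCols]
    grind
  have bot (P : ℕ → ℕ → R) (z : ℕ → R) (hP : ∀ c < J + K + 1, ∀ r < J + K + 1, P c r = if c = 0 then z r else f₂ (J + K + 3 + c) (J + K + 3 + r)) :
      colDet (J + K + 1) P = (-1) ^ (J + K) *
        colDet (J + K + 1) (fun c => if c < J + K then flagCols X Y J c else z) := by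
    nth_rw 2 [← mul_one (J + K)]
    refine colDet_block_swap (a := 0) (p := J + K) (q := 1) (by omega) _ _
      fun c hc r hr => ?_
    rw [hP c hc r hr]
    simp only [hf₂, flagCols]
    grind
  have t1 := top f₂ (Y K) (fun c hc r hr => by simp only [hf₂]; clear h1 h2 h3 top bot; grind)
  have t2 := top (fun c => if c < J + K + 2 then f₂ c else f₂ (J + K + 2 + 1)) (Y (K + 1))
    (fun c hc r hr => by
      split_ifs
      · rfl
      · simp only [hf₂]
        rw [if_pos hr, if_neg (by omega), if_pos (by omega),
          show J + K + 2 + 1 - (J + 2) = K + 1 by omega])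
  have b1 := bot (fun c r => f₂ (J + K + 2 + 1 + c) (J + K + 2 + 1 + r)) (Y (K + 1))
    (fun c hc r hr => by simp only [hf₂]; clear h1 h2 h3 top bot; grind)
  have b2 := bot (fun c r => if c = 0 then f₂ (J + K + 2) (J + K + 2 + 1 + r)
    else f₂ (J + K + 2 + 1 + c) (J + K + 2 + 1 + r)) (Y K)
    (fun c hc r hr => by simp only [hf₂]; clear h1 h2 h3 top bot; grind)
  rw [h1, h2, h3, t1, t2, b1, b2, add_assoc (J * K), pow_add]
  ring

lemma flagPos_exchange :
    flagPos X Y (J + 1) (K + 1) * ((-1) ^ ((J + 1) * (K + 1)) * flagPosP X Y J K) =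
      flagPos X Y J (K + 1) * flagPos X Y (J + 2) K * flagPos X Y (J + 1) (K + 2) +
      flagPos X Y (J + 1) K * flagPos X Y J (K + 2) * flagPos X Y (J + 2) (K + 1) := by
  have hs : (-1 : R) ^ ((J + 1) * (K + 1)) * (-1) ^ (J * K + J + K) = -1 := by
    rw [← pow_add, show (J + 1) * (K + 1) + (J * K + J + K) = 2 * (J * K + J + K) + 1 by ring]
    exact (even_two_mul _).add_one.neg_one_pow
  rw [flagPosP_eq, flagPos_add_zero_one X Y J K, flagPos_add_one_zero X Y J K,
    flagPos_add_one_one X Y J K, flagPos_add_two_zero X Y J K, flagPos_add_zero_two X Y J K,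
    flagPos_add_one_two X Y J K, flagPos_add_two_one X Y J K]
  simp only [← bracketTwo_basisCol]
  simp only [← bracketThree_basisCol]
  have h := bracketThree_hexagon (J + K) (flagCols X Y J) (X J) (Y K) (X (J + 1)) (Y (K + 1))
    (basisCol (J + K + 1)) (basisCol (J + K + 2))
  set w := flagCols X Y J
  set u : ℕ → R := basisCol (J + K + 1)
  set v : ℕ → R := basisCol (J + K + 2)
  linear_combination (-1) ^ K * h + (-1) ^ K * bracketThree (J + K) w (X J) (Y K) v *
    (bracketThree (J + K) w (X J) (X (J + 1)) (Y K) * bracketThree (J + K) w (Y (K + 1)) u v -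
     bracketThree (J + K) w (X J) (X (J + 1)) (Y (K + 1)) * bracketThree (J + K) w (Y K) u v) * hs
end

/-- The determinant of the block matrix with rows of sizes `J + 2`, `J`, `1` and columns of
sizes `J + 2`, `J`, `1`, with blocks `X, X, Y` in the first row and `X`, `Y` below. -/
def flagHor (X Y : ℕ → ℕ → R) (J : ℕ) : R :=
  colDet (2 * (J + 1) + 1) fun c r =>
    if r < J + 2 then
      if c < J + 2 then X c r
      else if c < 2 * J + 2 then X (c - (J + 2)) r
      else Y 0 r
    else if r < 2 * J + 2 then
      if c < J + 2 then X c (r - (J + 2)) else 0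
    else
      if c < J + 2 then Y c 0 else 0

lemma bracketTwo_basisCol_left (n : ℕ) (w : ℕ → ℕ → R) (p : ℕ → R) :
    bracketTwo n w p (basisCol n) = -colDet (n + 1) (fun c r =>
      (if c < n then w c else p) (if r = n then n + 1 else r)) := by
  unfold bracketTwo
  rw [← colDet_transpose, ← neg_neg (colDet (n + 2) _), ← colDet_swap (s := n) (by omega),
    ← colDet_transpose, colDet_succ_basisCol]
  · refine congrArg _ (colDet_congr fun c hc r hr => ?_)
    have : Equiv.swap n (n + 1) r = if r = n then n + 1 else r := by
      rw [Equiv.swap_apply_def]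
      grind
    simp only [this]
    grind
  · intro r hr
    have : Equiv.swap n (n + 1) r = if r = n then n + 1 else if r = n + 1 then n else r := by
      rw [Equiv.swap_apply_def]
    simp only [this, basisCol]
    by_cases h₁ : r = n <;> by_cases h₂ : r = n + 1 <;> simp [basisCol, h₁, h₂]

section
variable (X Y : ℕ → ℕ → R) (J : ℕ)

lemma bracketTwo_basisCol_pair (w : ℕ → ℕ → R) :
    bracketTwo J w (basisCol J) (basisCol (J + 1)) = colDet J w := by
  rw [bracketTwo_basisCol, colDet_succ_basisCol]
  · exact colDet_congr fun c hc r hr => by simp [hc]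
  · simp

/-- The rows of `X` with the row `Y · 0` appended at index `J`. -/
def stackRow : ℕ → ℕ → R := fun c r => if r < J then X c r else Y c 0

set_option maxHeartbeats 2000000 in
lemma flagHor_eq : flagHor X Y J = (-1) ^ J *
    (bracketTwo J X (Y 0) (X J) *
        colDet (J + 1) (fun c r => if c < J then stackRow X Y J c r else stackRow X Y J (J + 1) r) -
      bracketTwo J X (Y 0) (X (J + 1)) * colDet (J + 1) (stackRow X Y J)) := by
  set f₁ : ℕ → ℕ → R := fun c r =>
    if r < J + 2 then
      if c < J then 0
      else if c < J + 2 then X c r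
      else if c < 2 * J + 2 then X (c - (J + 2)) r
      else Y 0 r
    else if c < J + 2 then stackRow X Y J c (r - (J + 2)) else 0 with hf₁
  set f₂ : ℕ → ℕ → R := fun c r =>
    if r < J + 2 then
      if c < J then X c r
      else if c < J + 1 then Y 0 r
      else if c < 2 * J + 1 then 0
      else if c < 2 * J + 3 then X (c - (J + 1)) r
      else 0
    else if c < J + 1 then 0
      else if c < 2 * J + 3 then stackRow X Y J (c - (J + 1)) (r - (J + 2)) else 0 with hf₂
  set f₃ : ℕ → ℕ → R := fun c r =>
    if r < J + 2 then
      if c < J then X c r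
      else if c < J + 1 then Y 0 r
      else if c < J + 3 then X (c - 1) r
      else 0
    else if c < J + 1 then 0
      else if c < J + 3 then stackRow X Y J (c - 1) (r - (J + 2))
      else stackRow X Y J (c - (J + 3)) (r - (J + 2)) with hf₃
  have h1 : flagHor X Y J = colDet (2 * (J + 1) + 1) f₁ := by
    refine colDet_add_block (a := 0) (s := J + 2) (t := J) (by omega) (by omega) _ _
      fun c hc r hr => ?_
    simp only [hf₁, stackRow]
    clear hf₁ hf₂ hf₃ f₁ f₂ f₃
    split_ifs <;> first | omega | simp
  have h2 : colDet (2 * (J + 1) + 1) f₂ = colDet (2 * (J + 1) + 1) f₁ := by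
    refine colDet_block_swap_even (a := 0) (p := J + 2) (q := J + 1) (by omega)
      (by rw [mul_comm]; exact Nat.even_mul_succ_self (J + 1)) _ _ fun c hc r hr => ?_
    simp only [hf₁, hf₂]
    clear hf₁ hf₂ hf₃ f₁ f₂ f₃ h1
    split_ifs <;> first | omega | rfl | (congr 1 <;> omega)
  have h3 : colDet (2 * (J + 1) + 1) f₃ = colDet (2 * (J + 1) + 1) f₂ := by
    refine colDet_block_swap_even (a := J + 1) (p := J) (q := 2) (by omega)
      (even_two.mul_left J) _ _ fun c hc r hr => ?_
    simp only [hf₂, hf₃]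
    clear hf₁ hf₂ hf₃ f₁ f₂ f₃ h1 h2
    split_ifs <;> first | omega | rfl | (congr 1 <;> omega)
  have h4 := colDet_two_blocks (m := J + 1) (n := J) f₃ (fun c hc r hr => by
      simp only [hf₃]
      rw [if_neg (by omega), if_pos hc]) (fun c hc r hr => by
      simp only [hf₃]
      rw [if_pos hr, if_neg (by omega), if_neg (by omega), if_neg (by omega)])
  rw [show J + 1 + 1 + (J + 1) = 2 * (J + 1) + 1 by omega] at h4
  have top (P : ℕ → ℕ → R) (z : ℕ → R)
      (hP : ∀ c < J + 2, ∀ r < J + 2, P c r = if c < J + 1 then f₃ c r else z r) :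
      colDet (J + 1 + 1) P = bracketTwo J X (Y 0) z := by
    refine colDet_congr fun c hc r hr => ?_
    rw [hP c hc r hr]
    simp only [hf₃]
    clear hf₁ hf₂ hf₃ h1 h2 h3 h4
    split_ifs <;> first | omega | rfl
  have bot (P : ℕ → ℕ → R) (z : ℕ → R)
      (hP : ∀ c < J + 1, ∀ r < J + 1, P c r = if c = 0 then z r else f₃ (J + 2 + c) (J + 2 + r)) :
      colDet (J + 1) P = (-1) ^ J *
        colDet (J + 1) (fun c r => if c < J then stackRow X Y J c r else z r) := by
    nth_rw 2 [← mul_one J]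
    refine colDet_block_swap (a := 0) (p := J) (q := 1) (by omega) _ _ fun c hc r hr => ?_
    rw [hP c hc r hr]
    simp only [hf₃]
    clear hf₁ hf₂ hf₃ h1 h2 h3 h4 top
    split_ifs <;> first | omega | rfl | (congr 1 <;> omega)
  have t1 := top f₃ (X J) (fun c hc r hr => by
    simp only [hf₃]
    clear hf₁ hf₂ hf₃ h1 h2 h3 h4 top bot
    split_ifs <;> first | omega | rfl | (congr 1 <;> omega))
  have t2 := top (fun c => if c < J + 1 then f₃ c else f₃ (J + 1 + 1)) (X (J + 1))
    (fun c hc r hr => by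
      split_ifs
      · rfl
      · simp only [hf₃]
        rw [if_pos hr, if_neg (by omega), if_neg (by omega), if_pos (by omega),
          show J + 1 + 1 - 1 = J + 1 by omega])
  have b1 := bot (fun c r => f₃ (J + 1 + 1 + c) (J + 1 + 1 + r)) (stackRow X Y J (J + 1))
    (fun c hc r hr => by
      simp only [hf₃]
      clear hf₁ hf₂ hf₃ h1 h2 h3 h4 top bot t1 t2
      split_ifs <;> first | omega | rfl | (congr 1 <;> omega))
  have b2 := bot (fun c r => if c = 0 then f₃ (J + 1) (J + 1 + 1 + r)
    else f₃ (J + 1 + 1 + c) (J + 1 + 1 + r)) (stackRow X Y J J)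
    (fun c hc r hr => by
      simp only [hf₃]
      clear hf₁ hf₂ hf₃ h1 h2 h3 h4 top bot t1 t2
      split_ifs <;> first | omega | rfl | (congr 1 <;> omega))
  have b3 : colDet (J + 1) (fun c r => if c < J then stackRow X Y J c r else stackRow X Y J J r) =
      colDet (J + 1) (stackRow X Y J) :=
    colDet_congr fun c hc r hr => by
      split_ifs
      · rfl
      · rw [show c = J by omega]
  rw [h1, ← h2, ← h3, h4, t1, t2, b1, b2, b3]
  ring

lemma flagHor_exchange :
    flagPos X Y (J + 1) 0 * ((-1) ^ (J + 1) * flagHor X Y J) =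
      flagPos X Y J 0 * flagPos (fun r c => X c r) (fun r c => Y c r) (J + 1) 1 *
          flagPos X Y (J + 1) 1 +
        flagPos (fun r c => X c r) (fun r c => Y c r) J 1 * flagPos X Y J 1 *
          flagPos X Y (J + 2) 0 := by
  have e0 : flagPos X Y (J + 1) 0 = bracketTwo J X (X J) (basisCol (J + 1)) := by
    rw [bracketTwo_basisCol]
    exact colDet_congr fun c hc r hr => by simp only [ite_apply]; grind
  have e1 : flagPos X Y J 0 = bracketTwo J (fun r c => X c r) (basisCol J) (basisCol (J + 1)) := by
    rw [bracketTwo_basisCol_pair, colDet_transpose]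
    exact colDet_congr fun c hc r hr => by simp only [ite_apply]; grind
  have e2 : flagPos (fun r c => X c r) (fun r c => Y c r) (J + 1) 1 =
      bracketTwo J (fun r c => X c r) (fun c => X c J) (fun c => Y c 0) :=
    colDet_congr fun c hc r hr => by simp only [ite_apply]; grind
  have e3 : flagPos X Y (J + 1) 1 = bracketTwo J X (X J) (Y 0) :=
    colDet_congr fun c hc r hr => by simp only [ite_apply]; grind
  have e4 : flagPos (fun r c => X c r) (fun r c => Y c r) J 1 =
      bracketTwo J (fun r c => X c r) (fun c => Y c 0) (basisCol (J + 1)) := by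
    rw [bracketTwo_basisCol]
    exact colDet_congr fun c hc r hr => by simp only [ite_apply]; grind
  have e5 : flagPos X Y J 1 = bracketTwo J X (Y 0) (basisCol (J + 1)) := by
    rw [bracketTwo_basisCol]
    exact colDet_congr fun c hc r hr => by simp only [ite_apply]; grind
  have e6 : flagPos X Y (J + 2) 0 = bracketTwo J X (X J) (X (J + 1)) :=
    colDet_congr fun c hc r hr => by simp only [ite_apply]; grind
  have e7 : bracketTwo J (fun r c => X c r) (fun c => X c J) (basisCol (J + 1)) =
      bracketTwo J X (X J) (basisCol (J + 1)) := by
    rw [bracketTwo_basisCol, bracketTwo_basisCol, ← colDet_transpose]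
    exact colDet_congr fun c hc r hr => by simp only [ite_apply]; grind
  have e8 : bracketTwo J (fun r c => X c r) (fun c => X c J) (basisCol J) =
      -bracketTwo J X (X (J + 1)) (basisCol (J + 1)) := by
    rw [bracketTwo_basisCol, bracketTwo_basisCol_left, ← colDet_transpose]
    refine congrArg _ (colDet_congr fun c hc r hr => by simp only [ite_apply]; grind)
  have e9 : colDet (J + 1) (stackRow X Y J) =
      bracketTwo J (fun r c => X c r) (fun c => Y c 0) (basisCol (J + 1)) := by
    rw [bracketTwo_basisCol, ← colDet_transpose]
    exact colDet_congr fun c hc r hr => by simp only [ite_apply, stackRow]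
  have e10 : colDet (J + 1) (fun c r => if c < J then stackRow X Y J c r
        else stackRow X Y J (J + 1) r) =
      -bracketTwo J (fun r c => X c r) (fun c => Y c 0) (basisCol J) := by
    rw [bracketTwo_basisCol_left, neg_neg, ← colDet_transpose]
    exact colDet_congr fun c hc r hr => by
      simp only [ite_apply, stackRow]
      grind
  have hs : (-1 : R) ^ (J + 1) * (-1) ^ J = -1 := by
    rw [← pow_add, show J + 1 + J = 2 * J + 1 by ring]
    exact (even_two_mul _).add_one.neg_one_pow
  have hc := bracketTwo_exchange J X (X J) (basisCol (J + 1)) (X (J + 1)) (Y 0)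
  have hr := bracketTwo_exchange J (fun r c => X c r) (fun c => X c J) (basisCol (J + 1))
    (fun c => Y c 0) (basisCol J)
  rw [e7, e8] at hr
  rw [flagHor_eq, e9, e10, e0, e1, e2, e3, e4, e5, e6]
  rw [bracketTwo_swap J X (X J) (Y 0), bracketTwo_swap J X (X (J + 1)) (Y 0)]
  rw [bracketTwo_swap J X (Y 0) (basisCol (J + 1))] at hc
  rw [bracketTwo_swap J _ (basisCol J) (basisCol (J + 1))] at hr
  set w : ℕ → ℕ → R := fun r c => X c r
  set z : ℕ → R := fun c => Y c 0
  linear_combination -bracketTwo J X (X J) (Y 0) * hr -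
    bracketTwo J w z (basisCol (J + 1)) * hc +
    bracketTwo J X (X J) (basisCol (J + 1)) *
      (bracketTwo J X (X J) (Y 0) * bracketTwo J w z (basisCol J) +
        bracketTwo J X (X (J + 1)) (Y 0) * bracketTwo J w z (basisCol (J + 1))) * hs
end

/-- A block matrix with block `(a, b)` of size `m a × n b`. -/
def blockMat {A B : ℕ} {m : Fin A → ℕ} {n : Fin B → ℕ}
    (blk : ∀ a b, Matrix (Fin (m a)) (Fin (n b)) R) :
    Matrix (Σ a, Fin (m a)) (Σ b, Fin (n b)) R :=
  Matrix.of fun x y => blk x.1 y.1 x.2 y.2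

lemma blockDiagonal'_mul_blockMat_mul {A B : ℕ} {m : Fin A → ℕ} {n : Fin B → ℕ}
    (blk : ∀ a b, Matrix (Fin (m a)) (Fin (n b)) R) (g : ∀ a, Matrix (Fin (m a)) (Fin (m a)) R)
    (d : ∀ b, Matrix (Fin (n b)) (Fin (n b)) R) :
    Matrix.blockDiagonal' g * blockMat blk * Matrix.blockDiagonal' d =
      blockMat fun a b => g a * blk a b * d b := by
  ext ⟨a, r⟩ ⟨b, c⟩
  simp only [Matrix.mul_apply, blockMat, Matrix.of_apply, Fintype.sum_sigma]
  rw [Finset.sum_eq_single b]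
  · refine Finset.sum_congr rfl fun t _ => ?_
    rw [Matrix.blockDiagonal'_apply_eq, Finset.sum_eq_single a]
    · simp only [Matrix.blockDiagonal'_apply_eq]
    · intro a' _ ha
      exact Finset.sum_eq_zero fun s _ => by
        rw [Matrix.blockDiagonal'_apply_ne _ _ _ ha.symm, zero_mul]
    · simp
  · intro b' _ hb
    exact Finset.sum_eq_zero fun s _ => by
      rw [Matrix.blockDiagonal'_apply_ne _ _ _ hb, mul_zero]
  · simp

lemma det_blockDiagonal_sigma {A : ℕ} {m : Fin A → ℕ}
    (g : ∀ a, Matrix (Fin (m a)) (Fin (m a)) R) :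
    (Matrix.blockDiagonal' g).det = ∏ a, (g a).det := by
  rw [(Matrix.blockTriangular_blockDiagonal' g).det_fintype]
  refine Finset.prod_congr rfl fun a _ => ?_
  rw [← Matrix.det_submatrix_equiv_self (Equiv.sigmaSubtype a).symm]
  congr 1
  ext r c
  exact Matrix.blockDiagonal'_apply_eq g a r c

/-- The first index of the `a`-th block. -/
def blockStart {A : ℕ} (m : Fin A → ℕ) (a : Fin A) : ℕ :=
  ∑ i : Fin a.1, m (Fin.castLE a.2.le i)

/-- The index `r` of the `a`-th block among all indices. -/
def blockIndex {A N : ℕ} {m : Fin A → ℕ} (hm : ∑ a, m a = N) : (Σ a, Fin (m a)) ≃ Fin N :=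
  finSigmaFinEquiv.trans (finCongr hm)

lemma blockIndex_val {A N : ℕ} {m : Fin A → ℕ} (hm : ∑ a, m a = N) (a : Fin A) (r : Fin (m a)) :
    (blockIndex hm ⟨a, r⟩ : ℕ) = blockStart m a + r := by
  simp [blockIndex, finSigmaFinEquiv_apply, blockStart]

lemma colDet_eq_blockMat {A B N : ℕ} {m : Fin A → ℕ} {n : Fin B → ℕ} (hm : ∑ a, m a = N)
    (hn : ∑ b, n b = N) (f : ℕ → ℕ → R) (blk : ∀ a b, Matrix (Fin (m a)) (Fin (n b)) R)
    (h : ∀ a b (r : Fin (m a)) (c : Fin (n b)),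
      f (blockStart n b + c) (blockStart m a + r) = blk a b r c) :
    colDet N f = ((blockMat blk).submatrix (blockIndex hm).symm (blockIndex hn).symm).det := by
  unfold colDet
  congr 1
  ext r c
  obtain ⟨⟨a, r⟩, rfl⟩ := (blockIndex hm).surjective r
  obtain ⟨⟨b, c⟩, rfl⟩ := (blockIndex hn).surjective c
  simp [blockMat, blockIndex_val, h]

lemma colDet_block_scale {A B N : ℕ} {m : Fin A → ℕ} {n : Fin B → ℕ} (hm : ∑ a, m a = N)
    (hn : ∑ b, n b = N) (f f' : ℕ → ℕ → R) (blk : ∀ a b, Matrix (Fin (m a)) (Fin (n b)) R)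
    (g : ∀ a, Matrix (Fin (m a)) (Fin (m a)) R) (d : ∀ b, Matrix (Fin (n b)) (Fin (n b)) R)
    (h : ∀ a b (r : Fin (m a)) (c : Fin (n b)),
      f (blockStart n b + c) (blockStart m a + r) = blk a b r c)
    (h' : ∀ a b (r : Fin (m a)) (c : Fin (n b)),
      f' (blockStart n b + c) (blockStart m a + r) = (g a * blk a b * d b) r c) :
    colDet N f' = (∏ a, (g a).det) * (∏ b, (d b).det) * colDet N f := by
  rw [colDet_eq_blockMat hm hn f blk h,
    colDet_eq_blockMat hm hn f' (fun a b => g a * blk a b * d b) h',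
    ← blockDiagonal'_mul_blockMat_mul, ← Matrix.submatrix_mul_equiv _ _ _ (blockIndex hn).symm,
    ← Matrix.submatrix_mul_equiv _ _ _ (blockIndex hm).symm, Matrix.det_mul, Matrix.det_mul,
    Matrix.det_submatrix_equiv_self, Matrix.det_submatrix_equiv_self,
    det_blockDiagonal_sigma, det_blockDiagonal_sigma]
  ring

/-- A family of path matrices: `P ε i j r c` is the entry `(r, c)` of the matrix of the path from
the negative vertex `i` to the positive vertex `j` through the arrow `ε`. -/
abbrev PathFamily (R : Type) : Type := Fin 2 → ℕ → ℕ → ℕ → ℕ → R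

/-- The family obtained by exchanging the two arms. -/
def PathFamily.transpose (P : PathFamily R) : PathFamily R := fun ε i j r c => P ε j i c r

/-- `Q` is obtained from `P` by the changes of basis `g` and `d`. -/
def PathFamily.IsScaled (P Q : PathFamily R) (g d : ∀ n, Matrix (Fin n) (Fin n) R) : Prop :=
  ∀ ε i j (r : Fin i) (c : Fin j), Q ε i j r c =
    (g i * Matrix.of (fun (r : Fin i) (c : Fin j) => P ε i j r c) * d j) r c

/-- The determinant `s_{i;j,k}` of a family of path matrices. -/
def pathPos (P : PathFamily R) (j k : ℕ) : R :=
  colDet (j + k) fun c r => if c < j then P 0 (j + k) j r c else P 1 (j + k) k r (c - j)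

/-- The determinant of the presentation `f'` at the label `(i; J + 1, K + 1)`. -/
def pathPosP (P : PathFamily R) (J K : ℕ) : R :=
  colDet (2 * (J + 1 + (K + 1))) fun c r =>
    if r < J + K + 3 then
      if c < J + 2 then P 0 (J + K + 3) (J + 2) r c
      else if c < 2 * J + 2 then 0
      else if c < 2 * J + K + 4 then P 1 (J + K + 3) (K + 2) r (c - (2 * J + 2))
      else 0
    else
      if c < J + 2 then 0
      else if c < 2 * J + 2 then P 0 (J + K + 1) J (r - (J + K + 3)) (c - (J + 2))
      else if c < 2 * J + K + 4 then
        P 1 (J + K + 1) (K + 2) (r - (J + K + 3)) (c - (2 * J + 2))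
      else P 1 (J + K + 1) K (r - (J + K + 3)) (c - (2 * J + K + 4))

/-- The determinant of the presentation `f'` at the label `(J + 1; J + 1, 0)`. -/
def pathHor (P : PathFamily R) (J : ℕ) : R :=
  colDet (2 * (J + 1) + 1) fun c r =>
    if r < J + 2 then
      if c < J + 2 then P 0 (J + 2) (J + 2) r c
      else if c < 2 * J + 2 then P 0 (J + 2) J r (c - (J + 2))
      else P 1 (J + 2) 1 r 0
    else if r < 2 * J + 2 then
      if c < J + 2 then P 0 J (J + 2) (r - (J + 2)) c else 0
    else
      if c < J + 2 then P 1 1 (J + 2) 0 c else 0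

/-- The entries of a matrix assembled from a family of path matrices: `e a b` tells which path is
used in block `(a, b)`. -/
def pathBlock (P : PathFamily R) {A B : ℕ} (m : Fin A → ℕ) (n : Fin B → ℕ)
    (e : Fin A → Fin B → Option (Fin 2)) (a : Fin A) (b : Fin B) (r c : ℕ) : R :=
  match e a b with
  | none => 0
  | some ε => P ε (m a) (n b) r c

section
variable {P Q : PathFamily R} {g d : ∀ n, Matrix (Fin n) (Fin n) R}

lemma PathFamily.IsScaled.transpose (h : P.IsScaled Q g d) :
    P.transpose.IsScaled Q.transpose (fun n => (d n).transpose) (fun n => (g n).transpose) := by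
  intro ε i j r c
  rw [PathFamily.transpose, h ε j i c r, ← Matrix.transpose_apply (_ * _ * _),
    Matrix.transpose_mul, Matrix.transpose_mul, Matrix.mul_assoc]
  rfl

lemma PathFamily.IsScaled.colDet_eq (h : P.IsScaled Q g d) {A B N : ℕ} (m : Fin A → ℕ)
    (n : Fin B → ℕ) (e : Fin A → Fin B → Option (Fin 2)) (hm : ∑ a, m a = N) (hn : ∑ b, n b = N)
    (f : PathFamily R → ℕ → ℕ → R)
    (hf : ∀ P a b r c, r < m a → c < n b →
      f P (blockStart n b + c) (blockStart m a + r) = pathBlock P m n e a b r c) :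
    colDet N (f Q) = (∏ a, (g (m a)).det) * (∏ b, (d (n b)).det) * colDet N (f P) := by
  refine colDet_block_scale hm hn (f P) (f Q)
    (fun a b => Matrix.of fun r c => pathBlock P m n e a b r c)
    (fun a => g (m a)) (fun b => d (n b)) (fun a b r c => hf P a b r c r.2 c.2)
    (fun a b r c => ?_)
  rw [hf Q a b r c r.2 c.2]
  unfold pathBlock
  cases e a b with
  | none =>
    have : (Matrix.of fun (r : Fin (m a)) (c : Fin (n b)) => (0 : R)) = 0 := rfl
    simp [this]
  | some ε => exact h ε _ _ r c

lemma PathFamily.IsScaled.pathPos_eq (h : P.IsScaled Q g d) (j k : ℕ) :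
    pathPos Q j k = (g (j + k)).det * ((d j).det * (d k).det) * pathPos P j k := by
  have := h.colDet_eq ![j + k] ![j, k] ![![some 0, some 1]] (N := j + k) (by simp) (by simp)
    (fun P c r => if c < j then P 0 (j + k) j r c else P 1 (j + k) k r (c - j))
    (fun P a b r c hr hc => by
      fin_cases a <;> fin_cases b <;> simp [blockStart, pathBlock] at hr hc ⊢ <;> grind)
  rw [Fin.prod_univ_one, Fin.prod_univ_two] at this
  exact this

lemma PathFamily.IsScaled.pathPosP_eq (h : P.IsScaled Q g d) (J K : ℕ) :
    pathPosP Q J K = (g (J + K + 3)).det * (g (J + K + 1)).det *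
      ((d (J + 2)).det * (d J).det * (d (K + 2)).det * (d K).det) * pathPosP P J K := by
  have := h.colDet_eq ![J + K + 3, J + K + 1] ![J + 2, J, K + 2, K]
    ![![some 0, none, some 1, none], ![none, some 0, some 1, some 1]]
    (N := 2 * (J + 1 + (K + 1))) (by simp; omega) (by simp [Fin.sum_univ_succ]; omega)
    (fun P c r => if r < J + K + 3 then
      if c < J + 2 then P 0 (J + K + 3) (J + 2) r c
      else if c < 2 * J + 2 then 0
      else if c < 2 * J + K + 4 then P 1 (J + K + 3) (K + 2) r (c - (2 * J + 2))
      else 0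
    else
      if c < J + 2 then 0
      else if c < 2 * J + 2 then P 0 (J + K + 1) J (r - (J + K + 3)) (c - (J + 2))
      else if c < 2 * J + K + 4 then
        P 1 (J + K + 1) (K + 2) (r - (J + K + 3)) (c - (2 * J + 2))
      else P 1 (J + K + 1) K (r - (J + K + 3)) (c - (2 * J + K + 4)))
    (fun P a b r c hr hc => by
      fin_cases a <;> fin_cases b <;>
        simp [blockStart, pathBlock, Fin.sum_univ_succ] at hr hc ⊢ <;> grind)
  rw [Fin.prod_univ_two, Fin.prod_univ_four] at this
  exact this

lemma PathFamily.IsScaled.pathHor_eq (h : P.IsScaled Q g d) (J : ℕ) :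
    pathHor Q J = (g (J + 2)).det * (g J).det * (g 1).det *
      ((d (J + 2)).det * (d J).det * (d 1).det) * pathHor P J := by
  have := h.colDet_eq ![J + 2, J, 1] ![J + 2, J, 1]
    ![![some 0, some 0, some 1], ![some 0, none, none], ![some 1, none, none]]
    (N := 2 * (J + 1) + 1) (by simp [Fin.sum_univ_succ]; omega)
    (by simp [Fin.sum_univ_succ]; omega)
    (fun P c r => if r < J + 2 then
      if c < J + 2 then P 0 (J + 2) (J + 2) r c
      else if c < 2 * J + 2 then P 0 (J + 2) J r (c - (J + 2))
      else P 1 (J + 2) 1 r 0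
    else if r < 2 * J + 2 then
      if c < J + 2 then P 0 J (J + 2) (r - (J + 2)) c else 0
    else
      if c < J + 2 then P 1 1 (J + 2) 0 c else 0)
    (fun P a b r c hr hc => by
      fin_cases a <;> fin_cases b <;>
        simp [blockStart, pathBlock, Fin.sum_univ_succ] at hr hc ⊢ <;> grind)
  rw [Fin.prod_univ_three, Fin.prod_univ_three] at this
  exact this

end

/-- Every matrix of `Q` with indices at most `l` is the top left corner of `K`. -/
def PathFamily.IsCorner (Q : PathFamily R) (l : ℕ) (K : Fin 2 → ℕ → ℕ → R) : Prop :=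
  ∀ ε i j, i ≤ l → j ≤ l → ∀ r < i, ∀ c < j, Q ε i j r c = K ε r c

omit [CommRing R] in
lemma PathFamily.IsCorner.transpose {Q : PathFamily R} {K : Fin 2 → ℕ → ℕ → R}
    (h : Q.IsCorner l K) : Q.transpose.IsCorner l (fun ε r c => K ε c r) :=
  fun ε i j hi hj r hr c hc => h ε j i hj hi c hc r hr

section
variable {Q : PathFamily R} {K : Fin 2 → ℕ → ℕ → R} (h : Q.IsCorner l K)
include h

lemma PathFamily.IsCorner.pathPos_eq {j k : ℕ} (hjk : j + k ≤ l) :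
    pathPos Q j k = flagPos (fun c r => K 0 r c) (fun c r => K 1 r c) j k := by
  refine colDet_congr fun c hc r hr => ?_
  dsimp only
  split_ifs with h₁
  · exact h 0 _ _ hjk (by omega) r hr c h₁
  · exact h 1 _ _ hjk (by omega) r hr _ (by omega)

lemma PathFamily.IsCorner.pathPosP_eq {a b : ℕ} (hab : a + b + 3 ≤ l) :
    pathPosP Q a b = flagPosP (fun c r => K 0 r c) (fun c r => K 1 r c) a b := by
  refine colDet_congr fun c hc r hr => ?_
  dsimp only
  split_ifs
  all_goals first
    | rfl
    | exact h _ _ _ (by omega) (by omega) _ (by omega) _ (by omega)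

lemma PathFamily.IsCorner.pathHor_eq {a : ℕ} (ha : a + 2 ≤ l) :
    pathHor Q a = flagHor (fun c r => K 0 r c) (fun c r => K 1 r c) a := by
  refine colDet_congr fun c hc r hr => ?_
  dsimp only
  split_ifs
  all_goals first
    | rfl
    | exact h _ _ _ (by omega) (by omega) _ (by omega) _ (by omega)

end

section
variable [IsDomain R] {P Q : PathFamily R} {g d : ∀ n, Matrix (Fin n) (Fin n) R}
  {F : Fin 2 → ℕ → ℕ → R}

lemma pathPos_exchange (hs : P.IsScaled Q g d) (hc : Q.IsCorner l F)
    (hg : ∀ n ≤ l, (g n).det ≠ 0) (hd : ∀ n ≤ l, (d n).det ≠ 0) {J K : ℕ} (hl : J + K + 3 ≤ l) :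
    pathPos P (J + 1) (K + 1) * ((-1) ^ ((J + 1) * (K + 1)) * pathPosP P J K) =
      pathPos P J (K + 1) * pathPos P (J + 2) K * pathPos P (J + 1) (K + 2) +
      pathPos P (J + 1) K * pathPos P J (K + 2) * pathPos P (J + 2) (K + 1) := by
  have h := flagPos_exchange (fun c r => F 0 r c) (fun c r => F 1 r c) J K
  rw [← hc.pathPosP_eq hl, hs.pathPosP_eq] at h
  rw [← hc.pathPos_eq (by omega), ← hc.pathPos_eq (by omega), ← hc.pathPos_eq (by omega),
    ← hc.pathPos_eq (by omega), ← hc.pathPos_eq (by omega), ← hc.pathPos_eq (by omega),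
    ← hc.pathPos_eq (by omega)] at h
  simp only [hs.pathPos_eq] at h
  rw [show J + 1 + (K + 1) = J + K + 2 by omega, show J + (K + 1) = J + K + 1 by omega,
    show J + 2 + K = J + K + 2 by omega, show J + 1 + (K + 2) = J + K + 3 by omega,
    show J + 1 + K = J + K + 1 by omega, show J + (K + 2) = J + K + 2 by omega,
    show J + 2 + (K + 1) = J + K + 3 by omega] at h
  have hne : (g (J + K + 1)).det * (g (J + K + 2)).det * (g (J + K + 3)).det *
      ((d J).det * (d (J + 1)).det * (d (J + 2)).det) *
      ((d K).det * (d (K + 1)).det * (d (K + 2)).det) ≠ 0 := by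
    simp only [mul_ne_zero_iff]
    refine ⟨⟨⟨⟨?_, ?_⟩, ?_⟩, ⟨?_, ?_⟩, ?_⟩, ⟨?_, ?_⟩, ?_⟩ <;>
      first | exact hg _ (by omega) | exact hd _ (by omega)
  refine mul_left_cancel₀ hne ?_
  linear_combination h

lemma pathHor_exchange (hs : P.IsScaled Q g d) (hc : Q.IsCorner l F)
    (hg : ∀ n ≤ l, (g n).det ≠ 0) (hd : ∀ n ≤ l, (d n).det ≠ 0) {J : ℕ} (hl : J + 2 ≤ l) :
    pathPos P (J + 1) 0 * ((-1) ^ (J + 1) * pathHor P J) =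
      pathPos P J 0 * pathPos P.transpose (J + 1) 1 * pathPos P (J + 1) 1 +
        pathPos P.transpose J 1 * pathPos P J 1 * pathPos P (J + 2) 0 := by
  have h := flagHor_exchange (fun c r => F 0 r c) (fun c r => F 1 r c) J
  rw [← hc.pathHor_eq hl, hs.pathHor_eq] at h
  have ht := hc.transpose
  rw [← hc.pathPos_eq (j := J + 1) (k := 0) (by omega), ← hc.pathPos_eq (j := J) (k := 0) (by omega),
    ← hc.pathPos_eq (j := J + 1) (k := 1) (by omega), ← hc.pathPos_eq (j := J) (k := 1) (by omega),
    ← hc.pathPos_eq (j := J + 2) (k := 0) (by omega),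
    ← ht.pathPos_eq (j := J + 1) (k := 1) (by omega),
    ← ht.pathPos_eq (j := J) (k := 1) (by omega)] at h
  simp only [hs.pathPos_eq, hs.transpose.pathPos_eq, Matrix.det_transpose,
    Matrix.det_isEmpty, mul_one] at h
  rw [show J + 1 + 1 = J + 2 by omega] at h
  have hne : (g J).det * (g (J + 1)).det * (g (J + 2)).det * (g 1).det *
      ((d J).det * (d (J + 1)).det * (d (J + 2)).det * (d 1).det) ≠ 0 := by
    simp only [mul_ne_zero_iff]
    refine ⟨⟨⟨⟨?_, ?_⟩, ?_⟩, ?_⟩, ⟨⟨?_, ?_⟩, ?_⟩, ?_⟩ <;>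
      first | exact hg _ (by omega) | exact hd _ (by omega)
  refine mul_left_cancel₀ hne ?_
  linear_combination h

end

/-- Square matrices completing the flag of row spaces given by the matrices `A n`. -/
def flagCompletion (A : ∀ n, Matrix (Fin n) (Fin (n + 1)) R) : ∀ n, Matrix (Fin n) (Fin n) R
  | 0 => 1
  | n + 1 => Matrix.of (Fin.lastCases (motive := fun _ => Fin (n + 1) → R)
      (Pi.single (Fin.last n) 1) fun r => (flagCompletion A n * A n) r)

lemma flagCompletion_castSucc (A : ∀ n, Matrix (Fin n) (Fin (n + 1)) R) (n : ℕ) (r : Fin n) :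
    flagCompletion A (n + 1) r.castSucc = (flagCompletion A n * A n) r := by
  rw [flagCompletion]
  exact Fin.lastCases_castSucc (motive := fun _ => Fin (n + 1) → R) r

lemma flagCompletion_last (A : ∀ n, Matrix (Fin n) (Fin (n + 1)) R) (n : ℕ) :
    flagCompletion A (n + 1) (Fin.last n) = Pi.single (Fin.last n) 1 := by
  rw [flagCompletion]
  exact Fin.lastCases_last (motive := fun _ => Fin (n + 1) → R)

lemma det_flagCompletion_succ (A : ∀ n, Matrix (Fin n) (Fin (n + 1)) R) (n : ℕ) :
    (flagCompletion A (n + 1)).det =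
      (flagCompletion A n).det * ((A n).submatrix id Fin.castSucc).det := by
  rw [Matrix.det_succ_row _ (Fin.last n), Finset.sum_eq_single (Fin.last n)]
  · rw [flagCompletion_last, Pi.single_eq_same, ← Matrix.det_mul]
    simp only [Fin.val_last, Fin.succAbove_last, mul_one, (Even.add_self n).neg_one_pow, one_mul]
    congr 1
    ext r c
    simp only [Matrix.submatrix_apply, flagCompletion_castSucc, Matrix.mul_apply, id]
  · intro c _ hc
    rw [flagCompletion_last, Pi.single_eq_of_ne hc]
    simp
  · simp

lemma det_flagCompletion_ne_zero [IsDomain R] (A : ∀ n, Matrix (Fin n) (Fin (n + 1)) R)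
    (h : ∀ n < l, ((A n).submatrix id Fin.castSucc).det ≠ 0) {n : ℕ} (hn : n ≤ l) :
    (flagCompletion A n).det ≠ 0 := by
  induction n with
  | zero => simp
  | succ n ih =>
    rw [det_flagCompletion_succ]
    exact mul_ne_zero (ih (by omega)) (h n (by omega))

/-- The paths of `P` starting at `i < l` begin with the matrix `A i`. -/
def PathFamily.IsChain (P : PathFamily R) (l : ℕ) (A : ∀ n, Matrix (Fin n) (Fin (n + 1)) R) :
    Prop :=
  ∀ ε i j, i + 1 ≤ l → j ≤ l → ∀ (r : Fin i) (c : Fin j),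
    P ε i j r c = ∑ s : Fin (i + 1), A i r s * P ε (i + 1) j s c

lemma PathFamily.IsChain.scaled_succ {P Q : PathFamily R} {A : ∀ n, Matrix (Fin n) (Fin (n + 1)) R}
    {d : ∀ n, Matrix (Fin n) (Fin n) R} (h : P.IsChain l A)
    (hs : P.IsScaled Q (flagCompletion A) d) {i j : ℕ} (hi : i + 1 ≤ l) (hj : j ≤ l) (ε : Fin 2)
    {r c : ℕ} (hr : r < i) (hc : c < j) : Q ε i j r c = Q ε (i + 1) j r c := by
  have h1 := hs ε i j ⟨r, hr⟩ ⟨c, hc⟩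
  have h2 := hs ε (i + 1) j (Fin.castSucc ⟨r, hr⟩) ⟨c, hc⟩
  have h3 : Matrix.of (fun (r : Fin i) (c : Fin j) => P ε i j r c) =
      A i * Matrix.of (fun (r : Fin (i + 1)) (c : Fin j) => P ε (i + 1) j r c) := by
    ext r c
    exact h ε i j hi hj r c
  rw [h3, ← Matrix.mul_assoc, Matrix.mul_assoc] at h1
  rw [Matrix.mul_assoc] at h2
  refine h1.trans (Eq.trans ?_ h2.symm)
  rw [Matrix.mul_apply, Matrix.mul_apply]
  exact Finset.sum_congr rfl fun s _ => by rw [flagCompletion_castSucc]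

lemma PathFamily.IsChain.isCorner {P Q : PathFamily R} {A B : ∀ n, Matrix (Fin n) (Fin (n + 1)) R}
    (hA : P.IsChain l A) (hB : P.transpose.IsChain l B)
    (hs : P.IsScaled Q (flagCompletion A) (fun n => (flagCompletion B n).transpose)) :
    Q.IsCorner l (fun ε => Q ε l l) := by
  have ht : P.transpose.IsScaled Q.transpose (flagCompletion B)
      (fun n => (flagCompletion A n).transpose) := hs.transpose
  have rows (ε : Fin 2) (j : ℕ) (hj : j ≤ l) (i : ℕ) (hi : i ≤ l) :
      ∀ r < i, ∀ c < j, Q ε i j r c = Q ε l j r c := by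
    induction hi using Nat.decreasingInduction with
    | self => intros; rfl
    | of_succ i hi ih =>
      intro r hr c hc
      rw [hA.scaled_succ hs hi hj ε hr hc, ih r (by omega) c hc]
  have cols (ε : Fin 2) (j : ℕ) (hj : j ≤ l) :
      ∀ r < l, ∀ c < j, Q ε l j r c = Q ε l l r c := by
    induction hj using Nat.decreasingInduction with
    | self => intros; rfl
    | of_succ j hj ih =>
      intro r hr c hc
      rw [← ih r hr c (by omega)]
      exact hB.scaled_succ ht hj le_rfl ε hc hr
  intro ε i j hi hj r hr c hc
  rw [rows ε j hj i hi r hr c hc, cols ε j hj r (by omega) c hc]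

/-- The family obtained from `P` by the changes of basis `g` and `d`. -/
def PathFamily.scale (P : PathFamily R) (g d : ∀ n, Matrix (Fin n) (Fin n) R) : PathFamily R :=
  fun ε i j r c => if h : r < i ∧ c < j then
    (g i * Matrix.of (fun (r : Fin i) (c : Fin j) => P ε i j r c) * d j) ⟨r, h.1⟩ ⟨c, h.2⟩ else 0

lemma PathFamily.isScaled_scale (P : PathFamily R) (g d : ∀ n, Matrix (Fin n) (Fin n) R) :
    P.IsScaled (P.scale g d) g d := by
  intro ε i j r c
  rw [PathFamily.scale, dif_pos ⟨r.2, c.2⟩]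

/-- The matrices of all paths of the representation `M`. -/
def pathFamily (M : RepK2 l R) : PathFamily R := fun ε i j r c =>
  if h : r < l ∧ c < l then
    (chainNeg M i * M.kr ε * chainPos M j) ⟨r, h.1⟩ ⟨c, h.2⟩
  else 0

lemma pathMat_eq (M : RepK2 l R) (ε : Fin 2) {i j : ℕ} (hi : i ≤ l) (hj : j ≤ l) (r : Fin i)
    (c : Fin j) : pathMat M ε i j hi hj r c = pathFamily M ε i j r c := by
  rw [pathFamily, dif_pos ⟨by omega, by omega⟩]
  rfl

omit [CommRing R] in
lemma PathFamily.congr (P : PathFamily R) (ε : Fin 2) {i j r c i' j' r' c' : ℕ} (hi : i = i')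
    (hj : j = j') (hr : r = r') (hc : c = c') : P ε i j r c = P ε i' j' r' c' := by
  subst hi hj hr hc
  rfl

lemma sPos_eq (M : RepK2 l R) (j k : ℕ) (h : j + k ≤ l) :
    sPos M j k h = pathPos (pathFamily M) j k := by
  unfold sPos pathPos colDet
  congr 1
  ext r c
  simp only [Matrix.of_apply]
  induction c using Fin.addCases with
  | left c =>
    rw [finSumFinEquiv_symm_apply_castAdd, Sum.elim_inl, pathMat_eq, Fin.val_castAdd, if_pos c.2]
  | right c =>
    rw [finSumFinEquiv_symm_apply_natAdd, Sum.elim_inr, pathMat_eq, Fin.val_natAdd,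
      if_neg (by omega), Nat.add_sub_cancel_left]

lemma sNeg_eq (M : RepK2 l R) (j k : ℕ) (h : j + k ≤ l) :
    sNeg M j k h = pathPos (pathFamily M).transpose j k := by
  unfold sNeg pathPos colDet
  rw [← Matrix.det_transpose]
  congr 1
  ext r c
  simp only [Matrix.of_apply, Matrix.transpose_apply, PathFamily.transpose]
  induction c using Fin.addCases with
  | left c =>
    rw [finSumFinEquiv_symm_apply_castAdd, Sum.elim_inl, pathMat_eq, Fin.val_castAdd, if_pos c.2]
  | right c =>
    rw [finSumFinEquiv_symm_apply_natAdd, Sum.elim_inr, pathMat_eq, Fin.val_natAdd,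
      if_neg (by omega), Nat.add_sub_cancel_left]

lemma det_eq_colDet {n N : ℕ} (hn : n = N) (A : Matrix (Fin n) (Fin n) R) (f : ℕ → ℕ → R)
    (h : ∀ r c : Fin n, A r c = f c r) : A.det = colDet N f := by
  subst hn
  unfold colDet
  congr 1
  ext r c
  exact h r c

lemma sPosP_eq (M : RepK2 l R) (J K : ℕ) (h1 : 1 ≤ J + 1) (h2 : 1 ≤ K + 1)
    (h : J + 1 + (K + 1) + 1 ≤ l) :
    sPosP M (J + 1) (K + 1) h1 h2 h =
      (-1) ^ ((J + 1) * (K + 1)) * pathPosP (pathFamily M) J K := by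
  unfold sPosP pathPosP
  congr 1
  refine det_eq_colDet rfl _ _ fun r c => ?_
  simp only [Matrix.of_apply, pathMat_eq]
  split_ifs
  all_goals first
    | rfl
    | omega
    | exact (pathFamily M).congr _ (by omega) (by omega) (by omega) (by omega)

lemma sNegP_eq (M : RepK2 l R) (J K : ℕ) (h1 : 1 ≤ J + 1) (h2 : 1 ≤ K + 1)
    (h : J + 1 + (K + 1) + 1 ≤ l) :
    sNegP M (J + 1) (K + 1) h1 h2 h =
      (-1) ^ ((J + 1) * (K + 1)) * pathPosP (pathFamily M).transpose J K := by
  unfold sNegP pathPosP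
  congr 1
  rw [← Matrix.det_transpose]
  refine det_eq_colDet rfl _ _ fun r c => ?_
  simp only [Matrix.transpose_apply, Matrix.of_apply, pathMat_eq, PathFamily.transpose]
  split_ifs
  all_goals first
    | rfl
    | omega
    | exact (pathFamily M).congr _ (by omega) (by omega) (by omega) (by omega)

lemma sHorP_eq (M : RepK2 l R) (J : ℕ) (h1 : 1 ≤ J + 1) (h : J + 1 + 1 ≤ l) :
    sHorP M (J + 1) h1 h = (-1) ^ (J + 1) * pathHor (pathFamily M) J := by
  unfold sHorP pathHor
  congr 1
  refine det_eq_colDet rfl _ _ fun r c => ?_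
  simp only [Matrix.of_apply, pathMat_eq]
  split_ifs
  all_goals first
    | rfl
    | omega
    | exact (pathFamily M).congr _ (by omega) (by omega) (by omega) (by omega)

/-- The matrix of the arrow from `−n`, or an arbitrary matrix if there is no such arrow. -/
def RepK2.negArrow (M : RepK2 l R) : ∀ n, Matrix (Fin n) (Fin (n + 1)) R
  | 0 => 0
  | n + 1 => if h : n < l - 1 then M.neg ⟨n, h⟩ else 0

/-- The transposed matrix of the arrow to `n`, or an arbitrary matrix if there is no such arrow. -/
def RepK2.posArrow (M : RepK2 l R) : ∀ n, Matrix (Fin n) (Fin (n + 1)) R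
  | 0 => 0
  | n + 1 => if h : n < l - 1 then (M.pos ⟨n, h⟩).transpose else 0

lemma chainNeg_succ (M : RepK2 l R) {n : ℕ} (h : n < l - 1) :
    chainNeg M (n + 1) = padM l (M.neg ⟨n, h⟩) * chainNeg M (n + 2) := by
  unfold chainNeg
  rw [show l - (n + 1) = l - (n + 2) + 1 by omega, List.range_succ_eq_map, List.map_cons,
    List.prod_cons, List.map_map]
  congr 1
  · exact dif_pos h
  · congr 2
    funext d
    rw [Function.comp_apply]
    have e : n + 1 - 1 + d.succ = n + 2 - 1 + d := by omega
    generalize n + 1 - 1 + d.succ = a at e ⊢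
    rw [e]

lemma chainPos_succ (M : RepK2 l R) {n : ℕ} (h : n < l - 1) :
    chainPos M (n + 1) = chainPos M (n + 2) * padM l (M.pos ⟨n, h⟩) := by
  unfold chainPos
  rw [show l - (n + 1) = l - (n + 2) + 1 by omega, List.range_succ, List.map_append,
    List.prod_append, List.map_singleton, List.prod_singleton]
  congr 1
  have hn : l - 2 - (l - (n + 2)) = n := by omega
  rw [dif_pos (by omega)]
  congr 3

lemma padM_mul_apply {a b : ℕ} (ha : a ≤ l) (hb : b ≤ l) (A : Matrix (Fin a) (Fin b) R)
    (X : Matrix (Fin l) (Fin l) R) (r : Fin a) (c : Fin l) :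
    (padM l A * X) (Fin.castLE ha r) c = ∑ s, A r s * X (Fin.castLE hb s) c := by
  rw [Matrix.mul_apply]
  symm
  refine Finset.sum_of_injOn (Fin.castLE hb) (Fin.castLE_injective hb).injOn (by simp) ?_ ?_
  · intro s _ hs
    have : ¬ s.1 < b := fun h => hs ⟨⟨s, h⟩, by simp, rfl⟩
    simp [padM, this]
  · intro s _
    simp [padM]

lemma mul_padM_apply {a b : ℕ} (ha : a ≤ l) (hb : b ≤ l) (A : Matrix (Fin a) (Fin b) R)
    (X : Matrix (Fin l) (Fin l) R) (r : Fin l) (c : Fin b) :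
    (X * padM l A) r (Fin.castLE hb c) = ∑ s, A s c * X r (Fin.castLE ha s) := by
  rw [Matrix.mul_apply]
  symm
  refine Finset.sum_of_injOn (Fin.castLE ha) (Fin.castLE_injective ha).injOn (by simp) ?_ ?_
  · intro s _ hs
    have : ¬ s.1 < a := fun h => hs ⟨⟨s, h⟩, by simp, rfl⟩
    simp [padM, this]
  · intro s _
    simp [padM, mul_comm]

lemma isChain_negArrow (M : RepK2 l R) : (pathFamily M).IsChain l M.negArrow := by
  rintro ε (_ | n) j hi hj r c
  · exact r.elim0
  have h : n < l - 1 := by omega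
  rw [pathFamily, dif_pos ⟨by omega, by omega⟩, chainNeg_succ M h, Matrix.mul_assoc,
    Matrix.mul_assoc]
  refine (padM_mul_apply (by omega) (by omega) (M.neg ⟨n, h⟩) _ r _).trans ?_
  refine Finset.sum_congr rfl fun s _ => ?_
  rw [RepK2.negArrow, dif_pos h, pathFamily, dif_pos ⟨by omega, by omega⟩, Matrix.mul_assoc]
  rfl

lemma isChain_posArrow (M : RepK2 l R) : (pathFamily M).transpose.IsChain l M.posArrow := by
  rintro ε (_ | n) j hi hj r c
  · exact r.elim0
  have h : n < l - 1 := by omega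
  rw [PathFamily.transpose, pathFamily, dif_pos ⟨by omega, by omega⟩, chainPos_succ M h,
    ← Matrix.mul_assoc]
  refine (mul_padM_apply (by omega) (by omega) (M.pos ⟨n, h⟩) _ _ r).trans ?_
  refine Finset.sum_congr rfl fun s _ => ?_
  rw [RepK2.posArrow, dif_pos h, PathFamily.transpose, pathFamily, dif_pos ⟨by omega, by omega⟩]
  rfl

section
variable [IsDomain R] (M : RepK2 l R)
  (hneg : ∀ n < l, ((M.negArrow n).submatrix id Fin.castSucc).det ≠ 0)
  (hpos : ∀ n < l, ((M.posArrow n).submatrix id Fin.castSucc).det ≠ 0)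
include hneg hpos

lemma pathPos_pathFamily_exchange {J K : ℕ} (hl : J + K + 3 ≤ l) :
    pathPos (pathFamily M) (J + 1) (K + 1) *
        ((-1) ^ ((J + 1) * (K + 1)) * pathPosP (pathFamily M) J K) =
      pathPos (pathFamily M) J (K + 1) * pathPos (pathFamily M) (J + 2) K *
          pathPos (pathFamily M) (J + 1) (K + 2) +
        pathPos (pathFamily M) (J + 1) K * pathPos (pathFamily M) J (K + 2) *
          pathPos (pathFamily M) (J + 2) (K + 1) :=
  have hs := PathFamily.isScaled_scale (pathFamily M) (flagCompletion M.negArrow)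
    fun n => (flagCompletion M.posArrow n).transpose
  pathPos_exchange hs ((isChain_negArrow M).isCorner (isChain_posArrow M) hs)
    (fun _ hn => det_flagCompletion_ne_zero _ hneg hn)
    (fun _ hn => by rw [Matrix.det_transpose]; exact det_flagCompletion_ne_zero _ hpos hn) hl

lemma pathPos_transpose_pathFamily_exchange {J K : ℕ} (hl : J + K + 3 ≤ l) :
    pathPos (pathFamily M).transpose (J + 1) (K + 1) *
        ((-1) ^ ((J + 1) * (K + 1)) * pathPosP (pathFamily M).transpose J K) =
      pathPos (pathFamily M).transpose J (K + 1) * pathPos (pathFamily M).transpose (J + 2) K *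
          pathPos (pathFamily M).transpose (J + 1) (K + 2) +
        pathPos (pathFamily M).transpose (J + 1) K * pathPos (pathFamily M).transpose J (K + 2) *
          pathPos (pathFamily M).transpose (J + 2) (K + 1) :=
  have hs := PathFamily.isScaled_scale (pathFamily M).transpose (flagCompletion M.posArrow)
    fun n => (flagCompletion M.negArrow n).transpose
  pathPos_exchange hs ((isChain_posArrow M).isCorner (isChain_negArrow M) hs)
    (fun _ hn => det_flagCompletion_ne_zero _ hpos hn)
    (fun _ hn => by rw [Matrix.det_transpose]; exact det_flagCompletion_ne_zero _ hneg hn) hl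

lemma pathHor_pathFamily_exchange {J : ℕ} (hl : J + 2 ≤ l) :
    pathPos (pathFamily M) (J + 1) 0 * ((-1) ^ (J + 1) * pathHor (pathFamily M) J) =
      pathPos (pathFamily M) J 0 * pathPos (pathFamily M).transpose (J + 1) 1 *
          pathPos (pathFamily M) (J + 1) 1 +
        pathPos (pathFamily M).transpose J 1 * pathPos (pathFamily M) J 1 *
          pathPos (pathFamily M) (J + 2) 0 :=
  have hs := PathFamily.isScaled_scale (pathFamily M) (flagCompletion M.negArrow)
    fun n => (flagCompletion M.posArrow n).transpose
  pathHor_exchange hs ((isChain_negArrow M).isCorner (isChain_posArrow M) hs)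
    (fun _ hn => det_flagCompletion_ne_zero _ hneg hn)
    (fun _ hn => by rw [Matrix.det_transpose]; exact det_flagCompletion_ne_zero _ hpos hn) hl

end

section
variable {S : Type} [CommRing S] (φ : S →+* R)

/-- Extension of scalars for representations. -/
def RepK2.map (M : RepK2 l S) : RepK2 l R where
  neg t := (M.neg t).map φ
  pos t := (M.pos t).map φ
  kr ε := (M.kr ε).map φ

lemma padM_map {a b : ℕ} (A : Matrix (Fin a) (Fin b) S) :
    (padM l A).map φ = padM l (A.map φ) := by
  ext r c
  simp only [padM, Matrix.map_apply]
  split_ifs <;> simp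

lemma chainNeg_map (M : RepK2 l S) (i : ℕ) : chainNeg (M.map φ) i = (chainNeg M i).map φ := by
  unfold chainNeg
  rw [← RingHom.mapMatrix_apply, map_list_prod, List.map_map]
  congr 2
  funext d
  simp only [Function.comp_apply]
  split_ifs
  · rw [RingHom.mapMatrix_apply, padM_map]
    rfl
  · rw [map_one]

lemma chainPos_map (M : RepK2 l S) (j : ℕ) : chainPos (M.map φ) j = (chainPos M j).map φ := by
  unfold chainPos
  rw [← RingHom.mapMatrix_apply, map_list_prod, List.map_map]
  congr 2
  funext d
  simp only [Function.comp_apply]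
  split_ifs
  · rw [RingHom.mapMatrix_apply, padM_map]
    rfl
  · rw [map_one]

lemma pathFamily_map (M : RepK2 l S) (ε : Fin 2) (i j r c : ℕ) :
    pathFamily (M.map φ) ε i j r c = φ (pathFamily M ε i j r c) := by
  unfold pathFamily
  split_ifs
  · rw [chainNeg_map, chainPos_map, RepK2.map, ← Matrix.map_mul, ← Matrix.map_mul,
      Matrix.map_apply]
  · rw [map_zero]

lemma map_colDet (n : ℕ) (f : ℕ → ℕ → S) : φ (colDet n f) = colDet n fun c r => φ (f c r) := by
  unfold colDet
  rw [RingHom.map_det]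
  rfl

variable {P : PathFamily S} {P' : PathFamily R}
  (h : ∀ ε i j r c, P' ε i j r c = φ (P ε i j r c))
include h

lemma map_pathPos (j k : ℕ) : φ (pathPos P j k) = pathPos P' j k := by
  unfold pathPos
  rw [map_colDet]
  simp only [apply_ite φ, h]

lemma map_pathPosP (J K : ℕ) : φ (pathPosP P J K) = pathPosP P' J K := by
  unfold pathPosP
  rw [map_colDet]
  simp only [apply_ite φ, map_zero, h]

lemma map_pathHor (J : ℕ) : φ (pathHor P J) = pathHor P' J := by
  unfold pathHor
  rw [map_colDet]
  simp only [apply_ite φ, map_zero, h]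

end

open Polynomial in
/-- A one-parameter deformation of `M` along which all arrows of the arms are of full rank. -/
def RepK2.deform (M : RepK2 l R) : RepK2 l R[X] where
  neg t := Matrix.of fun r c => C (M.neg t r c) + if r.1 = c.1 then X else 0
  pos t := Matrix.of fun r c => C (M.pos t r c) + if r.1 = c.1 then X else 0
  kr ε := (M.kr ε).map C

open Polynomial in
lemma RepK2.deform_map (M : RepK2 l R) : M.deform.map (evalRingHom 0) = M := by
  obtain ⟨neg, pos, kr⟩ := M
  unfold RepK2.deform RepK2.map
  congr
  · funext t
    ext r c
    simp only [Matrix.map_apply, Matrix.of_apply, coe_evalRingHom]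
    split_ifs <;> simp
  · funext t
    ext r c
    simp only [Matrix.map_apply, Matrix.of_apply, coe_evalRingHom]
    split_ifs <;> simp
  · funext ε
    ext r c
    simp

open Polynomial in
lemma det_deform_ne_zero [Nontrivial R] {n : ℕ} (A : Matrix (Fin n) (Fin n) R) :
    (Matrix.of fun r c => C (A r c) + if r = c then X else 0).det ≠ 0 := by
  have : (Matrix.of fun r c => C (A r c) + if r = c then X else 0) = (-A).charmatrix := by
    ext1 r c
    by_cases h : r = c
    · subst h
      simp [Matrix.charmatrix_apply_eq, add_comm]
    · simp [h]
  rw [this]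
  exact (Matrix.charpoly_monic _).ne_zero

lemma det_deform_negArrow_ne_zero [Nontrivial R] (M : RepK2 l R) :
    ∀ n < l, ((M.deform.negArrow n).submatrix id Fin.castSucc).det ≠ 0 := by
  rintro (_ | n) hn
  · simp
  rw [RepK2.negArrow, dif_pos (by omega)]
  convert det_deform_ne_zero ((M.neg ⟨n, by omega⟩).submatrix id Fin.castSucc) using 2
  ext1 r c
  simp [RepK2.deform, Fin.ext_iff]

lemma det_deform_posArrow_ne_zero [Nontrivial R] (M : RepK2 l R) :
    ∀ n < l, ((M.deform.posArrow n).submatrix id Fin.castSucc).det ≠ 0 := by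
  rintro (_ | n) hn
  · simp
  rw [RepK2.posArrow, dif_pos (by omega)]
  convert det_deform_ne_zero ((M.pos ⟨n, by omega⟩).transpose.submatrix id Fin.castSucc) using 2
  ext1 r c
  simp [RepK2.deform, Fin.ext_iff, eq_comm]

/-- **Statement 14**: the exchange identities in `SI_{β_l}(K^2_{l,l})`:
`s^±_{i;j,k} (s^±_{i;j,k})' = s^±_{i−1;j−1,k} s^±_{i;j+1,k−1} s^±_{i+1;j,k+1}
 + s^±_{i−1;j,k−1} s^±_{i;j−1,k+1} s^±_{i+1;j+1,k}` for non-horizontal mutable labels, and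
`s_{i;i,0} (s_{i;i,0})' = s_{i−1;i−1,0} s_{i,1;i+1} s_{i+1;i,1}
 + s_{i−1,1;i} s_{i;i−1,1} s_{i+1;i+1,0}` for horizontal mutable labels. -/
theorem statement14 (l : ℕ) (hl : 1 ≤ l) :
    (∀ (j k : ℕ) (h1 : 1 ≤ j) (h2 : 1 ≤ k) (h : j + k + 1 ≤ l) (M : RepK2 l ℂ),
      sPos M j k (by omega) * sPosP M j k h1 h2 h =
        sPos M (j - 1) k (by omega) * sPos M (j + 1) (k - 1) (by omega) *
          sPos M j (k + 1) (by omega) +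
        sPos M j (k - 1) (by omega) * sPos M (j - 1) (k + 1) (by omega) *
          sPos M (j + 1) k (by omega)) ∧
    (∀ (j k : ℕ) (h1 : 1 ≤ j) (h2 : 1 ≤ k) (h : j + k + 1 ≤ l) (M : RepK2 l ℂ),
      sNeg M j k (by omega) * sNegP M j k h1 h2 h =
        sNeg M (j - 1) k (by omega) * sNeg M (j + 1) (k - 1) (by omega) *
          sNeg M j (k + 1) (by omega) +
        sNeg M j (k - 1) (by omega) * sNeg M (j - 1) (k + 1) (by omega) *
          sNeg M (j + 1) k (by omega)) ∧
    (∀ (i : ℕ) (h1 : 1 ≤ i) (h : i + 1 ≤ l) (M : RepK2 l ℂ),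
      sPos M i 0 (by omega) * sHorP M i h1 h =
        sPos M (i - 1) 0 (by omega) * sNeg M i 1 (by omega) * sPos M i 1 (by omega) +
        sNeg M (i - 1) 1 (by omega) * sPos M (i - 1) 1 (by omega) *
          sPos M (i + 1) 0 (by omega)) := by
  have key (M : RepK2 l ℂ) := pathFamily_map (Polynomial.evalRingHom 0) M.deform
  simp only [RepK2.deform_map] at key
  have keyT (M : RepK2 l ℂ) (ε : Fin 2) (i j r c : ℕ) : (pathFamily M).transpose ε i j r c =
      Polynomial.evalRingHom 0 ((pathFamily M.deform).transpose ε i j r c) := key M ε j i c r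
  refine ⟨?_, ?_, ?_⟩
  · rintro (_ | J) (_ | K) h1 h2 h M
    iterate 3 omega
    have e := congrArg (Polynomial.evalRingHom 0) (pathPos_pathFamily_exchange M.deform
      (det_deform_negArrow_ne_zero M) (det_deform_posArrow_ne_zero M)
      (show J + K + 3 ≤ l by omega))
    simp only [map_add, map_mul, map_pow, map_neg, map_one, map_pathPos _ (key M),
      map_pathPosP _ (key M)] at e
    simpa only [sPos_eq, sPosP_eq, Nat.add_sub_cancel] using e
  · rintro (_ | J) (_ | K) h1 h2 h M
    iterate 3 omega
    have e := congrArg (Polynomial.evalRingHom 0) (pathPos_transpose_pathFamily_exchange M.deform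
      (det_deform_negArrow_ne_zero M) (det_deform_posArrow_ne_zero M)
      (show J + K + 3 ≤ l by omega))
    simp only [map_add, map_mul, map_pow, map_neg, map_one, map_pathPos _ (keyT M),
      map_pathPosP _ (keyT M)] at e
    simpa only [sNeg_eq, sNegP_eq, Nat.add_sub_cancel] using e
  · rintro (_ | J) h1 h M
    · omega
    have e := congrArg (Polynomial.evalRingHom 0) (pathHor_pathFamily_exchange M.deform
      (det_deform_negArrow_ne_zero M) (det_deform_posArrow_ne_zero M)
      (show J + 2 ≤ l by omega))
    simp only [map_add, map_mul, map_pow, map_neg, map_one, map_pathPos _ (key M),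
      map_pathPos _ (keyT M), map_pathHor _ (key M)] at e
    simpa only [sPos_eq, sNeg_eq, sHorP_eq, Nat.add_sub_cancel] using e
end
end

section
/- Consider K^2_{2,2} with dimension vector β_2 = (1,2,2,1); write a representation as (B_{−1}, A_1, A_2, B_1) with B_{−1} a 1×2 matrix, A_1, A_2 2×2 matrices, and B_1 a 2×1 matrix, and set x_1 = B_{−1}A_1B_1, x_2 = B_{−1}A_2B_1, x_3 = det of the 2×2 matrix with rows B_{−1}A_1 and B_{−1}A_2, x_4 = det of the 2×2 matrix with columns A_1B_1 and A_2B_1, x_5 = det A_1, x_6 = det A_2, and x_2° = (x_2²x_5 + x_1²x_6 + x_3x_4)/(x_1x_2), which is a polynomial semi-invariant. Then: (1) the invariant ring SI_{β_2}(K^2_{2,2}) = k[Rep_{β_2}(K^2_{2,2})]^{SL_{β_2}} is minimally presented as k[x_1, x_2, …, x_6, x_2°]/(x_2²x_5 + x_1²x_6 + x_3x_4 − x_1x_2x_2°); (2) setting w_1 = (x_3x_4 + x_1²x_6)/x_2 − x_2x_5 and w_2 = (w_1² + 4x_3x_4x_5)/x_1², both of which are polynomial U-invariants, the U-invariant subring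 SI_{β_2}(K^2_{2,2})^U is minimally presented as k[w_1, w_2, x_1, x_3, x_4, x_5]/(w_1² + 4x_3x_4x_5 − w_2x_1²). -/
noncomputable section

/-! ## The semi-invariant ring of `K^2_{2,2}` with dimension vector `β_2 = (1,2,2,1)` -/

/-- A representation `(B₋₁, A₁, A₂, B₁)` of `K^2_{2,2}` of dimension vector `(1,2,2,1)`. -/
abbrev Rep22 : Type :=
  Matrix (Fin 1) (Fin 2) ℂ × Matrix (Fin 2) (Fin 2) ℂ × Matrix (Fin 2) (Fin 2) ℂ ×
    Matrix (Fin 2) (Fin 1) ℂ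

namespace Rep22

def Bm (M : Rep22) := M.1
def A1 (M : Rep22) := M.2.1
def A2 (M : Rep22) := M.2.2.1
def Bp (M : Rep22) := M.2.2.2

end Rep22

/-- `x₁ = B₋₁A₁B₁`. -/
def x1 (M : Rep22) : ℂ := (M.Bm * M.A1 * M.Bp) 0 0
/-- `x₂ = B₋₁A₂B₁`. -/
def x2 (M : Rep22) : ℂ := (M.Bm * M.A2 * M.Bp) 0 0
/-- `x₃ = det (B₋₁A₁ ; B₋₁A₂)` (rows). -/
def x3 (M : Rep22) : ℂ :=
  Matrix.det (Matrix.of fun r c : Fin 2 =>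
    if r = 0 then (M.Bm * M.A1) 0 c else (M.Bm * M.A2) 0 c)
/-- `x₄ = det (A₁B₁ | A₂B₁)` (columns). -/
def x4 (M : Rep22) : ℂ :=
  Matrix.det (Matrix.of fun r c : Fin 2 =>
    if c = 0 then (M.A1 * M.Bp) r 0 else (M.A2 * M.Bp) r 0)
/-- `x₅ = det A₁`. -/
def x5 (M : Rep22) : ℂ := M.A1.det
/-- `x₆ = det A₂`. -/
def x6 (M : Rep22) : ℂ := M.A2.det

/-- Coordinates of the representation space. -/
abbrev Coord22 : Type := (Fin 1 × Fin 2) ⊕ (Fin 2 × Fin 2) ⊕ (Fin 2 × Fin 2) ⊕ (Fin 2 × Fin 1)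

/-- Reading off coordinates. -/
def coords22 (M : Rep22) : Coord22 → ℂ
  | .inl (r, c) => M.Bm r c
  | .inr (.inl (r, c)) => M.A1 r c
  | .inr (.inr (.inl (r, c))) => M.A2 r c
  | .inr (.inr (.inr (r, c))) => M.Bp r c

/-- Polynomial functions on the representation space. -/
def IsPoly22 (f : Rep22 → ℂ) : Prop :=
  ∃ P : MvPolynomial Coord22 ℂ, ∀ M, f M = MvPolynomial.eval (coords22 M) P

/-- Base change by `(h, g) ∈ GL₂ × GL₂` at the two-dimensional vertices `−2` and `2`
(the `SL₁`-factors act trivially). -/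
def actSL (h g : Matrix (Fin 2) (Fin 2) ℂ) (M : Rep22) : Rep22 :=
  (M.Bm * h, h⁻¹ * M.A1 * g, h⁻¹ * M.A2 * g, g⁻¹ * M.Bp)

/-- Invariance under `SL_{β₂} = SL₁ × SL₂ × SL₂ × SL₁`. -/
def SLInv22 (f : Rep22 → ℂ) : Prop :=
  ∀ h g : Matrix (Fin 2) (Fin 2) ℂ, h.det = 1 → g.det = 1 → ∀ M, f (actSL h g M) = f M

/-- The action of `GL(W) = GL₂` mixing the two middle arrows. -/
def actW22 (u : Matrix (Fin 2) (Fin 2) ℂ) (M : Rep22) : Rep22 :=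
  (M.Bm, u 0 0 • M.A1 + u 1 0 • M.A2, u 0 1 • M.A1 + u 1 1 • M.A2, M.Bp)

/-- Invariance under the upper triangular unipotent subgroup `U ⊆ GL₂`. -/
def UInv22 (f : Rep22 → ℂ) : Prop :=
  ∀ (x : ℂ) (M : Rep22), f (actW22 !![1, x; 0, 1] M) = f M

/-- The invariant ring `SI_{β₂}(K^2_{2,2})`, as a set of functions. -/
def SI22 : Set (Rep22 → ℂ) := {f | IsPoly22 f ∧ SLInv22 f}

/-- The `U`-invariant subring `SI_{β₂}(K^2_{2,2})^U`. -/
def SI22U : Set (Rep22 → ℂ) := {f | IsPoly22 f ∧ SLInv22 f ∧ UInv22 f}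

open MvPolynomial

/-! ### Divisibility in polynomial rings over `ℂ` -/

/-- An irreducible `h` divides every polynomial that vanishes on the part of the zero locus of `h`
where `q` does not vanish, provided that part is nonempty. -/
lemma Irreducible.dvd_of_eval_eq_zero {n : ℕ} {h q P : MvPolynomial (Fin n) ℂ}
    (hirr : Irreducible h) (hq : ∃ t, eval t h = 0 ∧ eval t q ≠ 0)
    (hP : ∀ t, eval t h = 0 → eval t q ≠ 0 → eval t P = 0) : h ∣ P := by
  have hp : Prime h := hirr.prime
  have hprime : (Ideal.span {h}).IsPrime := (Ideal.span_singleton_prime hp.ne_zero).2 hp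
  have hmem : q * P ∈ vanishingIdeal ℂ (zeroLocus ℂ (Ideal.span {h})) := by
    intro t ht
    have ht0 : eval t h = 0 := by
      simpa [aeval_eq_eval] using ht h (Ideal.mem_span_singleton_self h)
    rw [aeval_eq_eval, map_mul]
    by_cases hqt : eval t q = 0
    · rw [hqt, zero_mul]
    · rw [hP t ht0 hqt, mul_zero]
  rw [IsPrime.vanishingIdeal_zeroLocus, Ideal.mem_span_singleton] at hmem
  refine (hp.dvd_or_dvd hmem).resolve_left ?_
  rintro ⟨r, rfl⟩
  obtain ⟨t, ht, ht'⟩ := hq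
  exact ht' (by rw [map_mul, ht, zero_mul])

/-- Setting a variable to zero changes a polynomial by a multiple of that variable. -/
lemma X_dvd_sub_aeval_update {n : ℕ} (i : Fin n) (P : MvPolynomial (Fin n) ℂ) :
    X i ∣ P - aeval (Function.update (X : Fin n → MvPolynomial (Fin n) ℂ) i 0) P := by
  rw [← Ideal.mem_span_singleton, ← Ideal.Quotient.mk_eq_mk_iff_sub_mem]
  have : (Ideal.Quotient.mkₐ ℂ (Ideal.span {(X i : MvPolynomial (Fin n) ℂ)})) =
      (Ideal.Quotient.mkₐ ℂ (Ideal.span {X i})).comp (aeval (Function.update X i 0)) := by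
    ext j
    by_cases hj : j = i
    · subst hj
      simp
    · simp [hj]
  exact DFunLike.congr_fun this P

lemma eval_aeval_update {n : ℕ} (i : Fin n) (P : MvPolynomial (Fin n) ℂ) (t : Fin n → ℂ) :
    eval t (aeval (Function.update (X : Fin n → MvPolynomial (Fin n) ℂ) i 0) P) =
      eval (Function.update t i 0) P := by
  have : ((aeval t : MvPolynomial (Fin n) ℂ →ₐ[ℂ] ℂ).comp (aeval (Function.update X i 0))) =
      aeval (Function.update t i 0) := by
    ext j
    by_cases hj : j = i
    · subst hj; simp
    · simp [hj]
  simpa [aeval_eq_eval] using DFunLike.congr_fun this P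

lemma not_dvd_of_eval {n : ℕ} {p q : MvPolynomial (Fin n) ℂ} (t : Fin n → ℂ)
    (hp : eval t p = 0) (hq : eval t q ≠ 0) : ¬ p ∣ q := by
  rintro ⟨r, rfl⟩
  exact hq (by rw [map_mul, hp, zero_mul])

lemma isRelPrime_X_of_eval {n : ℕ} {i : Fin n} {q : MvPolynomial (Fin n) ℂ} (t : Fin n → ℂ)
    (hp : t i = 0) (hq : eval t q ≠ 0) : IsRelPrime (X i) q :=
  X_prime.irreducible.isRelPrime_iff_not_dvd.2 (not_dvd_of_eval t (by simpa) hq)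

lemma irreducible_mul_X_add_of_mem_supported {n : ℕ} {f g : MvPolynomial (Fin n) ℂ} (i : Fin n)
    (hf0 : f ≠ 0) (hf : f ∈ supported ℂ {i}ᶜ) (hg : g ∈ supported ℂ {i}ᶜ) (h : IsRelPrime f g) :
    Irreducible (f * X i + g) :=
  irreducible_mul_X_add f g i hf0 (fun hi => mem_supported.1 hf hi rfl)
    (fun hi => mem_supported.1 hg hi rfl) h

lemma X_mem_supported_compl {n : ℕ} {i j : Fin n} (h : j ≠ i) :
    (X j : MvPolynomial (Fin n) ℂ) ∈ supported ℂ {i}ᶜ :=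
  X_mem_supported.2 h

lemma irreducible_relation_mod_x1 :
    Irreducible ((X 1) ^ 2 * X 4 + X 2 * X 3 : MvPolynomial (Fin 7) ℂ) := by
  refine irreducible_mul_X_add_of_mem_supported 4 (by simp)
    (pow_mem (X_mem_supported_compl (by decide)) 2)
    (mul_mem (X_mem_supported_compl (by decide)) (X_mem_supported_compl (by decide))) ?_
  exact (isRelPrime_X_of_eval ![0, 0, 1, 1, 0, 0, 0] (by simp) (by simp)).pow_left

lemma irreducible_relation : Irreducible ((X 1) ^ 2 * X 4 + (X 0) ^ 2 * X 5 + X 2 * X 3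
    - X 0 * X 1 * X 6 : MvPolynomial (Fin 7) ℂ) := by
  have hX : ∀ j : Fin 7, j ≠ 4 → (X j : MvPolynomial (Fin 7) ℂ) ∈ supported ℂ {4}ᶜ :=
    fun j => X_mem_supported_compl
  rw [add_assoc, add_sub_assoc]
  refine irreducible_mul_X_add_of_mem_supported 4 (by simp) (pow_mem (hX 1 (by decide)) 2)
    (sub_mem (add_mem (mul_mem (pow_mem (hX 0 (by decide)) 2) (hX 5 (by decide)))
      (mul_mem (hX 2 (by decide)) (hX 3 (by decide))))
      (mul_mem (mul_mem (hX 0 (by decide)) (hX 1 (by decide))) (hX 6 (by decide)))) ?_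
  exact (isRelPrime_X_of_eval ![0, 0, 1, 1, 0, 0, 0] (by simp) (by simp)).pow_left

lemma irreducible_relationU_mod_x1 :
    Irreducible ((X 0) ^ 2 + 4 * (X 3 * X 4 * X 5) : MvPolynomial (Fin 6) ℂ) := by
  have hX : ∀ j : Fin 6, j ≠ 5 → (X j : MvPolynomial (Fin 6) ℂ) ∈ supported ℂ {5}ᶜ :=
    fun j => X_mem_supported_compl
  have h4 : IsUnit (C 4 : MvPolynomial (Fin 6) ℂ) := (isUnit_iff_ne_zero.2 (by norm_num)).map C
  have := irreducible_mul_X_add_of_mem_supported (f := C 4 * (X 3 * X 4)) (g := (X 0) ^ 2) 5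
    (by simp)
    (mul_mem (Subalgebra.algebraMap_mem _ _) (mul_mem (hX 3 (by decide)) (hX 4 (by decide))))
    (pow_mem (hX 0 (by decide)) 2)
    ((isRelPrime_mul_unit_left_left h4).2 (IsRelPrime.mul_left
      (isRelPrime_X_of_eval ![1, 0, 0, 0, 0, 0] (by simp) (by simp))
      (isRelPrime_X_of_eval ![1, 0, 0, 0, 0, 0] (by simp) (by simp))))
  convert this using 1
  rw [show (C 4 : MvPolynomial (Fin 6) ℂ) = 4 from map_ofNat C 4]
  ring

lemma irreducible_relationU :
    Irreducible ((X 0) ^ 2 + 4 * (X 3 * X 4 * X 5) - X 1 * (X 2) ^ 2 :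
      MvPolynomial (Fin 6) ℂ) := by
  have hX : ∀ j : Fin 6, j ≠ 1 → (X j : MvPolynomial (Fin 6) ℂ) ∈ supported ℂ {1}ᶜ :=
    fun j => X_mem_supported_compl
  have := irreducible_mul_X_add_of_mem_supported (f := -(X 2) ^ 2)
    (g := (X 0) ^ 2 + 4 * (X 3 * X 4 * X 5)) 1
    (by simp) (neg_mem (pow_mem (hX 2 (by decide)) 2))
    (add_mem (pow_mem (hX 0 (by decide)) 2) (mul_mem (ofNat_mem _ 4)
      (mul_mem (mul_mem (hX 3 (by decide)) (hX 4 (by decide))) (hX 5 (by decide)))))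
    ((isRelPrime_X_of_eval ![1, 0, 0, 0, 0, 0] (by simp) (by simp)).pow_left.neg_left)
  convert this using 1
  ring

/-- If a relation among the generators has no constant and no linear terms, no generator is
redundant. -/
lemma notMem_adjoin_of_ker {n : ℕ} {R : Type*} [CommRing R] [Algebra ℂ R] {gens : Fin n → R}
    {r : MvPolynomial (Fin n) ℂ}
    (hker : RingHom.ker (aeval gens : MvPolynomial (Fin n) ℂ →ₐ[ℂ] R).toRingHom = Ideal.span {r})
    (i : Fin n)
    (hr : aeval (fun j => if j = i then (DualNumber.eps : DualNumber ℂ) else 0) r = 0) :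
    gens i ∉ Algebra.adjoin ℂ (Set.range fun j : {j : Fin n // j ≠ i} => gens j.1) := by
  rw [Algebra.adjoin_range_eq_range_aeval]
  rintro ⟨Q, hQ⟩
  have hmem : X i - rename Subtype.val Q ∈ Ideal.span {r} := by
    rw [← hker, RingHom.mem_ker]
    change aeval gens (X i - rename Subtype.val Q) = 0
    rw [map_sub, aeval_X, aeval_rename, ← hQ, sub_eq_zero]
    rfl
  obtain ⟨S, hS⟩ := Ideal.mem_span_singleton.1 hmem
  have h := congrArg (aeval (fun j => if j = i then (DualNumber.eps : DualNumber ℂ) else 0)) hS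
  have hzero : (fun j => if j = i then (DualNumber.eps : DualNumber ℂ) else 0) ∘
      (Subtype.val : {j : Fin n // j ≠ i} → Fin n) = fun _ => 0 := by
    funext j
    simp [j.2]
  rw [map_sub, aeval_X, aeval_rename, hzero, map_mul, hr, zero_mul, if_pos rfl,
    aeval_zero'] at h
  simpa [TrivSqZeroExt.algebraMap_eq_inl] using congrArg TrivSqZeroExt.snd h

/-! ### Polynomial functions on the representation space -/

lemma isPoly22_coord (c : Coord22) : IsPoly22 fun M => coords22 M c :=
  ⟨X c, fun M => by simp⟩

/-- The polynomial functions as a subalgebra of all functions. -/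
def polyAlg22 : Subalgebra ℂ (Rep22 → ℂ) where
  carrier := {f | IsPoly22 f}
  mul_mem' := by
    rintro f g ⟨P, hP⟩ ⟨Q, hQ⟩
    exact ⟨P * Q, fun M => by simp [hP, hQ]⟩
  add_mem' := by
    rintro f g ⟨P, hP⟩ ⟨Q, hQ⟩
    exact ⟨P + Q, fun M => by simp [hP, hQ]⟩
  algebraMap_mem' r := ⟨C r, fun M => by simp⟩

/-- The invariant ring as a subalgebra of all functions. -/
def siAlg22 : Subalgebra ℂ (Rep22 → ℂ) where
  carrier := SI22
  mul_mem' := by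
    rintro f g ⟨hf, hf'⟩ ⟨hg, hg'⟩
    refine ⟨polyAlg22.mul_mem hf hg, fun h g hh hg M => ?_⟩
    simp [hf' h g hh hg, hg' h g hh hg]
  add_mem' := by
    rintro f g ⟨hf, hf'⟩ ⟨hg, hg'⟩
    refine ⟨polyAlg22.add_mem hf hg, fun h g hh hg M => ?_⟩
    simp [hf' h g hh hg, hg' h g hh hg]
  algebraMap_mem' r := ⟨polyAlg22.algebraMap_mem r, fun _ _ _ _ _ => rfl⟩

/-- The `U`-invariant subring as a subalgebra of all functions. -/
def siuAlg22 : Subalgebra ℂ (Rep22 → ℂ) where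
  carrier := SI22U
  mul_mem' := by
    rintro f g ⟨hf, hf', hf''⟩ ⟨hg, hg', hg''⟩
    have h := siAlg22.mul_mem ⟨hf, hf'⟩ ⟨hg, hg'⟩
    exact ⟨h.1, h.2, fun x M => by simp [hf'' x, hg'' x]⟩
  add_mem' := by
    rintro f g ⟨hf, hf', hf''⟩ ⟨hg, hg', hg''⟩
    have h := siAlg22.add_mem ⟨hf, hf'⟩ ⟨hg, hg'⟩
    exact ⟨h.1, h.2, fun x M => by simp [hf'' x, hg'' x]⟩
  algebraMap_mem' r :=
    ⟨polyAlg22.algebraMap_mem r, fun _ _ _ _ _ => rfl, fun _ _ => rfl⟩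

lemma coords22_surjective (v : Coord22 → ℂ) : ∃ M : Rep22, coords22 M = v := by
  refine ⟨(Matrix.of fun r c => v (.inl (r, c)), Matrix.of fun r c => v (.inr (.inl (r, c))),
    Matrix.of fun r c => v (.inr (.inr (.inl (r, c)))),
    Matrix.of fun r c => v (.inr (.inr (.inr (r, c))))), ?_⟩
  funext c
  rcases c with ⟨r, c⟩ | ⟨r, c⟩ | ⟨r, c⟩ | ⟨r, c⟩ <;> rfl

/-- Polynomial functions agreeing where a nonzero polynomial function does not vanish are equal. -/
lemma IsPoly22.ext_of_ne_zero {d f g : Rep22 → ℂ} (hd : IsPoly22 d) (hf : IsPoly22 f)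
    (hg : IsPoly22 g) (hd0 : ∃ M, d M ≠ 0) (h : ∀ M, d M ≠ 0 → f M = g M) : f = g := by
  obtain ⟨D, hD⟩ := hd
  obtain ⟨F, hF⟩ := hf
  obtain ⟨G, hG⟩ := hg
  have hmul : D * (F - G) = 0 := by
    refine MvPolynomial.funext fun v => ?_
    obtain ⟨M, rfl⟩ := coords22_surjective v
    rw [map_mul, map_sub, ← hD, ← hF, ← hG, map_zero]
    by_cases hM : d M = 0
    · rw [hM, zero_mul]
    · rw [h M hM, sub_self, mul_zero]
  have hDne : D ≠ 0 := by
    rintro rfl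
    obtain ⟨M, hM⟩ := hd0
    exact hM (by rw [hD, map_zero])
  funext M
  rw [hF, hG, sub_eq_zero.1 ((mul_eq_zero.1 hmul).resolve_left hDne)]

lemma IsPoly22.mul_left_cancel {d f g : Rep22 → ℂ} (hd : IsPoly22 d) (hf : IsPoly22 f)
    (hg : IsPoly22 g) (hd0 : ∃ M, d M ≠ 0) (h : d * f = d * g) : f = g :=
  hd.ext_of_ne_zero hf hg hd0 fun M hM => mul_left_cancel₀ hM (congrFun h M)

/-- If the coordinates `φ x s` are fractions of elements of `A` with powers of `d` as denominators,
then so is every polynomial in them. -/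
lemma exists_pow_mul_eval_eq {T σ : Type*} (φ : T → σ → ℂ) (A : Subalgebra ℂ (T → ℂ))
    {d : T → ℂ} (hd : d ∈ A)
    (h : ∀ s, ∃ a ∈ A, ∃ k : ℕ, ∀ x, d x ≠ 0 → d x ^ k * φ x s = a x)
    (F : MvPolynomial σ ℂ) :
    ∃ a ∈ A, ∃ k : ℕ, ∀ x, d x ≠ 0 → d x ^ k * eval (φ x) F = a x := by
  induction F using MvPolynomial.induction_on with
  | C r => exact ⟨algebraMap ℂ _ r, A.algebraMap_mem r, 0, fun x _ => by simp⟩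
  | add P Q hP hQ =>
    obtain ⟨a, ha, k, hk⟩ := hP
    obtain ⟨b, hb, l, hl⟩ := hQ
    refine ⟨d ^ l * a + d ^ k * b, A.add_mem (A.mul_mem (A.pow_mem hd l) ha)
      (A.mul_mem (A.pow_mem hd k) hb), k + l, fun x hx => ?_⟩
    simp only [Pi.add_apply, Pi.mul_apply, Pi.pow_apply, ← hk x hx, ← hl x hx, map_add]
    ring
  | mul_X P s hP =>
    obtain ⟨a, ha, k, hk⟩ := hP
    obtain ⟨b, hb, l, hl⟩ := h s
    refine ⟨a * b, A.mul_mem ha hb, k + l, fun x hx => ?_⟩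
    simp only [Pi.mul_apply, ← hk x hx, ← hl x hx, map_mul, eval_X]
    ring

/-- A subalgebra closed under division by `d` within polynomial functions is closed under division
by powers of `d`. -/
lemma mem_of_pow_mul_mem {A : Subalgebra ℂ (Rep22 → ℂ)} {d : Rep22 → ℂ} (hd : IsPoly22 d)
    (hA : ∀ f, IsPoly22 f → d * f ∈ A → f ∈ A) {f : Rep22 → ℂ} (hf : IsPoly22 f) (N : ℕ)
    (h : d ^ N * f ∈ A) : f ∈ A := by
  induction N with
  | zero => simpa using h
  | succ N ih =>
    refine ih (hA _ (polyAlg22.mul_mem (polyAlg22.pow_mem hd N) hf) ?_)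
    rwa [← mul_assoc, ← pow_succ']

/-! ### The generators -/

lemma x1_apply (M : Rep22) : x1 M =
    (M.Bm 0 0 * M.A1 0 0 + M.Bm 0 1 * M.A1 1 0) * M.Bp 0 0 +
    (M.Bm 0 0 * M.A1 0 1 + M.Bm 0 1 * M.A1 1 1) * M.Bp 1 0 := by
  simp [x1, Matrix.mul_apply, Fin.sum_univ_two]

lemma x2_apply (M : Rep22) : x2 M =
    (M.Bm 0 0 * M.A2 0 0 + M.Bm 0 1 * M.A2 1 0) * M.Bp 0 0 +
    (M.Bm 0 0 * M.A2 0 1 + M.Bm 0 1 * M.A2 1 1) * M.Bp 1 0 := by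
  simp [x2, Matrix.mul_apply, Fin.sum_univ_two]

lemma x3_apply (M : Rep22) : x3 M =
    (M.Bm * M.A1) 0 0 * (M.Bm * M.A2) 0 1 - (M.Bm * M.A1) 0 1 * (M.Bm * M.A2) 0 0 := by
  simp [x3, Matrix.det_fin_two]

lemma x4_apply (M : Rep22) : x4 M =
    (M.A1 * M.Bp) 0 0 * (M.A2 * M.Bp) 1 0 - (M.A2 * M.Bp) 0 0 * (M.A1 * M.Bp) 1 0 := by
  simp [x4, Matrix.det_fin_two]

lemma x5_apply (M : Rep22) : x5 M = M.A1 0 0 * M.A1 1 1 - M.A1 0 1 * M.A1 1 0 :=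
  Matrix.det_fin_two _

lemma x6_apply (M : Rep22) : x6 M = M.A2 0 0 * M.A2 1 1 - M.A2 0 1 * M.A2 1 0 :=
  Matrix.det_fin_two _

/-- The polarized determinant `det (A₁ + A₂) - det A₁ - det A₂`. -/
def polarDet22 (M : Rep22) : ℂ := (M.A1 + M.A2).det - M.A1.det - M.A2.det

lemma polarDet22_apply (M : Rep22) : polarDet22 M =
    M.A1 0 0 * M.A2 1 1 + M.A2 0 0 * M.A1 1 1 - M.A1 0 1 * M.A2 1 0 - M.A2 0 1 * M.A1 1 0 := by
  simp only [polarDet22, Matrix.det_fin_two, Matrix.add_apply]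
  ring

lemma x3_entries (M : Rep22) : x3 M =
    (M.Bm 0 0 * M.A1 0 0 + M.Bm 0 1 * M.A1 1 0) * (M.Bm 0 0 * M.A2 0 1 + M.Bm 0 1 * M.A2 1 1) -
    (M.Bm 0 0 * M.A1 0 1 + M.Bm 0 1 * M.A1 1 1) *
      (M.Bm 0 0 * M.A2 0 0 + M.Bm 0 1 * M.A2 1 0) := by
  simp [x3_apply, Matrix.mul_apply, Fin.sum_univ_two]

lemma x4_entries (M : Rep22) : x4 M =
    (M.A1 0 0 * M.Bp 0 0 + M.A1 0 1 * M.Bp 1 0) * (M.A2 1 0 * M.Bp 0 0 + M.A2 1 1 * M.Bp 1 0) -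
    (M.A2 0 0 * M.Bp 0 0 + M.A2 0 1 * M.Bp 1 0) *
      (M.A1 1 0 * M.Bp 0 0 + M.A1 1 1 * M.Bp 1 0) := by
  simp [x4_apply, Matrix.mul_apply, Fin.sum_univ_two]

lemma x1_mul_x2_mul_polarDet22 (M : Rep22) : x1 M * x2 M * polarDet22 M =
    (x2 M) ^ 2 * x5 M + (x1 M) ^ 2 * x6 M + x3 M * x4 M := by
  rw [x1_apply, x2_apply, x3_entries, x4_entries, x5_apply, x6_apply, polarDet22_apply]
  ring

lemma Bm_mem (r c) : (fun M : Rep22 => M.Bm r c) ∈ polyAlg22 := isPoly22_coord (.inl (r, c))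
lemma A1_mem (r c) : (fun M : Rep22 => M.A1 r c) ∈ polyAlg22 :=
  isPoly22_coord (.inr (.inl (r, c)))
lemma A2_mem (r c) : (fun M : Rep22 => M.A2 r c) ∈ polyAlg22 :=
  isPoly22_coord (.inr (.inr (.inl (r, c))))
lemma Bp_mem (r c) : (fun M : Rep22 => M.Bp r c) ∈ polyAlg22 :=
  isPoly22_coord (.inr (.inr (.inr (r, c))))

lemma bilinear_mem (A : Rep22 → Matrix (Fin 2) (Fin 2) ℂ)
    (hA : ∀ r c, (fun M => A M r c) ∈ polyAlg22) :
    (fun M : Rep22 => (M.Bm * A M * M.Bp) 0 0) ∈ polyAlg22 := by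
  have : (fun M : Rep22 => (M.Bm * A M * M.Bp) 0 0) =
      ∑ j, (∑ i, (fun M : Rep22 => M.Bm 0 i) * fun M => A M i j) * fun M => M.Bp j 0 := by
    funext M
    simp [Matrix.mul_apply]
  rw [this]
  exact sum_mem fun j _ => mul_mem (sum_mem fun i _ => mul_mem (Bm_mem 0 i) (hA i j)) (Bp_mem j 0)

lemma det_mem (A : Rep22 → Matrix (Fin 2) (Fin 2) ℂ)
    (hA : ∀ r c, (fun M => A M r c) ∈ polyAlg22) : (fun M => (A M).det) ∈ polyAlg22 := by
  simp only [Matrix.det_fin_two]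
  exact sub_mem (mul_mem (hA 0 0) (hA 1 1)) (mul_mem (hA 0 1) (hA 1 0))

lemma isPoly22_x1 : IsPoly22 x1 := bilinear_mem _ A1_mem
lemma isPoly22_x2 : IsPoly22 x2 := bilinear_mem _ A2_mem
lemma isPoly22_x5 : IsPoly22 x5 := det_mem _ A1_mem
lemma isPoly22_x6 : IsPoly22 x6 := det_mem _ A2_mem

lemma isPoly22_polarDet22 : IsPoly22 polarDet22 :=
  polyAlg22.sub_mem (polyAlg22.sub_mem (det_mem _ fun r c => add_mem (A1_mem r c) (A2_mem r c))
    isPoly22_x5) isPoly22_x6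

lemma isPoly22_x3 : IsPoly22 x3 := by
  have hrow : ∀ A : Rep22 → Matrix (Fin 2) (Fin 2) ℂ, (∀ r c, (fun M => A M r c) ∈ polyAlg22) →
      ∀ c, (fun M : Rep22 => (M.Bm * A M) 0 c) ∈ polyAlg22 := by
    intro A hA c
    simp only [Matrix.mul_apply, Fin.sum_univ_two]
    exact add_mem (mul_mem (Bm_mem 0 0) (hA 0 c)) (mul_mem (Bm_mem 0 1) (hA 1 c))
  rw [show x3 = _ from funext x3_apply]
  exact polyAlg22.sub_mem (mul_mem (hrow _ A1_mem 0) (hrow _ A2_mem 1))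
    (mul_mem (hrow _ A1_mem 1) (hrow _ A2_mem 0))

lemma isPoly22_x4 : IsPoly22 x4 := by
  have hcol : ∀ A : Rep22 → Matrix (Fin 2) (Fin 2) ℂ, (∀ r c, (fun M => A M r c) ∈ polyAlg22) →
      ∀ r, (fun M : Rep22 => (A M * M.Bp) r 0) ∈ polyAlg22 := by
    intro A hA r
    simp only [Matrix.mul_apply, Fin.sum_univ_two]
    exact add_mem (mul_mem (hA r 0) (Bp_mem 0 0)) (mul_mem (hA r 1) (Bp_mem 1 0))
  rw [show x4 = _ from funext x4_apply]
  exact polyAlg22.sub_mem (mul_mem (hcol _ A1_mem 0) (hcol _ A2_mem 1))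
    (mul_mem (hcol _ A2_mem 0) (hcol _ A1_mem 1))

/-! ### Invariance of the generators -/

section Invariance

variable {h g : Matrix (Fin 2) (Fin 2) ℂ}

lemma Bm_mul_actSL (hh : h.det = 1) (M : Rep22) (A : Matrix (Fin 2) (Fin 2) ℂ) :
    M.Bm * h * (h⁻¹ * A * g) = M.Bm * A * g := by
  have hh' : IsUnit h.det := by simp [hh]
  simp only [Matrix.mul_assoc, Matrix.mul_nonsing_inv_cancel_left _ _ hh']

lemma actSL_mul_Bp (hg : g.det = 1) (M : Rep22) (A : Matrix (Fin 2) (Fin 2) ℂ) :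
    h⁻¹ * A * g * (g⁻¹ * M.Bp) = h⁻¹ * (A * M.Bp) := by
  have hg' : IsUnit g.det := by simp [hg]
  simp only [Matrix.mul_assoc, Matrix.mul_nonsing_inv_cancel_left _ _ hg']

lemma bilinear_actSL (hh : h.det = 1) (hg : g.det = 1) (M : Rep22)
    (A : Matrix (Fin 2) (Fin 2) ℂ) :
    M.Bm * h * (h⁻¹ * A * g) * (g⁻¹ * M.Bp) = M.Bm * A * M.Bp := by
  have hg' : IsUnit g.det := by simp [hg]
  rw [Bm_mul_actSL hh, Matrix.mul_assoc (M.Bm * A), Matrix.mul_nonsing_inv_cancel_left _ _ hg']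

lemma det_actSL (hh : h.det = 1) (hg : g.det = 1) (A : Matrix (Fin 2) (Fin 2) ℂ) :
    (h⁻¹ * A * g).det = A.det := by
  simp [Matrix.det_mul, Matrix.det_nonsing_inv, hh, hg]

lemma x1_mem_siAlg22 : x1 ∈ siAlg22 := ⟨isPoly22_x1, fun _ _ hh hg M =>
  congrArg (fun N : Matrix (Fin 1) (Fin 1) ℂ => N 0 0) (bilinear_actSL hh hg M M.A1)⟩

lemma x2_mem_siAlg22 : x2 ∈ siAlg22 := ⟨isPoly22_x2, fun _ _ hh hg M =>
  congrArg (fun N : Matrix (Fin 1) (Fin 1) ℂ => N 0 0) (bilinear_actSL hh hg M M.A2)⟩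

lemma x3_mem_siAlg22 : x3 ∈ siAlg22 := by
  refine ⟨isPoly22_x3, fun h g hh hg M => ?_⟩
  have h1 : (actSL h g M).Bm * (actSL h g M).A1 = M.Bm * M.A1 * g := Bm_mul_actSL hh M M.A1
  have h2 : (actSL h g M).Bm * (actSL h g M).A2 = M.Bm * M.A2 * g := Bm_mul_actSL hh M M.A2
  rw [x3_apply, x3_apply, h1, h2]
  simp only [Matrix.mul_apply (N := g), Fin.sum_univ_two]
  rw [Matrix.det_fin_two] at hg
  linear_combination ((M.Bm * M.A1) 0 0 * (M.Bm * M.A2) 0 1 -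
    (M.Bm * M.A1) 0 1 * (M.Bm * M.A2) 0 0) * hg

lemma x4_mem_siAlg22 : x4 ∈ siAlg22 := by
  refine ⟨isPoly22_x4, fun h g hh hg M => ?_⟩
  have h1 : (actSL h g M).A1 * (actSL h g M).Bp = h⁻¹ * (M.A1 * M.Bp) := actSL_mul_Bp hg M M.A1
  have h2 : (actSL h g M).A2 * (actSL h g M).Bp = h⁻¹ * (M.A2 * M.Bp) := actSL_mul_Bp hg M M.A2
  have hdet : h⁻¹.det = 1 := by simp [Matrix.det_nonsing_inv, hh]
  rw [x4_apply, x4_apply, h1, h2]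
  simp only [Matrix.mul_apply (M := h⁻¹), Fin.sum_univ_two]
  rw [Matrix.det_fin_two] at hdet
  linear_combination ((M.A1 * M.Bp) 0 0 * (M.A2 * M.Bp) 1 0 -
    (M.A2 * M.Bp) 0 0 * (M.A1 * M.Bp) 1 0) * hdet

lemma x5_mem_siAlg22 : x5 ∈ siAlg22 := ⟨isPoly22_x5, fun _ _ hh hg M => det_actSL hh hg M.A1⟩

lemma x6_mem_siAlg22 : x6 ∈ siAlg22 := ⟨isPoly22_x6, fun _ _ hh hg M => det_actSL hh hg M.A2⟩

lemma polarDet22_mem_siAlg22 : polarDet22 ∈ siAlg22 := by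
  refine ⟨isPoly22_polarDet22, fun h g hh hg M => ?_⟩
  have h3 : (actSL h g M).A1 + (actSL h g M).A2 = h⁻¹ * (M.A1 + M.A2) * g := by
    rw [Matrix.mul_add, Matrix.add_mul]
    rfl
  rw [polarDet22, h3, det_actSL hh hg]
  exact congrArg₂ (fun a b => (M.A1 + M.A2).det - a - b) (det_actSL hh hg M.A1)
    (det_actSL hh hg M.A2)

end Invariance

/-! ### The action of the unipotent group -/

lemma actW22_Bm (x : ℂ) (M : Rep22) : (actW22 !![1, x; 0, 1] M).Bm = M.Bm := rfl
lemma actW22_Bp (x : ℂ) (M : Rep22) : (actW22 !![1, x; 0, 1] M).Bp = M.Bp := rfl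
lemma actW22_A1 (x : ℂ) (M : Rep22) : (actW22 !![1, x; 0, 1] M).A1 = M.A1 := by
  simp [actW22, Rep22.A1]
lemma actW22_A2 (x : ℂ) (M : Rep22) : (actW22 !![1, x; 0, 1] M).A2 = x • M.A1 + M.A2 := by
  simp [actW22, Rep22.A1, Rep22.A2]

lemma x1_actW22 (x : ℂ) (M : Rep22) : x1 (actW22 !![1, x; 0, 1] M) = x1 M := by
  simp only [x1, actW22_A1, actW22_Bm, actW22_Bp]

lemma x2_actW22 (x : ℂ) (M : Rep22) : x2 (actW22 !![1, x; 0, 1] M) = x2 M + x * x1 M := by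
  simp only [x2_apply, x1_apply, actW22_A2, actW22_Bm, actW22_Bp, Matrix.add_apply,
    Matrix.smul_apply, smul_eq_mul]
  ring

lemma x3_actW22 (x : ℂ) (M : Rep22) : x3 (actW22 !![1, x; 0, 1] M) = x3 M := by
  simp only [x3_entries, actW22_A1, actW22_A2, actW22_Bm, Matrix.add_apply,
    Matrix.smul_apply, smul_eq_mul]
  ring

lemma x4_actW22 (x : ℂ) (M : Rep22) : x4 (actW22 !![1, x; 0, 1] M) = x4 M := by
  simp only [x4_entries, actW22_A1, actW22_A2, actW22_Bp, Matrix.add_apply,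
    Matrix.smul_apply, smul_eq_mul]
  ring

lemma x5_actW22 (x : ℂ) (M : Rep22) : x5 (actW22 !![1, x; 0, 1] M) = x5 M := by
  simp only [x5, actW22_A1]

lemma x6_actW22 (x : ℂ) (M : Rep22) : x6 (actW22 !![1, x; 0, 1] M) =
    x6 M + x * polarDet22 M + x ^ 2 * x5 M := by
  simp only [x6_apply, x5_apply, polarDet22_apply, actW22_A2, Matrix.add_apply,
    Matrix.smul_apply, smul_eq_mul]
  ring

lemma polarDet22_actW22 (x : ℂ) (M : Rep22) : polarDet22 (actW22 !![1, x; 0, 1] M) =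
    polarDet22 M + 2 * x * x5 M := by
  simp only [x5_apply, polarDet22_apply, actW22_A1, actW22_A2, Matrix.add_apply,
    Matrix.smul_apply, smul_eq_mul]
  ring

/-- The `U`-invariant `w₁ = x₁x₂° - 2x₂x₅`. -/
def wOne22 : Rep22 → ℂ := x1 * polarDet22 - (2 : ℂ) • (x2 * x5)

/-- The `U`-invariant `w₂ = x₂°² - 4x₅x₆`, the discriminant of `det (sA₁ + tA₂)`. -/
def wTwo22 : Rep22 → ℂ := polarDet22 ^ 2 - (4 : ℂ) • (x5 * x6)

lemma wOne22_apply (M : Rep22) : wOne22 M = x1 M * polarDet22 M - 2 * (x2 M * x5 M) := rfl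

lemma wTwo22_apply (M : Rep22) : wTwo22 M = polarDet22 M ^ 2 - 4 * (x5 M * x6 M) := rfl

lemma wOne22_mem_siuAlg22 : wOne22 ∈ siuAlg22 := by
  have h : wOne22 ∈ siAlg22 := siAlg22.sub_mem
    (siAlg22.mul_mem x1_mem_siAlg22 polarDet22_mem_siAlg22)
    (siAlg22.smul_mem (siAlg22.mul_mem x2_mem_siAlg22 x5_mem_siAlg22) 2)
  refine ⟨h.1, h.2, fun x M => ?_⟩
  simp only [wOne22_apply, x1_actW22, x2_actW22, x5_actW22, polarDet22_actW22]
  ring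

lemma wTwo22_mem_siuAlg22 : wTwo22 ∈ siuAlg22 := by
  have h : wTwo22 ∈ siAlg22 := siAlg22.sub_mem (siAlg22.pow_mem polarDet22_mem_siAlg22 2)
    (siAlg22.smul_mem (siAlg22.mul_mem x5_mem_siAlg22 x6_mem_siAlg22) 4)
  refine ⟨h.1, h.2, fun x M => ?_⟩
  simp only [wTwo22_apply, x6_actW22, x5_actW22, polarDet22_actW22]
  ring

lemma x2_mul_wOne22 (M : Rep22) :
    x2 M * wOne22 M = x3 M * x4 M + (x1 M) ^ 2 * x6 M - (x2 M) ^ 2 * x5 M := by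
  rw [wOne22_apply]
  linear_combination x1_mul_x2_mul_polarDet22 M

/-! ### Normal forms -/

/-- The normal form of a representation with `x₁ ≠ 0`, in terms of `x₁, …, x₅, x₂°`. -/
def normalForm22 (a b c d e f : ℂ) : Rep22 :=
  (!![1, 0], !![a, 0; 0, e / a], !![b, c / a; d / a, (f - b * e / a) / a], !![1; 0])

section NormalForm

variable {a b c d e f : ℂ}

lemma x1_normalForm22 : x1 (normalForm22 a b c d e f) = a := by
  simp [x1_apply, normalForm22, Rep22.Bm, Rep22.A1, Rep22.Bp]

lemma x2_normalForm22 : x2 (normalForm22 a b c d e f) = b := by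
  simp [x2_apply, normalForm22, Rep22.Bm, Rep22.A2, Rep22.Bp]

lemma x3_normalForm22 (ha : a ≠ 0) : x3 (normalForm22 a b c d e f) = c := by
  simp [x3_entries, normalForm22, Rep22.Bm, Rep22.A1, Rep22.A2]
  field_simp

lemma x4_normalForm22 (ha : a ≠ 0) : x4 (normalForm22 a b c d e f) = d := by
  simp [x4_entries, normalForm22, Rep22.Bp, Rep22.A1, Rep22.A2]
  field_simp

lemma x5_normalForm22 (ha : a ≠ 0) : x5 (normalForm22 a b c d e f) = e := by
  simp [x5_apply, normalForm22, Rep22.A1]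
  field_simp

lemma polarDet22_normalForm22 (ha : a ≠ 0) : polarDet22 (normalForm22 a b c d e f) = f := by
  simp [polarDet22_apply, normalForm22, Rep22.A1, Rep22.A2]
  field_simp
  ring

lemma x6_normalForm22 (ha : a ≠ 0) :
    x6 (normalForm22 a b c d e f) = (a * b * f - b ^ 2 * e - c * d) / a ^ 2 := by
  simp [x6_apply, normalForm22, Rep22.A2]
  field_simp

end NormalForm

/-- A representation with `x₁ ≠ 0` is `SL`-equivalent to its normal form. -/
lemma exists_actSL_eq_normalForm22 (M : Rep22) (hM : x1 M ≠ 0) :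
    ∃ h g : Matrix (Fin 2) (Fin 2) ℂ, h.det = 1 ∧ g.det = 1 ∧
      actSL h g M = normalForm22 (x1 M) (x2 M) (x3 M) (x4 M) (x5 M) (polarDet22 M) := by
  set h : Matrix (Fin 2) (Fin 2) ℂ := !![(M.A1 0 0 * M.Bp 0 0 + M.A1 0 1 * M.Bp 1 0) / x1 M,
    -M.Bm 0 1; (M.A1 1 0 * M.Bp 0 0 + M.A1 1 1 * M.Bp 1 0) / x1 M, M.Bm 0 0] with hh_def
  set g : Matrix (Fin 2) (Fin 2) ℂ := !![M.Bp 0 0,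
    -(M.Bm 0 0 * M.A1 0 1 + M.Bm 0 1 * M.A1 1 1) / x1 M;
    M.Bp 1 0, (M.Bm 0 0 * M.A1 0 0 + M.Bm 0 1 * M.A1 1 0) / x1 M] with hg_def
  have hh : h.det = 1 := by
    rw [hh_def, Matrix.det_fin_two_of]
    field_simp
    rw [x1_apply]
    ring
  have hg : g.det = 1 := by
    rw [hg_def, Matrix.det_fin_two_of]
    field_simp
    rw [x1_apply]
    ring
  have hhu : IsUnit h.det := by simp [hh]
  have hgu : IsUnit g.det := by simp [hg]
  refine ⟨h, g, hh, hg, Prod.ext ?_ (Prod.ext ?_ (Prod.ext ?_ ?_))⟩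
  · change M.Bm * h = !![1, 0]
    ext i j
    fin_cases i; fin_cases j
    · simp [hh_def, Matrix.mul_apply, Fin.sum_univ_two]
      field_simp
      rw [x1_apply]
      ring
    · simp [hh_def, Matrix.mul_apply, Fin.sum_univ_two]
      ring
  · change h⁻¹ * M.A1 * g = !![x1 M, 0; 0, x5 M / x1 M]
    rw [Matrix.mul_assoc, ← Matrix.nonsing_inv_mul_cancel_left h !![x1 M, 0; 0, x5 M / x1 M] hhu]
    congr 1
    ext i j
    fin_cases i <;> fin_cases j <;>
      simp [hh_def, hg_def, Matrix.mul_apply, Fin.sum_univ_two] <;> field_simp <;>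
      simp only [x5_apply] <;> ring
  · change h⁻¹ * M.A2 * g = !![x2 M, x3 M / x1 M; x4 M / x1 M,
      (polarDet22 M - x2 M * x5 M / x1 M) / x1 M]
    rw [Matrix.mul_assoc, ← Matrix.nonsing_inv_mul_cancel_left h !![x2 M, x3 M / x1 M; x4 M / x1 M,
      (polarDet22 M - x2 M * x5 M / x1 M) / x1 M] hhu]
    congr 1
    ext i j
    fin_cases i <;> fin_cases j <;>
      simp [hh_def, hg_def, Matrix.mul_apply, Fin.sum_univ_two] <;> field_simp <;>
      simp only [x1_apply, x2_apply, x3_entries, x4_entries, x5_apply, polarDet22_apply] <;> ring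
  · change g⁻¹ * M.Bp = !![1; 0]
    rw [← Matrix.nonsing_inv_mul_cancel_left g !![(1 : ℂ); 0] hgu]
    congr 1
    ext i j
    fin_cases i <;> fin_cases j <;> simp [hg_def, Matrix.mul_apply, Fin.sum_univ_two]

lemma exists_x1_mul_x2_ne_zero : ∃ M, (x1 * x2) M ≠ 0 :=
  ⟨normalForm22 1 1 0 0 0 0, by simp [x1_normalForm22, x2_normalForm22]⟩

lemma exists_x1_ne_zero : ∃ M, x1 M ≠ 0 := exists_x1_mul_x2_ne_zero.imp fun _ => left_ne_zero_of_mul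

lemma exists_x2_ne_zero : ∃ M, x2 M ≠ 0 :=
  exists_x1_mul_x2_ne_zero.imp fun _ => right_ne_zero_of_mul

lemma x1_sq_mul_wTwo22 (M : Rep22) :
    (x1 M) ^ 2 * wTwo22 M = (wOne22 M) ^ 2 + 4 * (x3 M * x4 M * x5 M) := by
  rw [wOne22_apply, wTwo22_apply]
  linear_combination (4 * x5 M) * x1_mul_x2_mul_polarDet22 M

/-- A polynomial function determined by its values on normal forms whose parameters lie in `A` is
a fraction of an element of `A` by a power of the first parameter. -/
lemma exists_pow_mul_mem_of_normalForm22 {A : Subalgebra ℂ (Rep22 → ℂ)} (hA : A ≤ polyAlg22)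
    {a b c d e m f : Rep22 → ℂ} (ha : a ∈ A) (hb : b ∈ A) (hc : c ∈ A) (hd : d ∈ A) (he : e ∈ A)
    (hm : m ∈ A) (ha0 : ∃ M, a M ≠ 0) (hf : IsPoly22 f)
    (h : ∀ M, a M ≠ 0 → f M = f (normalForm22 (a M) (b M) (c M) (d M) (e M) (m M / a M))) :
    ∃ N : ℕ, a ^ N * f ∈ A := by
  obtain ⟨F, hF⟩ := hf
  obtain ⟨y, hy, N, hN⟩ := exists_pow_mul_eval_eq
    (fun M => coords22 (normalForm22 (a M) (b M) (c M) (d M) (e M) (m M / a M))) A ha (by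
      have hconst : ∀ r : ℂ, ∃ y ∈ A, ∃ k : ℕ, ∀ M, a M ≠ 0 → a M ^ k * r = y M := fun r =>
        ⟨algebraMap ℂ _ r, A.algebraMap_mem r, 0, fun M _ => by simp⟩
      have hself : ∀ g ∈ A, ∃ y ∈ A, ∃ k : ℕ, ∀ M, a M ≠ 0 → a M ^ k * g M = y M := fun g hg =>
        ⟨g, hg, 0, fun M _ => by simp⟩
      have hdiv : ∀ g ∈ A, ∃ y ∈ A, ∃ k : ℕ, ∀ M, a M ≠ 0 → a M ^ k * (g M / a M) = y M :=
        fun g hg => ⟨g, hg, 1, fun M hM => by field_simp⟩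
      rintro (⟨r, c⟩ | ⟨r, c⟩ | ⟨r, c⟩ | ⟨r, c⟩) <;> fin_cases r <;> fin_cases c
      · exact hconst 1
      · exact hconst 0
      · exact hself _ ha
      · exact hconst 0
      · exact hconst 0
      · exact hdiv _ he
      · exact hself _ hb
      · exact hdiv _ hc
      · exact hdiv _ hd
      · refine ⟨m - b * e, A.sub_mem hm (A.mul_mem hb he), 2, fun M hM => ?_⟩
        change a M ^ 2 * ((m M / a M - b M * e M / a M) / a M) = m M - b M * e M
        field_simp
      · exact hconst 1
      · exact hconst 0) F
  refine ⟨N, ?_⟩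
  have : a ^ N * f = y := (hA ha).ext_of_ne_zero
    (polyAlg22.mul_mem (polyAlg22.pow_mem (hA ha) N) ⟨F, hF⟩) (hA hy) ha0 fun M hM => by
      rw [← hN M hM, ← hF, ← h M hM]
      rfl
  rwa [this]

/-- A representation with `x₁ = 0` and prescribed `x₂ ≠ 0`, `x₃`, `x₄`, `x₆`, `x₂°`. -/
def boundaryForm22 (b c d e f : ℂ) : Rep22 :=
  (!![1, 0], !![0, -c / b; -d / b, f / b], !![b, 0; 0, e / b], !![1; 0])

section BoundaryForm

variable {b c d e f : ℂ}

lemma x1_boundaryForm22 : x1 (boundaryForm22 b c d e f) = 0 := by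
  simp [x1_apply, boundaryForm22, Rep22.Bm, Rep22.A1, Rep22.Bp]

lemma x2_boundaryForm22 : x2 (boundaryForm22 b c d e f) = b := by
  simp [x2_apply, boundaryForm22, Rep22.Bm, Rep22.A2, Rep22.Bp]

lemma x3_boundaryForm22 (hb : b ≠ 0) : x3 (boundaryForm22 b c d e f) = c := by
  simp [x3_entries, boundaryForm22, Rep22.Bm, Rep22.A1, Rep22.A2]
  field_simp

lemma x4_boundaryForm22 (hb : b ≠ 0) : x4 (boundaryForm22 b c d e f) = d := by
  simp [x4_entries, boundaryForm22, Rep22.Bp, Rep22.A1, Rep22.A2]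
  field_simp

lemma x5_boundaryForm22 : x5 (boundaryForm22 b c d e f) = -(c * d) / b ^ 2 := by
  simp [x5_apply, boundaryForm22, Rep22.A1]
  field_simp

lemma x6_boundaryForm22 (hb : b ≠ 0) : x6 (boundaryForm22 b c d e f) = e := by
  simp [x6_apply, boundaryForm22, Rep22.A2]
  field_simp

lemma polarDet22_boundaryForm22 (hb : b ≠ 0) : polarDet22 (boundaryForm22 b c d e f) = f := by
  simp [polarDet22_apply, boundaryForm22, Rep22.A1, Rep22.A2]
  field_simp

end BoundaryForm

/-! ### The presentations -/

lemma aeval_apply_eq_eval {n : ℕ} (gens : Fin n → Rep22 → ℂ) (P : MvPolynomial (Fin n) ℂ)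
    (M : Rep22) : aeval gens P M = eval (fun i => gens i M) P := by
  have : (Pi.evalAlgHom ℂ (fun _ : Rep22 => ℂ) M).comp (aeval gens) =
      aeval fun i => gens i M := by
    ext i
    simp
  simpa [aeval_eq_eval] using DFunLike.congr_fun this P

lemma range_aeval_le {n : ℕ} {gens : Fin n → Rep22 → ℂ} {A : Subalgebra ℂ (Rep22 → ℂ)}
    (h : ∀ i, gens i ∈ A) :
    (aeval gens : MvPolynomial (Fin n) ℂ →ₐ[ℂ] (Rep22 → ℂ)).range ≤ A := by
  rw [← Algebra.adjoin_range_eq_range_aeval]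
  exact Algebra.adjoin_le (Set.range_subset_iff.2 h)

/-- The kernel of the evaluation at `gens` is generated by an irreducible relation, if all points of
the zero locus of the relation outside another hypersurface are values of `gens`. -/
lemma ker_aeval_eq_span {n : ℕ} {gens : Fin n → Rep22 → ℂ} {r : MvPolynomial (Fin n) ℂ}
    (q : MvPolynomial (Fin n) ℂ) (hr : Irreducible r) (hr0 : aeval gens r = 0)
    (hq : ∃ t, eval t r = 0 ∧ eval t q ≠ 0)
    (hsurj : ∀ t, eval t r = 0 → eval t q ≠ 0 → ∃ M, (fun i => gens i M) = t) :
    RingHom.ker (aeval gens : MvPolynomial (Fin n) ℂ →ₐ[ℂ] (Rep22 → ℂ)).toRingHom =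
      Ideal.span {r} := by
  refine le_antisymm (fun P hP => ?_) ?_
  · have hP0 : aeval gens P = 0 := hP
    refine Ideal.mem_span_singleton.2 (hr.dvd_of_eval_eq_zero hq fun t ht htq => ?_)
    obtain ⟨M, rfl⟩ := hsurj t ht htq
    rw [← aeval_apply_eq_eval, hP0]
    rfl
  · rw [Ideal.span_singleton_le_iff_mem]
    exact hr0

/-- Suppose that `r = h + X i * s` is a relation among `gens` with `h` irreducible, and that all
points of the zero locus of `h` in the hyperplane `X i = 0` (outside another hypersurface) are
values of `gens`. Then the algebra generated by `gens` is closed under division by `gens i`. -/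
lemma mem_range_of_mul_mem_range {n : ℕ} {gens : Fin n → Rep22 → ℂ} (i : Fin n)
    (h s q : MvPolynomial (Fin n) ℂ) (hpoly : ∀ j, gens j ∈ polyAlg22) (hi : ∃ M, gens i M ≠ 0)
    (hirr : Irreducible h) (hrel : aeval gens (h + X i * s) = 0)
    (hq : ∃ t, eval t h = 0 ∧ eval t q ≠ 0)
    (hsurj : ∀ t, eval t h = 0 → eval t q ≠ 0 →
      ∃ M, (fun j => gens j M) = Function.update t i 0)
    {f : Rep22 → ℂ} (hf : IsPoly22 f)
    (hmem : gens i * f ∈ (aeval gens : MvPolynomial (Fin n) ℂ →ₐ[ℂ] (Rep22 → ℂ)).range) :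
    f ∈ (aeval gens : MvPolynomial (Fin n) ℂ →ₐ[ℂ] (Rep22 → ℂ)).range := by
  obtain ⟨P, hP⟩ := hmem
  obtain ⟨Q, hQ⟩ := X_dvd_sub_aeval_update i P
  obtain ⟨S, hS⟩ : h ∣ aeval (Function.update X i 0) P := by
    refine hirr.dvd_of_eval_eq_zero hq fun t ht htq => ?_
    obtain ⟨M, hM⟩ := hsurj t ht htq
    have hMi : gens i M = 0 := by simpa using congrFun hM i
    rw [eval_aeval_update, ← hM, ← aeval_apply_eq_eval]
    refine (congrFun hP M).trans ?_
    rw [Pi.mul_apply, hMi, zero_mul]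
  have hPQ : P = X i * (Q - s * S) + (h + X i * s) * S := by
    linear_combination hQ + hS
  have hval : gens i * f = gens i * aeval gens (Q - s * S) := by
    refine hP.symm.trans ?_
    change aeval gens P = _
    conv_lhs => rw [hPQ]
    rw [map_add, map_mul, map_mul, hrel, zero_mul, add_zero, aeval_X]
  exact ⟨Q - s * S, ((hpoly i).mul_left_cancel hf (range_aeval_le hpoly ⟨_, rfl⟩) hi hval).symm⟩

/-- The generators `x₁, …, x₆, x₂°` of the invariant ring. -/
def gens22 : Fin 7 → Rep22 → ℂ := ![x1, x2, x3, x4, x5, x6, polarDet22]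

lemma gens22_mem_siAlg22 (i : Fin 7) : gens22 i ∈ siAlg22 := by
  fin_cases i
  exacts [x1_mem_siAlg22, x2_mem_siAlg22, x3_mem_siAlg22, x4_mem_siAlg22, x5_mem_siAlg22,
    x6_mem_siAlg22, polarDet22_mem_siAlg22]

lemma aeval_gens22_relation : aeval gens22 ((X 1) ^ 2 * X 4 + (X 0) ^ 2 * X 5 + X 2 * X 3
    - X 0 * X 1 * X 6 : MvPolynomial (Fin 7) ℂ) = 0 := by
  funext M
  simp [gens22]
  linear_combination -x1_mul_x2_mul_polarDet22 M

lemma range_aeval_gens22 :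
    (aeval gens22 : MvPolynomial (Fin 7) ℂ →ₐ[ℂ] (Rep22 → ℂ)).range = siAlg22 := by
  refine le_antisymm (range_aeval_le gens22_mem_siAlg22) fun f hf => ?_
  have hpoly : ∀ i, gens22 i ∈ polyAlg22 := fun i => (gens22_mem_siAlg22 i).1
  have hgen : ∀ i, gens22 i ∈ (aeval gens22 : MvPolynomial (Fin 7) ℂ →ₐ[ℂ] (Rep22 → ℂ)).range :=
    fun i => ⟨X i, aeval_X _ i⟩
  obtain ⟨N, hN⟩ := exists_pow_mul_mem_of_normalForm22 (range_aeval_le hpoly) (hgen 0) (hgen 1)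
    (hgen 2) (hgen 3) (hgen 4) (mul_mem (hgen 0) (hgen 6)) exists_x1_ne_zero hf.1 (by
      intro M hM
      obtain ⟨h, g, hh, hg, hM'⟩ := exists_actSL_eq_normalForm22 M hM
      rw [← hf.2 h g hh hg M, hM', Pi.mul_apply, mul_div_cancel_left₀ _ hM]
      rfl)
  refine mem_of_pow_mul_mem isPoly22_x1 (fun f hf hmem => mem_range_of_mul_mem_range 0
    ((X 1) ^ 2 * X 4 + X 2 * X 3) (X 0 * X 5 - X 1 * X 6) (X 1) hpoly exists_x1_ne_zero
    irreducible_relation_mod_x1 ?_ ⟨![0, 1, 0, 0, 0, 0, 0], by simp, by simp⟩ ?_ hf hmem) hf.1 N hN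
  · rw [← aeval_gens22_relation]
    congr 1
    ring
  · intro t ht ht1
    simp only [map_add, map_mul, map_pow, eval_X] at ht ht1
    refine ⟨boundaryForm22 (t 1) (t 2) (t 3) (t 5) (t 6), ?_⟩
    funext i
    fin_cases i
    · exact x1_boundaryForm22
    · exact x2_boundaryForm22
    · exact x3_boundaryForm22 ht1
    · exact x4_boundaryForm22 ht1
    · refine x5_boundaryForm22.trans ?_
      change _ = t 4
      field_simp
      linear_combination -ht
    · exact x6_boundaryForm22 ht1
    · exact polarDet22_boundaryForm22 ht1

lemma ker_aeval_gens22 :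
    RingHom.ker (aeval gens22 : MvPolynomial (Fin 7) ℂ →ₐ[ℂ] (Rep22 → ℂ)).toRingHom =
      Ideal.span {(X 1) ^ 2 * X 4 + (X 0) ^ 2 * X 5 + X 2 * X 3 - X 0 * X 1 * X 6} := by
  refine ker_aeval_eq_span (X 0) irreducible_relation aeval_gens22_relation
    ⟨![1, 0, 0, 0, 0, 0, 0], by simp, by simp⟩ fun t ht ht0 => ?_
  simp only [map_add, map_sub, map_mul, map_pow, eval_X] at ht ht0
  refine ⟨normalForm22 (t 0) (t 1) (t 2) (t 3) (t 4) (t 6), ?_⟩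
  funext i
  fin_cases i
  · exact x1_normalForm22
  · exact x2_normalForm22
  · exact x3_normalForm22 ht0
  · exact x4_normalForm22 ht0
  · exact x5_normalForm22 ht0
  · refine (x6_normalForm22 ht0).trans ?_
    change _ = t 5
    field_simp
    linear_combination -ht
  · exact polarDet22_normalForm22 ht0

/-- The generators `w₁, w₂, x₁, x₃, x₄, x₅` of the `U`-invariant subring. -/
def gensU22 : Fin 6 → Rep22 → ℂ := ![wOne22, wTwo22, x1, x3, x4, x5]

lemma gensU22_mem_siuAlg22 (i : Fin 6) : gensU22 i ∈ siuAlg22 := by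
  fin_cases i
  exacts [wOne22_mem_siuAlg22, wTwo22_mem_siuAlg22,
    ⟨x1_mem_siAlg22.1, x1_mem_siAlg22.2, x1_actW22⟩,
    ⟨x3_mem_siAlg22.1, x3_mem_siAlg22.2, x3_actW22⟩,
    ⟨x4_mem_siAlg22.1, x4_mem_siAlg22.2, x4_actW22⟩,
    ⟨x5_mem_siAlg22.1, x5_mem_siAlg22.2, x5_actW22⟩]

lemma aeval_gensU22_relation :
    aeval gensU22 ((X 0) ^ 2 + 4 * (X 3 * X 4 * X 5) - X 1 * (X 2) ^ 2 :
      MvPolynomial (Fin 6) ℂ) = 0 := by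
  funext M
  simp [gensU22]
  linear_combination -x1_sq_mul_wTwo22 M

/-- A `U`-invariant semi-invariant is determined by its values on normal forms with `x₂ = 0`. -/
lemma apply_eq_normalForm22_of_mem_siuAlg22 {f : Rep22 → ℂ} (hf : f ∈ siuAlg22) (M : Rep22)
    (hM : x1 M ≠ 0) :
    f M = f (normalForm22 (x1 M) 0 (x3 M) (x4 M) (x5 M) (wOne22 M / x1 M)) := by
  have hx1 := x1_actW22 (-(x2 M / x1 M)) M
  have hx2 : x2 (actW22 !![1, -(x2 M / x1 M); 0, 1] M) = 0 := by
    rw [x2_actW22]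
    field_simp
    ring
  have hp : polarDet22 (actW22 !![1, -(x2 M / x1 M); 0, 1] M) = wOne22 M / x1 M := by
    rw [polarDet22_actW22, wOne22_apply]
    field_simp
    ring
  obtain ⟨h, g, hh, hg, hM'⟩ := exists_actSL_eq_normalForm22
    (actW22 !![1, -(x2 M / x1 M); 0, 1] M) (by rwa [hx1])
  rw [hx1, hx2, x3_actW22, x4_actW22, x5_actW22, hp] at hM'
  rw [← hM', hf.2.1 h g hh hg, hf.2.2]

lemma range_aeval_gensU22 :
    (aeval gensU22 : MvPolynomial (Fin 6) ℂ →ₐ[ℂ] (Rep22 → ℂ)).range = siuAlg22 := by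
  refine le_antisymm (range_aeval_le gensU22_mem_siuAlg22) fun f hf => ?_
  have hpoly : ∀ i, gensU22 i ∈ polyAlg22 := fun i => (gensU22_mem_siuAlg22 i).1
  have hgen : ∀ i, gensU22 i ∈ (aeval gensU22 : MvPolynomial (Fin 6) ℂ →ₐ[ℂ] (Rep22 → ℂ)).range :=
    fun i => ⟨X i, aeval_X _ i⟩
  obtain ⟨N, hN⟩ := exists_pow_mul_mem_of_normalForm22 (range_aeval_le hpoly) (hgen 2)
    (zero_mem _) (hgen 3) (hgen 4) (hgen 5) (hgen 0) exists_x1_ne_zero hf.1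
    (apply_eq_normalForm22_of_mem_siuAlg22 hf)
  refine mem_of_pow_mul_mem isPoly22_x1 (fun f hf hmem => mem_range_of_mul_mem_range 2
    ((X 0) ^ 2 + 4 * (X 3 * X 4 * X 5)) (-(X 1 * X 2)) (X 0 * X 5) hpoly exists_x1_ne_zero
    irreducible_relationU_mod_x1 ?_ ⟨![2, 0, 0, 1, 1, -1], by simp; norm_num, by simp⟩
    ?_ hf hmem) hf.1 N hN
  · rw [← aeval_gensU22_relation]
    congr 1
    ring
  · intro t ht htq
    simp only [map_add, map_mul, map_pow, eval_X, map_ofNat] at ht htq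
    have h0 : t 0 ≠ 0 := left_ne_zero_of_mul htq
    have h5 : t 5 ≠ 0 := right_ne_zero_of_mul htq
    have hb : -(t 0 / (2 * t 5)) ≠ 0 := by simp [h0, h5]
    have hx5 : x5 (boundaryForm22 (-(t 0 / (2 * t 5))) (t 3) (t 4) (-(t 1 / (4 * t 5))) 0) =
        t 5 := by
      rw [x5_boundaryForm22]
      field_simp
      linear_combination -ht
    refine ⟨boundaryForm22 (-(t 0 / (2 * t 5))) (t 3) (t 4) (-(t 1 / (4 * t 5))) 0, ?_⟩
    funext i
    fin_cases i
    · change wOne22 _ = t 0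
      rw [wOne22_apply, x1_boundaryForm22, x2_boundaryForm22, hx5]
      field_simp
      ring
    · change wTwo22 _ = t 1
      rw [wTwo22_apply, hx5, x6_boundaryForm22 hb, polarDet22_boundaryForm22 hb]
      field_simp
      ring
    · exact x1_boundaryForm22
    · exact x3_boundaryForm22 hb
    · exact x4_boundaryForm22 hb
    · exact hx5

lemma ker_aeval_gensU22 :
    RingHom.ker (aeval gensU22 : MvPolynomial (Fin 6) ℂ →ₐ[ℂ] (Rep22 → ℂ)).toRingHom =
      Ideal.span {(X 0) ^ 2 + 4 * (X 3 * X 4 * X 5) - X 1 * (X 2) ^ 2} := by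
  refine ker_aeval_eq_span (X 2) irreducible_relationU aeval_gensU22_relation
    ⟨![0, 0, 1, 0, 0, 0], by simp, by simp⟩ fun t ht ht2 => ?_
  simp only [map_add, map_sub, map_mul, map_pow, eval_X, map_ofNat] at ht ht2
  refine ⟨normalForm22 (t 2) 0 (t 3) (t 4) (t 5) (t 0 / t 2), ?_⟩
  funext i
  fin_cases i
  · change wOne22 _ = t 0
    rw [wOne22_apply, x1_normalForm22, x2_normalForm22, polarDet22_normalForm22 ht2]
    field_simp
    ring
  · change wTwo22 _ = t 1
    rw [wTwo22_apply, x5_normalForm22 ht2, x6_normalForm22 ht2, polarDet22_normalForm22 ht2]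
    field_simp
    linear_combination ht
  · exact x1_normalForm22
  · exact x3_normalForm22 ht2
  · exact x4_normalForm22 ht2
  · exact x5_normalForm22 ht2

lemma eq_polarDet22 {f : Rep22 → ℂ} (hf : IsPoly22 f) (h : ∀ M, x1 M * x2 M * f M =
    (x2 M) ^ 2 * x5 M + (x1 M) ^ 2 * x6 M + x3 M * x4 M) : f = polarDet22 := by
  have hd : IsPoly22 (x1 * x2) := polyAlg22.mul_mem isPoly22_x1 isPoly22_x2
  have hx : x1 * x2 * f = x1 * x2 * polarDet22 := by
    funext M
    simp only [Pi.mul_apply, h M, x1_mul_x2_mul_polarDet22 M]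
  exact hd.mul_left_cancel hf isPoly22_polarDet22 exists_x1_mul_x2_ne_zero hx

lemma eq_wOne22 {f : Rep22 → ℂ} (hf : IsPoly22 f) (h : ∀ M, x2 M * f M =
    x3 M * x4 M + (x1 M) ^ 2 * x6 M - (x2 M) ^ 2 * x5 M) : f = wOne22 := by
  have hx : x2 * f = x2 * wOne22 := by
    funext M
    simp only [Pi.mul_apply, h M, x2_mul_wOne22 M]
  exact isPoly22_x2.mul_left_cancel hf wOne22_mem_siuAlg22.1 exists_x2_ne_zero hx

lemma eq_wTwo22 {f : Rep22 → ℂ} (hf : IsPoly22 f) (h : ∀ M, (x1 M) ^ 2 * f M =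
    (wOne22 M) ^ 2 + 4 * (x3 M * x4 M * x5 M)) : f = wTwo22 := by
  refine isPoly22_x1.ext_of_ne_zero hf wTwo22_mem_siuAlg22.1 exists_x1_ne_zero fun M hM =>
    mul_left_cancel₀ (pow_ne_zero 2 hM) ?_
  rw [h M, x1_sq_mul_wTwo22 M]

/-- **Statement 19**: with `x₂° = (x₂²x₅ + x₁²x₆ + x₃x₄)/(x₁x₂)` (a polynomial
semi-invariant), `SI_{β₂}(K^2_{2,2})` is minimally presented as
`k[x₁,…,x₆,x₂°]/(x₂²x₅ + x₁²x₆ + x₃x₄ − x₁x₂x₂°)`; and with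
`w₁ = (x₃x₄ + x₁²x₆)/x₂ − x₂x₅` and `w₂ = (w₁² + 4x₃x₄x₅)/x₁²` (polynomial `U`-invariants),
`SI_{β₂}(K^2_{2,2})^U` is minimally presented as
`k[w₁,w₂,x₁,x₃,x₄,x₅]/(w₁² + 4x₃x₄x₅ − w₂x₁²)`. -/
theorem statement19 :
    (∃ x2o : Rep22 → ℂ, IsPoly22 x2o ∧
      ∀ M, x1 M * x2 M * x2o M = (x2 M)^2 * x5 M + (x1 M)^2 * x6 M + x3 M * x4 M) ∧
    (∀ x2o : Rep22 → ℂ, IsPoly22 x2o →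
      (∀ M, x1 M * x2 M * x2o M = (x2 M)^2 * x5 M + (x1 M)^2 * x6 M + x3 M * x4 M) →
      x2o ∈ SI22 ∧
      (letI gens : Fin 7 → (Rep22 → ℂ) := ![x1, x2, x3, x4, x5, x6, x2o]
       Set.range (aeval gens : MvPolynomial (Fin 7) ℂ →ₐ[ℂ] (Rep22 → ℂ)) = SI22 ∧
       RingHom.ker (aeval gens : MvPolynomial (Fin 7) ℂ →ₐ[ℂ] (Rep22 → ℂ)).toRingHom =
         Ideal.span {(X 1)^2 * X 4 + (X 0)^2 * X 5 + X 2 * X 3 - X 0 * X 1 * X 6} ∧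
       ∀ i : Fin 7, gens i ∉
         Algebra.adjoin ℂ (Set.range fun j : {j : Fin 7 // j ≠ i} => gens j.1))) ∧
    (∃ w1 w2 : Rep22 → ℂ, IsPoly22 w1 ∧ IsPoly22 w2 ∧
      (∀ M, x2 M * w1 M = x3 M * x4 M + (x1 M)^2 * x6 M - (x2 M)^2 * x5 M) ∧
      (∀ M, (x1 M)^2 * w2 M = (w1 M)^2 + 4 * (x3 M * x4 M * x5 M))) ∧
    (∀ w1 w2 : Rep22 → ℂ, IsPoly22 w1 → IsPoly22 w2 →
      (∀ M, x2 M * w1 M = x3 M * x4 M + (x1 M)^2 * x6 M - (x2 M)^2 * x5 M) →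
      (∀ M, (x1 M)^2 * w2 M = (w1 M)^2 + 4 * (x3 M * x4 M * x5 M)) →
      w1 ∈ SI22U ∧ w2 ∈ SI22U ∧
      (letI gens : Fin 6 → (Rep22 → ℂ) := ![w1, w2, x1, x3, x4, x5]
       Set.range (aeval gens : MvPolynomial (Fin 6) ℂ →ₐ[ℂ] (Rep22 → ℂ)) = SI22U ∧
       RingHom.ker (aeval gens : MvPolynomial (Fin 6) ℂ →ₐ[ℂ] (Rep22 → ℂ)).toRingHom =
         Ideal.span {(X 0)^2 + 4 * (X 3 * X 4 * X 5) - X 1 * (X 2)^2} ∧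
       ∀ i : Fin 6, gens i ∉
         Algebra.adjoin ℂ (Set.range fun j : {j : Fin 6 // j ≠ i} => gens j.1))) := by
  refine ⟨⟨polarDet22, isPoly22_polarDet22, x1_mul_x2_mul_polarDet22⟩, ?_,
    ⟨wOne22, wTwo22, wOne22_mem_siuAlg22.1, wTwo22_mem_siuAlg22.1, x2_mul_wOne22,
      x1_sq_mul_wTwo22⟩, ?_⟩
  · intro x2o hx2o hx2o'
    obtain rfl := eq_polarDet22 hx2o hx2o'
    refine ⟨polarDet22_mem_siAlg22, congrArg SetLike.coe range_aeval_gens22, ker_aeval_gens22,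
      fun i => notMem_adjoin_of_ker ker_aeval_gens22 i ?_⟩
    fin_cases i <;> simp [pow_two]
  · intro w1 w2 hw1 hw2 hw1' hw2'
    obtain rfl := eq_wOne22 hw1 hw1'
    obtain rfl := eq_wTwo22 hw2 hw2'
    refine ⟨wOne22_mem_siuAlg22, wTwo22_mem_siuAlg22, congrArg SetLike.coe range_aeval_gensU22,
      ker_aeval_gensU22, fun i => notMem_adjoin_of_ker ker_aeval_gensU22 i ?_⟩
    fin_cases i <;> simp [pow_two]
end
end
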